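/- Let d ≥ 2, 1 < p < ∞ and ρ > 0, and let V be a locally bounded measurable function on B_ρ \ {0} ⊆ ℝ^d such that the function x ↦ ‖x‖^p V(x) is continuous on B_ρ \ {0} and lim_{x → 0} ‖x‖^p V(x) = 0. Then for any two positive C¹ weak solutions u, v of -Δ_p w + V|w|^{p-2}w = 0 in B_ρ \ {0}, the limit lim_{x → 0} u(x)/v(x) exists in the extended interval [0, +∞]. -/

import Mathlib

open MeasureTheory Metric Filter Topology Set
open scoped RealInnerProductSpace ENNReal

noncomputable section

/-- `u` is a positive `C¹` weak solution of `-Δ_p u + V|u|^{p-2}u = 0` in the open set `Ω`. -/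
def IsPosWeakSol {d : ℕ} (p : ℝ) (V : EuclideanSpace ℝ (Fin d) → ℝ)
    (Ω : Set (EuclideanSpace ℝ (Fin d))) (u : EuclideanSpace ℝ (Fin d) → ℝ) : Prop :=
  ContDiffOn ℝ 1 u Ω ∧ (∀ x ∈ Ω, 0 < u x) ∧
  ∀ φ : EuclideanSpace ℝ (Fin d) → ℝ, ContDiff ℝ (⊤ : ℕ∞) φ → HasCompactSupport φ →
    tsupport φ ⊆ Ω →
    ∫ x in Ω, (‖gradient u x‖ ^ (p - 2) * ⟪gradient u x, gradient φ x⟫ +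
      V x * |u x| ^ (p - 2) * u x * φ x) = 0

/-- The Euclidean space `ℝ^d`. -/
abbrev Eu (d : ℕ) := EuclideanSpace ℝ (Fin d)

section

variable {d : ℕ} {p : ℝ}

/-! ### The `p`-Laplacian flux -/

/-- The flux `a ↦ ‖a‖^{p-2} a` of the `p`-Laplacian. -/
def flux (p : ℝ) (a : Eu d) : Eu d := ‖a‖ ^ (p - 2) • a

lemma flux_zero : flux p (0 : Eu d) = 0 := by simp [flux]

lemma rpow_sub_two_mul_self (hp : 1 < p) {t : ℝ} (ht : 0 ≤ t) :
    t ^ (p - 2) * t = t ^ (p - 1) := by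
  rcases ht.eq_or_lt with rfl | h
  · rw [mul_zero, Real.zero_rpow (by linarith)]
  · rw [← Real.rpow_add_one h.ne']; congr 1; ring

lemma rpow_sub_one_mul_self (hp : 1 < p) {t : ℝ} (ht : 0 ≤ t) :
    t ^ (p - 1) * t = t ^ p := by
  rcases ht.eq_or_lt with rfl | h
  · rw [mul_zero, Real.zero_rpow (by linarith)]
  · rw [← Real.rpow_add_one h.ne']; congr 1; ring

lemma norm_flux (hp : 1 < p) (a : Eu d) : ‖flux p a‖ = ‖a‖ ^ (p - 1) := by
  rw [flux, norm_smul, Real.norm_of_nonneg (by positivity),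
    rpow_sub_two_mul_self hp (norm_nonneg _)]

lemma flux_neg (a : Eu d) : flux p (-a) = -flux p a := by simp [flux]

lemma flux_smul (hp : 1 < p) {c : ℝ} (hc : 0 ≤ c) (a : Eu d) :
    flux p (c • a) = c ^ (p - 1) • flux p a := by
  rw [flux, flux, norm_smul, Real.norm_of_nonneg hc, Real.mul_rpow hc (norm_nonneg _), smul_smul,
    smul_smul, ← rpow_sub_two_mul_self hp hc]
  congr 1; ring

lemma inner_flux_self (hp : 1 < p) (a : Eu d) : ⟪flux p a, a⟫ = ‖a‖ ^ p := by
  rw [flux, real_inner_smul_left, real_inner_self_eq_norm_sq, sq, ← mul_assoc,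
    rpow_sub_two_mul_self hp (norm_nonneg _), rpow_sub_one_mul_self hp (norm_nonneg _)]

lemma abs_inner_flux_le (hp : 1 < p) (a b : Eu d) : |⟪flux p a, b⟫| ≤ ‖a‖ ^ (p - 1) * ‖b‖ := by
  rw [← norm_flux hp]; exact abs_real_inner_le_norm _ _

lemma continuous_flux (hp : 1 < p) : Continuous (flux p : Eu d → Eu d) := by
  rw [continuous_iff_continuousAt]
  intro a
  by_cases ha : a = 0
  · subst ha
    rw [ContinuousAt, flux_zero, tendsto_zero_iff_norm_tendsto_zero]
    have : Tendsto (fun a : Eu d => ‖a‖ ^ (p - 1)) (𝓝 0) (𝓝 (‖(0 : Eu d)‖ ^ (p - 1))) :=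
      (continuous_norm.rpow_const fun _ => Or.inr (by linarith)).tendsto 0
    rw [norm_zero, Real.zero_rpow (by linarith)] at this
    exact this.congr fun a => (norm_flux hp a).symm
  · exact (continuousAt_id.norm.rpow_const (Or.inl (norm_ne_zero_iff.2 ha))).smul continuousAt_id

lemma inner_flux_sub_ge (hp : 1 < p) (a b : Eu d) :
    (‖a‖ ^ (p - 1) - ‖b‖ ^ (p - 1)) * (‖a‖ - ‖b‖) +
      (‖a‖ ^ (p - 2) + ‖b‖ ^ (p - 2)) * (‖a‖ * ‖b‖ - ⟪a, b⟫) = ⟪flux p a - flux p b, a - b⟫ := by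
  rw [inner_sub_left, inner_sub_right, inner_sub_right, inner_flux_self hp, inner_flux_self hp,
    flux, flux, real_inner_smul_left, real_inner_smul_left, real_inner_comm b a,
    ← rpow_sub_one_mul_self hp (norm_nonneg a), ← rpow_sub_one_mul_self hp (norm_nonneg b),
    ← rpow_sub_two_mul_self hp (norm_nonneg a), ← rpow_sub_two_mul_self hp (norm_nonneg b)]
  ring

lemma rpow_sub_mul_sub_nonneg (hp : 1 < p) {s t : ℝ} (hs : 0 ≤ s) (ht : 0 ≤ t) :
    0 ≤ (s ^ (p - 1) - t ^ (p - 1)) * (s - t) := by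
  rcases le_total s t with h | h
  · have := Real.rpow_le_rpow hs h (by linarith : 0 ≤ p - 1)
    nlinarith
  · have := Real.rpow_le_rpow ht h (by linarith : 0 ≤ p - 1)
    nlinarith

lemma flux_monotone (hp : 1 < p) (a b : Eu d) : 0 ≤ ⟪flux p a - flux p b, a - b⟫ := by
  rw [← inner_flux_sub_ge hp]
  have h1 := rpow_sub_mul_sub_nonneg hp (norm_nonneg a) (norm_nonneg b)
  have h2 : 0 ≤ ‖a‖ * ‖b‖ - ⟪a, b⟫ := sub_nonneg.2 (real_inner_le_norm a b)
  positivity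

lemma eq_of_inner_flux_sub_eq_zero (hp : 1 < p) {a b : Eu d}
    (h : ⟪flux p a - flux p b, a - b⟫ = 0) : a = b := by
  have h1 := rpow_sub_mul_sub_nonneg hp (norm_nonneg a) (norm_nonneg b)
  have h2 : 0 ≤ ‖a‖ * ‖b‖ - ⟪a, b⟫ := sub_nonneg.2 (real_inner_le_norm a b)
  have h3 : 0 ≤ (‖a‖ ^ (p - 2) + ‖b‖ ^ (p - 2)) * (‖a‖ * ‖b‖ - ⟪a, b⟫) := by positivity
  have h4 := inner_flux_sub_ge hp a b
  rw [h] at h4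
  have h5 : (‖a‖ ^ (p - 1) - ‖b‖ ^ (p - 1)) * (‖a‖ - ‖b‖) = 0 := by linarith
  have h6 : (‖a‖ ^ (p - 2) + ‖b‖ ^ (p - 2)) * (‖a‖ * ‖b‖ - ⟪a, b⟫) = 0 := by linarith
  have hn : ‖a‖ = ‖b‖ := by
    rcases mul_eq_zero.1 h5 with h | h
    · exact (Real.rpow_left_inj (norm_nonneg a) (norm_nonneg b) (by linarith)).1 (sub_eq_zero.1 h)
    · linarith
  by_cases hb : b = 0
  · subst hb; simpa using hn
  have hb' : 0 < ‖b‖ := norm_pos_iff.2 hb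
  have hi : ⟪a, b⟫ = ‖a‖ * ‖b‖ := by
    rcases mul_eq_zero.1 h6 with h | h
    · have : 0 < ‖b‖ ^ (p - 2) := Real.rpow_pos_of_pos hb' _
      have : 0 ≤ ‖a‖ ^ (p - 2) := by positivity
      linarith
    · linarith
  rw [← sub_eq_zero, ← norm_eq_zero, ← sq_eq_zero_iff, norm_sub_sq_real, hi, hn]
  ring

/-- Picone's inequality for the `p`-Laplacian in logarithmic form. -/
lemma picone_nonneg (hp : 1 < p) (a b : Eu d) :
    0 ≤ ‖a‖ ^ p - p * ⟪flux p b, a⟫ + (p - 1) * ‖b‖ ^ p := by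
  have hq := Real.HolderConjugate.conjExponent hp
  have h := Real.young_inequality_of_nonneg (norm_nonneg a)
    (by positivity : (0 : ℝ) ≤ ‖b‖ ^ (p - 1)) hq
  rw [← Real.rpow_mul (norm_nonneg b)] at h
  have h1 : (p - 1) * p.conjExponent = p := by
    rw [Real.conjExponent]; field_simp [(by linarith : p - 1 ≠ 0)]
  rw [h1] at h
  have h2 := (abs_le.1 (abs_inner_flux_le hp b a)).2
  have h3 : p * (‖a‖ ^ p / p + ‖b‖ ^ p / p.conjExponent) = ‖a‖ ^ p + (p - 1) * ‖b‖ ^ p := by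
    rw [Real.conjExponent]; field_simp [(by linarith : p - 1 ≠ 0)]
  have h4 := mul_le_mul_of_nonneg_left h (by linarith : 0 ≤ p)
  have h5 := mul_le_mul_of_nonneg_left h2 (by linarith : 0 ≤ p)
  rw [h3] at h4
  linarith [mul_comm ‖a‖ (‖b‖ ^ (p - 1))]

/-! ### Calculus with gradients -/

lemma HasGradientAt.fadd {f g : Eu d → ℝ} {f' g' x : Eu d} (hf : HasGradientAt f f' x)
    (hg : HasGradientAt g g' x) : HasGradientAt (fun y => f y + g y) (f' + g') x := by
  rw [hasGradientAt_iff_hasFDerivAt, map_add]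
  exact hf.hasFDerivAt.add hg.hasFDerivAt

lemma HasGradientAt.fneg {f : Eu d → ℝ} {f' x : Eu d} (hf : HasGradientAt f f' x) :
    HasGradientAt (fun y => -f y) (-f') x := by
  rw [hasGradientAt_iff_hasFDerivAt, map_neg]
  exact hf.hasFDerivAt.neg

lemma HasGradientAt.fsub {f g : Eu d → ℝ} {f' g' x : Eu d} (hf : HasGradientAt f f' x)
    (hg : HasGradientAt g g' x) : HasGradientAt (fun y => f y - g y) (f' - g') x := by
  simpa [sub_eq_add_neg] using hf.fadd hg.fneg

lemma HasGradientAt.fmul {f g : Eu d → ℝ} {f' g' x : Eu d} (hf : HasGradientAt f f' x)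
    (hg : HasGradientAt g g' x) :
    HasGradientAt (fun y => f y * g y) (f x • g' + g x • f') x := by
  have e : InnerProductSpace.toDual ℝ (Eu d) (f x • g' + g x • f') =
      f x • InnerProductSpace.toDual ℝ (Eu d) g' + g x • InnerProductSpace.toDual ℝ (Eu d) f' := by
    simp
  rw [hasGradientAt_iff_hasFDerivAt, e]
  exact hf.hasFDerivAt.mul hg.hasFDerivAt

lemma HasGradientAt.fcomp {f : Eu d → ℝ} {f' x : Eu d} {h : ℝ → ℝ} {h' : ℝ}
    (hh : HasDerivAt h h' (f x)) (hf : HasGradientAt f f' x) :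
    HasGradientAt (fun y => h (f y)) (h' • f') x := by
  have e : InnerProductSpace.toDual ℝ (Eu d) (h' • f') =
      h' • InnerProductSpace.toDual ℝ (Eu d) f' := by simp
  rw [hasGradientAt_iff_hasFDerivAt, e]
  exact hh.comp_hasFDerivAt x hf.hasFDerivAt

lemma ContDiffOn.hasGradientAt' {u : Eu d → ℝ} {Ω : Set (Eu d)} (hu : ContDiffOn ℝ 1 u Ω)
    (hΩ : IsOpen Ω) {x : Eu d} (hx : x ∈ Ω) : HasGradientAt u (gradient u x) x :=
  ((hu.differentiableOn (by norm_num)).differentiableAt (hΩ.mem_nhds hx)).hasGradientAt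

lemma ContDiffOn.continuousOn_gradient {u : Eu d → ℝ} {Ω : Set (Eu d)}
    (hu : ContDiffOn ℝ 1 u Ω) (hΩ : IsOpen Ω) : ContinuousOn (gradient u) Ω := by
  have := hu.continuousOn_fderiv_of_isOpen hΩ (by norm_num)
  exact (InnerProductSpace.toDual ℝ (Eu d)).symm.continuous.comp_continuousOn this

lemma ContDiff.continuous_gradient' {u : Eu d → ℝ} (hu : ContDiff ℝ 1 u) :
    Continuous (gradient u) := by
  rw [← continuousOn_univ]
  exact (contDiffOn_univ.2 hu).continuousOn_gradient isOpen_univ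

lemma ContDiff.hasGradientAt' {u : Eu d → ℝ} (hu : ContDiff ℝ 1 u) (x : Eu d) :
    HasGradientAt u (gradient u x) x :=
  (hu.differentiable (by norm_num) x).hasGradientAt

lemma norm_gradient_eq (u : Eu d → ℝ) (x : Eu d) : ‖gradient u x‖ = ‖fderiv ℝ u x‖ := by
  simp [gradient]

lemma tsupport_gradient_subset (F : Eu d → ℝ) :
    tsupport (gradient F) ⊆ tsupport F := by
  have : tsupport (fderiv ℝ F) ⊆ tsupport F := tsupport_fderiv_subset ℝ
  refine subset_trans (closure_mono ?_) this
  intro x hx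
  simpa [gradient, Function.mem_support] using hx

lemma gradient_eq_zero_of_notMem {F : Eu d → ℝ} {x : Eu d} (hx : x ∉ tsupport F) :
    gradient F x = 0 :=
  image_eq_zero_of_notMem_tsupport fun h => hx (tsupport_gradient_subset F h)

lemma continuous_of_continuousOn_of_eq_zero {X Y : Type*} [TopologicalSpace X]
    [TopologicalSpace Y] [Zero Y] {f : X → Y} {Ω K : Set X} (hΩ : IsOpen Ω) (hK : IsClosed K)
    (hKΩ : K ⊆ Ω) (hf : ContinuousOn f Ω) (h0 : ∀ x ∉ K, f x = 0) : Continuous f := by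
  rw [continuous_iff_continuousAt]
  intro x
  by_cases hx : x ∈ Ω
  · exact hf.continuousAt (hΩ.mem_nhds hx)
  · have : f =ᶠ[𝓝 x] fun _ => 0 := by
      filter_upwards [hK.isOpen_compl.mem_nhds fun h => hx (hKΩ h)] with y hy using h0 y hy
    exact continuousAt_const.congr this.symm

lemma contDiff_of_contDiffOn_of_eq_zero {f : Eu d → ℝ} {Ω K : Set (Eu d)} (hΩ : IsOpen Ω)
    (hK : IsClosed K) (hKΩ : K ⊆ Ω) (hf : ContDiffOn ℝ 1 f Ω) (h0 : ∀ x ∉ K, f x = 0) :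
    ContDiff ℝ 1 f := by
  rw [contDiff_iff_contDiffAt]
  intro x
  by_cases hx : x ∈ Ω
  · exact hf.contDiffAt (hΩ.mem_nhds hx)
  · have : f =ᶠ[𝓝 x] fun _ => 0 := by
      filter_upwards [hK.isOpen_compl.mem_nhds fun h => hx (hKΩ h)] with y hy using h0 y hy
    exact contDiffAt_const.congr_of_eventuallyEq this

lemma tsupport_subset_of_eq_zero {X Y : Type*} [TopologicalSpace X] [Zero Y] {f : X → Y}
    {K : Set X} (hK : IsClosed K) (h0 : ∀ x ∉ K, f x = 0) : tsupport f ⊆ K :=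
  closure_minimal (fun x hx => by_contra fun h => hx (h0 x h)) hK

/-- Continuous on an open set and vanishing off a compact subset implies integrable. -/
lemma integrable_of_continuousOn_of_eq_zero {f : Eu d → ℝ} {Ω K : Set (Eu d)} (hΩ : IsOpen Ω)
    (hK : IsCompact K) (hKΩ : K ⊆ Ω) (hf : ContinuousOn f Ω) (h0 : ∀ x ∉ K, f x = 0) :
    Integrable f :=
  (continuous_of_continuousOn_of_eq_zero hΩ hK.isClosed hKΩ hf h0).integrable_of_hasCompactSupport
    (HasCompactSupport.intro hK h0)

/-- A compactly supported `C¹` function with vanishing gradient is zero. -/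
lemma eq_zero_of_gradient_eq_zero (hd : 0 < d) {F : Eu d → ℝ} (hF : ContDiff ℝ 1 F)
    (hc : HasCompactSupport F) (h : ∀ x, gradient F x = 0) (x : Eu d) : F x = 0 := by
  have : Nonempty (Fin d) := ⟨⟨0, hd⟩⟩
  have hconst : ∀ y, F y = F x := fun y =>
    is_const_of_fderiv_eq_zero (𝕜 := ℝ) (hF.differentiable (by norm_num)) (fun z => by
      have := h z; simpa [gradient] using this) y x
  by_contra hx
  have : tsupport F = univ := by
    refine eq_univ_of_forall fun y => subset_tsupport _ ?_
    simp [Function.mem_support, hconst y, hx]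
  have hcu : IsCompact (univ : Set (Eu d)) := by rw [← this]; exact hc
  exact noncompact_univ (Eu d) hcu

/-! ### Weak solutions of `-Δ_p u = g` -/

/-- `u` is a `C¹` weak solution of `-Δ_p u = g` in the open set `Ω`, with `g` continuous. -/
structure PSol (p : ℝ) (Ω : Set (Eu d)) (u g : Eu d → ℝ) : Prop where
  isOpen : IsOpen Ω
  contDiffOn : ContDiffOn ℝ 1 u Ω
  cont : ContinuousOn g Ω
  eq : ∀ F : Eu d → ℝ, ContDiff ℝ 1 F → HasCompactSupport F → tsupport F ⊆ Ω →
    ∫ x, ⟪flux p (gradient u x), gradient F x⟫ = ∫ x, g x * F x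

namespace PSol

variable {Ω : Set (Eu d)} {u g : Eu d → ℝ}

lemma hasGradientAt (h : PSol p Ω u g) {x : Eu d} (hx : x ∈ Ω) :
    HasGradientAt u (gradient u x) x := h.contDiffOn.hasGradientAt' h.isOpen hx

lemma continuousOn_flux (hp : 1 < p) (h : PSol p Ω u g) :
    ContinuousOn (fun x => flux p (gradient u x)) Ω :=
  (continuous_flux hp).comp_continuousOn (h.contDiffOn.continuousOn_gradient h.isOpen)

lemma integrable_flux (hp : 1 < p) (h : PSol p Ω u g) {F : Eu d → ℝ} (hF : ContDiff ℝ 1 F)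
    (hc : HasCompactSupport F) (hs : tsupport F ⊆ Ω) :
    Integrable fun x => ⟪flux p (gradient u x), gradient F x⟫ :=
  integrable_of_continuousOn_of_eq_zero h.isOpen hc hs
    ((h.continuousOn_flux hp).inner hF.continuous_gradient'.continuousOn)
    fun x hx => by rw [gradient_eq_zero_of_notMem hx, inner_zero_right]

lemma integrable_rhs (h : PSol p Ω u g) {F : Eu d → ℝ} (hF : Continuous F)
    (hc : HasCompactSupport F) (hs : tsupport F ⊆ Ω) : Integrable fun x => g x * F x :=
  integrable_of_continuousOn_of_eq_zero h.isOpen hc hs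
    (h.cont.mul hF.continuousOn)
    fun x hx => by rw [image_eq_zero_of_notMem_tsupport hx, mul_zero]

lemma mono (h : PSol p Ω u g) {Ω' : Set (Eu d)} (ho : IsOpen Ω') (hs : Ω' ⊆ Ω) : PSol p Ω' u g :=
  ⟨ho, h.contDiffOn.mono hs, h.cont.mono hs, fun F h1 h2 h3 => h.eq F h1 h2 (h3.trans hs)⟩

lemma congr_rhs (h : PSol p Ω u g) {g' : Eu d → ℝ} (hg : ∀ x ∈ Ω, g' x = g x) :
    PSol p Ω u g' := by
  refine ⟨h.isOpen, h.contDiffOn, h.cont.congr hg, fun F h1 h2 h3 => ?_⟩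
  rw [h.eq F h1 h2 h3]
  congr 1; ext x
  by_cases hx : x ∈ tsupport F
  · rw [hg x (h3 hx)]
  · rw [image_eq_zero_of_notMem_tsupport hx, mul_zero, mul_zero]

/-- Changing the solution to `v` with `∇ v = c ∇ u`, `c ≥ 0`. -/
lemma of_gradient (hp : 1 < p) (h : PSol p Ω u g) {v : Eu d → ℝ} {c : ℝ} (hc : 0 ≤ c)
    (hv : ContDiffOn ℝ 1 v Ω) (hg : ∀ x ∈ Ω, gradient v x = c • gradient u x) :
    PSol p Ω v fun x => c ^ (p - 1) * g x := by
  refine ⟨h.isOpen, hv, continuousOn_const.mul h.cont, fun F h1 h2 h3 => ?_⟩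
  have := congrArg (fun t => c ^ (p - 1) * t) (h.eq F h1 h2 h3)
  simp only [← integral_const_mul] at this
  rw [show (∫ x, c ^ (p - 1) * g x * F x) = ∫ x, c ^ (p - 1) * (g x * F x) by simp only [mul_assoc],
    ← this]
  congr 1; ext x
  by_cases hx : x ∈ tsupport F
  · rw [hg x (h3 hx), flux_smul hp hc, real_inner_smul_left]
  · rw [gradient_eq_zero_of_notMem hx, inner_zero_right, inner_zero_right, mul_zero]

lemma const_mul_add (hp : 1 < p) (h : PSol p Ω u g) {c : ℝ} (hc : 0 ≤ c) (k : ℝ) :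
    PSol p Ω (fun x => c * u x + k) fun x => c ^ (p - 1) * g x := by
  refine h.of_gradient hp hc ((contDiffOn_const.mul h.contDiffOn).add contDiffOn_const) ?_
  intro x hx
  have h1 := ((hasGradientAt_const x c).fmul (h.hasGradientAt hx)).fadd (hasGradientAt_const x k)
  rw [h1.gradient]; simp

lemma neg (h : PSol p Ω u g) : PSol p Ω (fun x => -u x) fun x => -g x := by
  refine ⟨h.isOpen, h.contDiffOn.neg, h.cont.neg, fun F h1 h2 h3 => ?_⟩
  have := congrArg (fun t => -t) (h.eq F h1 h2 h3)
  simp only [← integral_neg] at this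
  rw [show (∫ x, -g x * F x) = ∫ x, -(g x * F x) by simp only [neg_mul], ← this]
  congr 1; ext x
  by_cases hx : x ∈ tsupport F
  · rw [(h.hasGradientAt (h3 hx)).fneg.gradient, flux_neg, inner_neg_left]
  · rw [gradient_eq_zero_of_notMem hx, inner_zero_right, inner_zero_right, neg_zero]

lemma const_sub (hp : 1 < p) (h : PSol p Ω u g) (k : ℝ) :
    PSol p Ω (fun x => k - u x) fun x => -g x := by
  have := h.neg.const_mul_add hp zero_le_one k
  simp only [one_mul, Real.one_rpow] at this
  convert this using 2; ring

lemma add_const (hp : 1 < p) (h : PSol p Ω u g) (k : ℝ) :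
    PSol p Ω (fun x => u x + k) g := by
  have := h.const_mul_add hp zero_le_one k
  simpa only [one_mul, Real.one_rpow] using this

lemma const_mul (hp : 1 < p) (h : PSol p Ω u g) {c : ℝ} (hc : 0 ≤ c) :
    PSol p Ω (fun x => c * u x) fun x => c ^ (p - 1) * g x := by
  simpa only [add_zero] using h.const_mul_add hp hc 0

/-- Rescaling `x ↦ z + R x`. -/
lemma rescale (hp : 1 < p) (h : PSol p Ω u g) (z : Eu d) {R : ℝ} (hR : 0 < R) :
    PSol p ((fun x => z + R • x) ⁻¹' Ω) (fun x => u (z + R • x))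
      fun x => R ^ p * g (z + R • x) := by
  have hcont : Continuous fun x : Eu d => z + R • x := by fun_prop
  have hgrad : ∀ {w : Eu d → ℝ} {x w' : Eu d}, HasGradientAt w w' (z + R • x) →
      HasGradientAt (fun x => w (z + R • x)) (R • w') x := by
    intro w x w' hw
    have h1 : HasFDerivAt (fun x : Eu d => z + R • x) (R • ContinuousLinearMap.id ℝ (Eu d)) x :=
      ((hasFDerivAt_id x).const_smul R).const_add z
    have e : InnerProductSpace.toDual ℝ (Eu d) (R • w') =
        (InnerProductSpace.toDual ℝ (Eu d) w').comp (R • ContinuousLinearMap.id ℝ (Eu d)) := by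
      ext y
      simp
    rw [hasGradientAt_iff_hasFDerivAt, e]
    exact HasFDerivAt.comp x hw.hasFDerivAt h1
  have ho := h.isOpen.preimage hcont
  refine ⟨ho, h.contDiffOn.comp (by fun_prop) (fun x hx => hx),
    continuousOn_const.mul (h.cont.comp hcont.continuousOn fun x hx => hx), fun F h1 h2 h3 => ?_⟩
  set G : Eu d → ℝ := fun y => F (R⁻¹ • (y - z)) with hG
  have hFG : ∀ x, F x = G (z + R • x) := by
    intro x; simp [hG, smul_smul, inv_mul_cancel₀ hR.ne']
  let e : Eu d ≃ₜ Eu d := (Homeomorph.subRight z).trans (Homeomorph.smulOfNeZero R⁻¹ (by positivity))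
  have hGe : G = F ∘ e := by
    ext y; simp [e, hG]
  have hG1 : ContDiff ℝ 1 G := by
    apply h1.comp; fun_prop
  have hG2 : HasCompactSupport G := by rw [hGe]; exact h2.comp_homeomorph e
  have hG3 : tsupport G ⊆ Ω := by
    have : tsupport G ⊆ e ⁻¹' tsupport F := by
      rw [hGe]; exact tsupport_comp_subset_preimage F e.continuous
    intro y hy
    have h4 := h3 (this hy)
    have : z + R • e y = y := by simp [e, smul_smul, mul_inv_cancel₀ hR.ne']
    simpa [this] using h4
  have key := h.eq G hG1 hG2 hG3
  have hA : ∀ f : Eu d → ℝ, ∫ x, f (z + R • x) = |(R ^ Module.finrank ℝ (Eu d))⁻¹| * ∫ y, f y := by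
    intro f
    rw [Measure.integral_comp_smul volume (fun y => f (z + y)) R, smul_eq_mul,
      integral_add_left_eq_self]
  have hB := hA fun y => ⟪flux p (gradient u y), gradient G y⟫
  rw [key, ← hA fun y => g y * G y] at hB
  have hB' := congrArg (fun t => R ^ p * t) hB
  simp only [← integral_const_mul] at hB'
  have e1 : (∫ x, R ^ p * (g (z + R • x) * G (z + R • x))) =
      ∫ x, R ^ p * g (z + R • x) * F x := by
    congr 1; ext x; rw [hFG x]; ring
  rw [← e1, ← hB']
  congr 1; ext x
  by_cases hx : x ∈ tsupport F
  · have hx' : z + R • x ∈ Ω := h3 hx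
    have g1 := hgrad (h.hasGradientAt hx')
    have g2 := hgrad (hG1.hasGradientAt' (z + R • x))
    rw [g1.gradient, show gradient F x = R • gradient G (z + R • x) by
      rw [← g2.gradient]; congr 1; ext y; exact hFG y]
    rw [flux_smul hp hR.le, real_inner_smul_left, real_inner_smul_right, ← mul_assoc,
      rpow_sub_one_mul_self hp hR.le]
  · rw [gradient_eq_zero_of_notMem hx, inner_zero_right]
    have : gradient G (z + R • x) = 0 := by
      apply gradient_eq_zero_of_notMem
      intro hy
      have : tsupport G ⊆ e ⁻¹' tsupport F := by
        rw [hGe]; exact tsupport_comp_subset_preimage F e.continuous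
      have h5 := this hy
      have h6 : e (z + R • x) = x := by simp [e, smul_smul, inv_mul_cancel₀ hR.ne']
      rw [mem_preimage, h6] at h5
      exact hx h5
    rw [this, inner_zero_right, mul_zero]

end PSol

/-! ### Smooth test functions suffice -/

/-- A compactly supported `C¹` function is `C¹`-approximated by smooth functions. -/
lemma exists_smooth_approx {F : Eu d → ℝ} (hF : ContDiff ℝ 1 F) (hc : HasCompactSupport F)
    {ε δ : ℝ} (hε : 0 < ε) (hδ : 0 < δ) :
    ∃ φ : Eu d → ℝ, ContDiff ℝ (⊤ : ℕ∞) φ ∧ HasCompactSupport φ ∧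
      tsupport φ ⊆ cthickening δ (tsupport F) ∧
      (∀ x, |φ x - F x| ≤ ε) ∧ ∀ x, ‖gradient φ x - gradient F x‖ ≤ ε := by
  have u1 : UniformContinuous F := hc.uniformContinuous_of_continuous hF.continuous
  have hfc : Continuous (fderiv ℝ F) := hF.continuous_fderiv (by norm_num)
  have u2 : UniformContinuous (fderiv ℝ F) :=
    (hc.fderiv ℝ).uniformContinuous_of_continuous hfc
  obtain ⟨δ1, hδ1, h1⟩ := Metric.uniformContinuous_iff.1 u1 ε hε
  obtain ⟨δ2, hδ2, h2⟩ := Metric.uniformContinuous_iff.1 u2 ε hε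
  set r := min δ (min δ1 δ2) with hr
  have hr0 : 0 < r := by positivity
  let ψ : ContDiffBump (0 : Eu d) := ⟨r / 2, r, by positivity, by linarith⟩
  have hloc : LocallyIntegrable (ψ.normed volume) := 
    (ψ.continuous_normed).locallyIntegrable
  have hs : tsupport (ψ.normed volume) = closedBall 0 r := ψ.tsupport_normed_eq
  have hzero : ∀ x ∉ cthickening r (tsupport F),
      (convolution (ψ.normed volume) F (ContinuousLinearMap.lsmul ℝ ℝ) volume) x = 0 := by
    intro x hx
    rw [convolution_def]
    rw [← integral_zero (Eu d) ℝ]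
    congr 1; ext t
    by_cases ht : t ∈ closedBall (0 : Eu d) r
    · have : F (x - t) = 0 := by
        apply image_eq_zero_of_notMem_tsupport
        intro h
        apply hx
        apply mem_cthickening_of_dist_le x (x - t) r _ h
        simpa [dist_eq_norm] using ht
      simp [this]
    · rw [← hs] at ht
      simp [image_eq_zero_of_notMem_tsupport ht]
  refine ⟨convolution (ψ.normed volume) F (ContinuousLinearMap.lsmul ℝ ℝ) volume,
    ψ.hasCompactSupport_normed.contDiff_convolution_left _ ψ.contDiff_normed
      hF.continuous.locallyIntegrable, ψ.hasCompactSupport_normed.convolution _ hc, ?_, ?_, ?_⟩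
  · refine (tsupport_subset_of_eq_zero isClosed_cthickening hzero).trans
      (cthickening_mono (min_le_left _ _) _)
  · intro x
    rw [← Real.dist_eq]
    refine ContDiffBump.dist_normed_convolution_le hF.continuous.aestronglyMeasurable ?_
    intro y hy
    exact (h1 (lt_of_lt_of_le hy ((min_le_right _ _).trans (min_le_left _ _)))).le
  · intro x
    have hd := hc.hasFDerivAt_convolution_right (ContinuousLinearMap.lsmul ℝ ℝ) hloc hF x
    have hL : ContinuousLinearMap.precompR (Eu d) (ContinuousLinearMap.lsmul ℝ ℝ (E := ℝ)) =
        ContinuousLinearMap.lsmul ℝ ℝ := by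
      ext a; rfl
    rw [hL] at hd
    rw [gradient, gradient, ← map_sub, LinearIsometryEquiv.norm_map, hd.fderiv, ← dist_eq_norm]
    refine ContDiffBump.dist_normed_convolution_le hfc.aestronglyMeasurable ?_
    intro y hy
    exact (h2 (lt_of_lt_of_le hy ((min_le_right _ _).trans (min_le_right _ _)))).le

/-- A positive weak solution (smooth tests) is a weak solution with `C¹` tests. -/
lemma IsPosWeakSol.pSol (hp : 1 < p) {V : Eu d → ℝ} {Ω : Set (Eu d)} {u : Eu d → ℝ}
    (hΩ : IsOpen Ω) (hV : ContinuousOn V Ω) (h : IsPosWeakSol p V Ω u) :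
    PSol p Ω u fun x => -V x * u x ^ (p - 1) := by
  obtain ⟨hu, hpos, heq⟩ := h
  have hA : ContinuousOn (fun x => flux p (gradient u x)) Ω :=
    (continuous_flux hp).comp_continuousOn (hu.continuousOn_gradient hΩ)
  have hG : ContinuousOn (fun x => V x * u x ^ (p - 1)) Ω :=
    hV.mul (hu.continuousOn.rpow_const fun x hx => Or.inl (hpos x hx).ne')
  refine ⟨hΩ, hu, ?_, fun F h1 h2 h3 => ?_⟩
  · exact hV.neg.mul (hu.continuousOn.rpow_const fun x hx => Or.inl (hpos x hx).ne')
  have hI : ∀ F : Eu d → ℝ, ContDiff ℝ 1 F → HasCompactSupport F → tsupport F ⊆ Ω →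
      Integrable fun x => ⟪flux p (gradient u x), gradient F x⟫ + V x * u x ^ (p - 1) * F x := by
    intro F h1 h2 h3
    refine integrable_of_continuousOn_of_eq_zero hΩ h2 h3
      ((hA.inner h1.continuous_gradient'.continuousOn).add (hG.mul h1.continuous.continuousOn)) ?_
    intro x hx
    rw [gradient_eq_zero_of_notMem hx, image_eq_zero_of_notMem_tsupport hx]; simp
  have hsm : ∀ φ : Eu d → ℝ, ContDiff ℝ (⊤ : ℕ∞) φ → HasCompactSupport φ → tsupport φ ⊆ Ω →
      ∫ x, (⟪flux p (gradient u x), gradient φ x⟫ + V x * u x ^ (p - 1) * φ x) = 0 := by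
    intro φ h1 h2 h3
    rw [← heq φ h1 h2 h3, ← setIntegral_eq_integral_of_forall_compl_eq_zero (s := Ω)]
    · apply setIntegral_congr_fun hΩ.measurableSet
      intro x hx
      have hx' := hpos x hx
      simp only [flux, real_inner_smul_left]
      rw [abs_of_pos hx', ← rpow_sub_two_mul_self hp hx'.le]; ring
    · intro x hx
      have hx : x ∉ tsupport φ := fun h => hx (h3 h)
      rw [gradient_eq_zero_of_notMem hx, image_eq_zero_of_notMem_tsupport hx]; simp
  obtain ⟨δ, hδ, hδΩ⟩ := h2.exists_cthickening_subset_open hΩ h3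
  set K := cthickening δ (tsupport F)
  have hK : IsCompact K := IsCompact.cthickening h2
  have hcont : ContinuousOn (fun x => ‖flux p (gradient u x)‖ + |V x * u x ^ (p - 1)|) K :=
    (hA.norm.add hG.abs).mono hδΩ
  have h_int : IntegrableOn (fun x => ‖flux p (gradient u x)‖ + |V x * u x ^ (p - 1)|) K :=
    hcont.integrableOn_compact hK
  set C := ∫ x in K, (‖flux p (gradient u x)‖ + |V x * u x ^ (p - 1)|) with hC
  have hC0 : 0 ≤ C := integral_nonneg fun x => by positivity
  have key : ∀ ε > 0,
      |∫ x, (⟪flux p (gradient u x), gradient F x⟫ + V x * u x ^ (p - 1) * F x)| ≤ C * ε := by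
    intro ε hε
    obtain ⟨φ, a1, a2, a3, a4, a5⟩ := exists_smooth_approx h1 h2 hε hδ
    have a1' : ContDiff ℝ 1 φ := a1.of_le (by exact_mod_cast le_top)
    have e0 := hsm φ a1 a2 (a3.trans hδΩ)
    rw [← sub_zero (∫ x, _), ← e0, ← integral_sub (hI F h1 h2 h3) (hI φ a1' a2 (a3.trans hδΩ)),
      ← setIntegral_eq_integral_of_forall_compl_eq_zero (s := K), hC, ← integral_mul_const,
      ← Real.norm_eq_abs]
    · refine norm_integral_le_of_norm_le (h_int.mul_const _) (Eventually.of_forall fun x => ?_)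
      have e1 : ⟪flux p (gradient u x), gradient F x⟫ + V x * u x ^ (p - 1) * F x -
          (⟪flux p (gradient u x), gradient φ x⟫ + V x * u x ^ (p - 1) * φ x) =
          -⟪flux p (gradient u x), gradient φ x - gradient F x⟫ -
            V x * u x ^ (p - 1) * (φ x - F x) := by
        rw [inner_sub_right]; ring
      rw [e1, Real.norm_eq_abs, add_mul]
      refine (abs_sub _ _).trans (add_le_add ?_ ?_)
      · rw [abs_neg]
        exact (abs_real_inner_le_norm _ _).trans (mul_le_mul_of_nonneg_left (a5 x) (norm_nonneg _))
      · rw [abs_mul]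
        exact mul_le_mul_of_nonneg_left (a4 x) (abs_nonneg _)
    · intro x hx
      have hx1 : x ∉ tsupport F := fun h => hx (self_subset_cthickening _ h)
      have hx2 : x ∉ tsupport φ := fun h => hx (a3 h)
      rw [gradient_eq_zero_of_notMem hx1, gradient_eq_zero_of_notMem hx2,
        image_eq_zero_of_notMem_tsupport hx1, image_eq_zero_of_notMem_tsupport hx2]; simp
  have hz : ∫ x, (⟪flux p (gradient u x), gradient F x⟫ + V x * u x ^ (p - 1) * F x) = 0 := by
    rw [← abs_nonpos_iff]
    refine le_of_forall_pos_le_add fun ε hε => ?_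
    refine (key (ε / (C + 1)) (by positivity)).trans ?_
    rw [zero_add, mul_div_assoc', div_le_iff₀ (by positivity)]
    nlinarith
  have i1 : Integrable fun x => ⟪flux p (gradient u x), gradient F x⟫ :=
    integrable_of_continuousOn_of_eq_zero hΩ h2 h3
      (hA.inner h1.continuous_gradient'.continuousOn)
      fun x hx => by rw [gradient_eq_zero_of_notMem hx, inner_zero_right]
  have i2 : Integrable fun x => V x * u x ^ (p - 1) * F x :=
    integrable_of_continuousOn_of_eq_zero hΩ h2 h3 (hG.mul h1.continuous.continuousOn)
      fun x hx => by rw [image_eq_zero_of_notMem_tsupport hx, mul_zero]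
  rw [integral_add i1 i2] at hz
  simp only [neg_mul, integral_neg]
  linarith

/-! ### Comparison principles -/

/-- The positive part to a power `q > 1` is differentiable. -/
lemma hasDerivAt_max_rpow {q : ℝ} (hq : 1 < q) (t : ℝ) :
    HasDerivAt (fun s : ℝ => (max s 0) ^ q) (q * (max t 0) ^ (q - 1)) t := by
  rcases lt_trichotomy t 0 with h | rfl | h
  · rw [max_eq_right h.le, Real.zero_rpow (by linarith), mul_zero]
    refine (hasDerivAt_const t (0 : ℝ)).congr_of_eventuallyEq ?_
    filter_upwards [gt_mem_nhds h] with s hs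
    rw [max_eq_right hs.le, Real.zero_rpow (by linarith)]
  · have h1 := (hasDerivAt_abs_rpow (0 : ℝ) hq)
    rw [mul_zero] at h1
    rw [max_self, Real.zero_rpow (by linarith), mul_zero]
    rw [hasDerivAt_iff_isLittleO] at h1 ⊢
    refine Asymptotics.IsBigO.trans_isLittleO (Asymptotics.IsBigO.of_bound 1 ?_) h1
    refine Eventually.of_forall fun s => ?_
    have e : (0 : ℝ) ^ q = 0 := Real.zero_rpow (by linarith)
    simp only [max_self, abs_zero, e, sub_zero, smul_eq_mul, mul_zero, one_mul]
    rw [Real.norm_of_nonneg (by positivity), Real.norm_of_nonneg (by positivity)]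
    exact Real.rpow_le_rpow (le_max_right _ _) (max_le (le_abs_self s) (abs_nonneg s)) (by linarith)
  · rw [max_eq_left h.le]
    refine (Real.hasDerivAt_rpow_const (Or.inl h.ne')).congr_of_eventuallyEq ?_
    filter_upwards [lt_mem_nhds h] with s hs
    rw [max_eq_left hs.le]

lemma contDiff_max_rpow {q : ℝ} (hq : 1 < q) : ContDiff ℝ 1 fun s : ℝ => (max s 0) ^ q := by
  rw [contDiff_one_iff_deriv]
  refine ⟨fun t => (hasDerivAt_max_rpow hq t).differentiableAt, ?_⟩
  rw [show deriv (fun s : ℝ => (max s 0) ^ q) = fun t => q * (max t 0) ^ (q - 1) from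
    funext fun t => (hasDerivAt_max_rpow hq t).deriv]
  exact continuous_const.mul ((continuous_id.max continuous_const).rpow_const
    fun _ => Or.inr (by linarith))

section TestFunction

variable {D K : Set (Eu d)} {H : Eu d → ℝ}

lemma indicator_eq_zero_of_notMem (h0 : ∀ x ∈ D, x ∉ K → H x = 0) {x : Eu d} (hx : x ∉ K) :
    D.indicator H x = 0 := by
  by_cases h : x ∈ D
  · rw [indicator_of_mem h, h0 x h hx]
  · rw [indicator_of_notMem h]

lemma contDiff_indicator (hD : IsOpen D) (hK : IsCompact K) (hKD : K ⊆ D)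
    (hH : ContDiffOn ℝ 1 H D) (h0 : ∀ x ∈ D, x ∉ K → H x = 0) :
    ContDiff ℝ 1 (D.indicator H) :=
  contDiff_of_contDiffOn_of_eq_zero hD hK.isClosed hKD
    (hH.congr fun _ hx => indicator_of_mem hx H) fun _ hx => indicator_eq_zero_of_notMem h0 hx

lemma tsupport_indicator_subset (hK : IsCompact K) (h0 : ∀ x ∈ D, x ∉ K → H x = 0) :
    tsupport (D.indicator H) ⊆ K :=
  tsupport_subset_of_eq_zero hK.isClosed fun _ hx => indicator_eq_zero_of_notMem h0 hx

lemma hasCompactSupport_indicator (hK : IsCompact K) (h0 : ∀ x ∈ D, x ∉ K → H x = 0) :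
    HasCompactSupport (D.indicator H) :=
  HasCompactSupport.intro hK fun _ hx => indicator_eq_zero_of_notMem h0 hx

lemma HasGradientAt.indicator {H' x : Eu d} (hD : IsOpen D) (hx : x ∈ D)
    (hH : HasGradientAt H H' x) : HasGradientAt (D.indicator H) H' x := by
  rw [hasGradientAt_iff_hasFDerivAt] at *
  refine hH.congr_of_eventuallyEq ?_
  filter_upwards [hD.mem_nhds hx] with y hy using indicator_of_mem hy H

end TestFunction

/-- A nonnegative continuous function with zero integral vanishes. -/
lemma eq_zero_of_integral_eq_zero {f : Eu d → ℝ} (hf : Continuous f) (hi : Integrable f)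
    (h0 : ∀ x, 0 ≤ f x) (h : ∫ x, f x ≤ 0) (x : Eu d) : f x = 0 := by
  have h1 : ∫ x, f x = 0 := le_antisymm h (integral_nonneg h0)
  have h2 := (integral_eq_zero_iff_of_nonneg h0 hi).1 h1
  exact congrFun (hf.ae_eq_iff_eq volume continuous_const |>.1 h2) x

/-- The set where a function continuous on `closure D` and negative on the frontier is at least
`0` is a compact subset of `D`. -/
lemma isCompact_superlevel {D : Set (Eu d)} (hD : IsOpen D) (hDc : IsCompact (closure D))
    {w : Eu d → ℝ} (hw : ContinuousOn w (closure D)) (hfr : ∀ x ∈ frontier D, w x < 0) :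
    IsCompact {x ∈ closure D | 0 ≤ w x} ∧ {x ∈ closure D | 0 ≤ w x} ⊆ D := by
  constructor
  · have : {x ∈ closure D | 0 ≤ w x} = closure D ∩ w ⁻¹' Ici 0 := rfl
    rw [this]
    exact hDc.of_isClosed_subset (hw.preimage_isClosed_of_isClosed isClosed_closure isClosed_Ici)
      inter_subset_left
  · rintro x ⟨hx, h0⟩
    by_contra h
    exact absurd (hfr x ⟨hx, by rwa [hD.interior_eq]⟩) (not_lt.2 h0)

open Classical in
/-- Weak comparison principle. -/
lemma PSol.comparison (hd : 0 < d) (hp : 1 < p) {Ω₁ Ω₂ D : Set (Eu d)} {b gb u gu : Eu d → ℝ}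
    (hb : PSol p Ω₁ b gb) (hu : PSol p Ω₂ u gu) (hD : IsOpen D) (hDc : IsCompact (closure D))
    (h1 : closure D ⊆ Ω₁) (h2 : closure D ⊆ Ω₂) (hg : ∀ x ∈ D, u x < b x → gb x ≤ gu x)
    (hfr : ∀ x ∈ frontier D, b x ≤ u x) : ∀ x ∈ D, b x ≤ u x := by
  intro x hx
  refine le_of_forall_pos_le_add fun ε hε => ?_
  have hD1 : D ⊆ Ω₁ := subset_closure.trans h1
  have hD2 : D ⊆ Ω₂ := subset_closure.trans h2
  set w : Eu d → ℝ := fun y => b y - u y - ε with hw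
  have hwc : ContinuousOn w (closure D) :=
    ((hb.contDiffOn.continuousOn.mono h1).sub (hu.contDiffOn.continuousOn.mono h2)).sub
      continuousOn_const
  obtain ⟨hK, hKD⟩ := isCompact_superlevel hD hDc hwc
    fun y hy => by have := hfr y hy; simp only [hw]; linarith
  set K := {x ∈ closure D | 0 ≤ w x}
  set H : Eu d → ℝ := fun y => (max (w y) 0) ^ (2 : ℝ) with hH
  have hHs : ContDiffOn ℝ 1 H D := (contDiff_max_rpow one_lt_two).comp_contDiffOn
    (((hb.contDiffOn.mono hD1).sub (hu.contDiffOn.mono hD2)).sub contDiffOn_const)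
  have h0 : ∀ y ∈ D, y ∉ K → H y = 0 := by
    intro y hy hyK
    have : w y ≤ 0 := by
      by_contra h
      exact hyK ⟨subset_closure hy, (not_le.1 h).le⟩
    simp only [hH]
    rw [max_eq_right this, Real.zero_rpow (by norm_num)]
  set F := D.indicator H
  have hF1 : ContDiff ℝ 1 F := contDiff_indicator hD hK hKD hHs h0
  have hF2 : HasCompactSupport F := hasCompactSupport_indicator hK h0
  have hF3 : tsupport F ⊆ D := (tsupport_indicator_subset hK h0).trans hKD
  have hgrad : ∀ y ∈ D, gradient F y =
      (2 * (max (w y) 0)) • (gradient b y - gradient u y) := by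
    intro y hy
    have e1 : HasGradientAt w (gradient b y - gradient u y) y := by
      simpa using ((hb.hasGradientAt (hD1 hy)).fsub (hu.hasGradientAt (hD2 hy))).fsub
        (hasGradientAt_const y ε)
    have e2 := (e1.fcomp (hasDerivAt_max_rpow one_lt_two (w y))).indicator hD hy
    rw [show (2 : ℝ) - 1 = 1 by norm_num, Real.rpow_one] at e2
    exact e2.gradient
  have e1 := hb.eq F hF1 hF2 (hF3.trans hD1)
  have e2 := hu.eq F hF1 hF2 (hF3.trans hD2)
  have i1 := hb.integrable_flux hp hF1 hF2 (hF3.trans hD1)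
  have i2 := hu.integrable_flux hp hF1 hF2 (hF3.trans hD2)
  have i3 := hb.integrable_rhs hF1.continuous hF2 (hF3.trans hD1)
  have i4 := hu.integrable_rhs hF1.continuous hF2 (hF3.trans hD2)
  have hle : ∫ x, (⟪flux p (gradient b x), gradient F x⟫ - ⟪flux p (gradient u x), gradient F x⟫)
      ≤ 0 := by
    rw [integral_sub i1 i2, e1, e2, ← integral_sub i3 i4]
    refine integral_nonpos fun y => ?_
    by_cases hy : y ∈ D
    · have hFy : F y = (max (w y) 0) ^ (2 : ℝ) := indicator_of_mem hy H
      by_cases hwy : 0 < w y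
      · have := hg y hy (by simp only [hw] at hwy; linarith)
        have h3 : 0 ≤ F y := by rw [hFy]; positivity
        have := mul_le_mul_of_nonneg_right this h3
        simp only [Pi.zero_apply]; linarith
      · rw [hFy, max_eq_right (not_lt.1 hwy), Real.zero_rpow (by norm_num)]; simp
    · have : F y = 0 := indicator_of_notMem hy H
      simp [this]
  have hform : ∀ y, ⟪flux p (gradient b y), gradient F y⟫ - ⟪flux p (gradient u y), gradient F y⟫ =
      if y ∈ D then (2 * (max (w y) 0)) *
        ⟪flux p (gradient b y) - flux p (gradient u y), gradient b y - gradient u y⟫ else 0 := by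
    intro y
    by_cases hy : y ∈ D
    · rw [if_pos hy, hgrad y hy, ← inner_sub_left, real_inner_smul_right]
    · rw [if_neg hy, gradient_eq_zero_of_notMem fun h => hy (hF3 h)]; simp
  have hcont : Continuous fun y =>
      ⟪flux p (gradient b y), gradient F y⟫ - ⟪flux p (gradient u y), gradient F y⟫ := by
    refine continuous_of_continuousOn_of_eq_zero hD hF2.isCompact.isClosed hF3 ?_ ?_
    · exact (((hb.continuousOn_flux hp).mono hD1).inner hF1.continuous_gradient'.continuousOn).sub
        (((hu.continuousOn_flux hp).mono hD2).inner hF1.continuous_gradient'.continuousOn)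
    · intro y hy
      rw [gradient_eq_zero_of_notMem hy]; simp
  have hz := eq_zero_of_integral_eq_zero hcont (i1.sub i2) (fun y => by
    rw [hform]
    split_ifs
    · exact mul_nonneg (by positivity) (flux_monotone hp _ _)
    · rfl) hle
  have hg0 : ∀ y, gradient F y = 0 := by
    intro y
    by_cases hy : y ∈ D
    · have h5 := hz y
      rw [hform, if_pos hy] at h5
      rw [hgrad y hy]
      rcases mul_eq_zero.1 h5 with h | h
      · rw [h, zero_smul]
      · rw [eq_of_inner_flux_sub_eq_zero hp h, sub_self, smul_zero]
    · exact gradient_eq_zero_of_notMem fun h => hy (hF3 h)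
  have hFx := eq_zero_of_gradient_eq_zero hd hF1 hF2 hg0 x
  have hFx' : F x = (max (w x) 0) ^ (2 : ℝ) := indicator_of_mem hx H
  rw [hFx', Real.rpow_eq_zero (le_max_right _ _) (by norm_num)] at hFx
  have := le_max_left (w x) 0
  rw [hFx] at this
  simp only [hw] at this
  linarith

/-- Comparison of the quotient of two positive solutions of
`-Δ_p w + V w^{p-1} = 0`, via Picone's identity. -/
lemma picone_comparison (hd : 0 < d) (hp : 1 < p) {Ω D : Set (Eu d)} {V u v : Eu d → ℝ}
    (hu : PSol p Ω u fun x => -V x * u x ^ (p - 1))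
    (hv : PSol p Ω v fun x => -V x * v x ^ (p - 1))
    (hupos : ∀ x ∈ Ω, 0 < u x) (hvpos : ∀ x ∈ Ω, 0 < v x)
    (hD : IsOpen D) (hDc : IsCompact (closure D)) (h1 : closure D ⊆ Ω) {c : ℝ} (hc : 0 < c)
    (hfr : ∀ x ∈ frontier D, u x ≤ c * v x) : ∀ x ∈ D, u x ≤ c * v x := by
  intro x hx
  have hD1 : D ⊆ Ω := subset_closure.trans h1
  suffices hlog : ∀ ε > 0, Real.log (u x) - Real.log (v x) - Real.log c ≤ ε by
    have := le_of_forall_pos_le_add (a := Real.log (u x) - Real.log (v x) - Real.log c) (b := 0)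
      fun ε hε => by simpa using hlog ε hε
    have hvx := hvpos x (hD1 hx)
    rw [← Real.log_le_log_iff (hupos x (hD1 hx)) (by positivity), Real.log_mul hc.ne' hvx.ne']
    linarith
  intro ε hε
  set w : Eu d → ℝ := fun y => Real.log (u y) - Real.log (v y) - Real.log c - ε with hw
  have hlu : ContDiffOn ℝ 1 (fun y => Real.log (u y)) Ω :=
    hu.contDiffOn.log fun y hy => (hupos y hy).ne'
  have hlv : ContDiffOn ℝ 1 (fun y => Real.log (v y)) Ω :=
    hv.contDiffOn.log fun y hy => (hvpos y hy).ne'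
  have hws : ContDiffOn ℝ 1 w Ω := ((hlu.sub hlv).sub contDiffOn_const).sub contDiffOn_const
  obtain ⟨hK, hKD⟩ := isCompact_superlevel hD hDc (hws.continuousOn.mono h1) fun y hy => by
    have hy' : y ∈ Ω := h1 (frontier_subset_closure hy)
    have := Real.log_le_log (hupos y hy') (hfr y hy)
    rw [Real.log_mul hc.ne' (hvpos y hy').ne'] at this
    simp only [hw]; linarith
  set K := {x ∈ closure D | 0 ≤ w x}
  set H : Eu d → ℝ := fun y => (max (w y) 0) ^ (2 : ℝ) with hH
  have hHs : ContDiffOn ℝ 1 H D := (contDiff_max_rpow one_lt_two).comp_contDiffOn (hws.mono hD1)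
  have h0 : ∀ y ∈ D, y ∉ K → H y = 0 := by
    intro y hy hyK
    have : w y ≤ 0 := by
      by_contra h
      exact hyK ⟨subset_closure hy, (not_le.1 h).le⟩
    simp only [hH]
    rw [max_eq_right this, Real.zero_rpow (by norm_num)]
  -- the auxiliary functions
  set H₁ : Eu d → ℝ := fun y => u y * H y with hH₁
  set P : Eu d → ℝ := fun y => u y ^ p * v y ^ (1 - p) with hP
  set H₂ : Eu d → ℝ := fun y => P y * H y with hH₂
  have hPs : ContDiffOn ℝ 1 P D :=
    ((hu.contDiffOn.mono hD1).rpow_const_of_ne fun y hy => (hupos y (hD1 hy)).ne').mul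
      ((hv.contDiffOn.mono hD1).rpow_const_of_ne fun y hy => (hvpos y (hD1 hy)).ne')
  have h01 : ∀ y ∈ D, y ∉ K → H₁ y = 0 := fun y hy hyK => by simp [hH₁, h0 y hy hyK]
  have h02 : ∀ y ∈ D, y ∉ K → H₂ y = 0 := fun y hy hyK => by simp [hH₂, h0 y hy hyK]
  set F := D.indicator H
  set F₁ := D.indicator H₁
  set F₂ := D.indicator H₂
  have hF : ContDiff ℝ 1 F := contDiff_indicator hD hK hKD hHs h0
  have hF1 : ContDiff ℝ 1 F₁ := contDiff_indicator hD hK hKD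
    ((hu.contDiffOn.mono hD1).mul hHs) h01
  have hF2 : ContDiff ℝ 1 F₂ := contDiff_indicator hD hK hKD (hPs.mul hHs) h02
  have hFc : HasCompactSupport F := hasCompactSupport_indicator hK h0
  have hFc1 : HasCompactSupport F₁ := hasCompactSupport_indicator hK h01
  have hFc2 : HasCompactSupport F₂ := hasCompactSupport_indicator hK h02
  have ht : tsupport F ⊆ D := (tsupport_indicator_subset hK h0).trans hKD
  have ht1 : tsupport F₁ ⊆ D := (tsupport_indicator_subset hK h01).trans hKD
  have ht2 : tsupport F₂ ⊆ D := (tsupport_indicator_subset hK h02).trans hKD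
  set a : Eu d → Eu d := fun y => (u y)⁻¹ • gradient u y with ha
  set b : Eu d → Eu d := fun y => (v y)⁻¹ • gradient v y with hb
  have hgu : ∀ y ∈ D, gradient u y = u y • a y := fun y hy => by
    simp [ha, smul_smul, mul_inv_cancel₀ (hupos y (hD1 hy)).ne']
  have hgv : ∀ y ∈ D, gradient v y = v y • b y := fun y hy => by
    simp [hb, smul_smul, mul_inv_cancel₀ (hvpos y (hD1 hy)).ne']
  have hgw : ∀ y ∈ D, HasGradientAt w (a y - b y) y := by
    intro y hy
    have e1 := (hu.hasGradientAt (hD1 hy)).fcomp (Real.hasDerivAt_log (hupos y (hD1 hy)).ne')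
    have e2 := (hv.hasGradientAt (hD1 hy)).fcomp (Real.hasDerivAt_log (hvpos y (hD1 hy)).ne')
    simpa using ((e1.fsub e2).fsub (hasGradientAt_const y (Real.log c))).fsub
      (hasGradientAt_const y ε)
  set h' : Eu d → ℝ := fun y => 2 * (max (w y) 0) with hh'
  have hgH : ∀ y ∈ D, HasGradientAt H (h' y • (a y - b y)) y := by
    intro y hy
    have e2 := (hgw y hy).fcomp (hasDerivAt_max_rpow one_lt_two (w y))
    rwa [show (2 : ℝ) - 1 = 1 by norm_num, Real.rpow_one] at e2
  have hgF : ∀ y ∈ D, gradient F y = h' y • (a y - b y) := fun y hy =>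
    ((hgH y hy).indicator hD hy).gradient
  have hgF1 : ∀ y ∈ D, gradient F₁ y = u y • (h' y • (a y - b y) + H y • a y) := by
    intro y hy
    have := (((hu.hasGradientAt (hD1 hy)).fmul (hgH y hy)).indicator hD hy).gradient
    rw [this, hgu y hy, smul_add, smul_comm (u y) (H y) (a y)]
  have hgF2 : ∀ y ∈ D, gradient F₂ y =
      P y • (h' y • (a y - b y) + H y • (p • a y - (p - 1) • b y)) := by
    intro y hy
    have hu0 := hupos y (hD1 hy)
    have hv0 := hvpos y (hD1 hy)
    have e1 := (hu.hasGradientAt (hD1 hy)).fcomp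
      (Real.hasDerivAt_rpow_const (p := p) (Or.inl hu0.ne'))
    have e2 := (hv.hasGradientAt (hD1 hy)).fcomp
      (Real.hasDerivAt_rpow_const (p := 1 - p) (Or.inl hv0.ne'))
    have e3 : HasGradientAt P (P y • (p • a y - (p - 1) • b y)) y := by
      have := e1.fmul e2
      convert this using 1
      rw [hgu y hy, hgv y hy]
      have r1 : u y ^ (p - 1) * u y = u y ^ p := rpow_sub_one_mul_self hp hu0.le
      have r2 : v y ^ (1 - p - 1) * v y = v y ^ (1 - p) := by
        rw [← Real.rpow_add_one hv0.ne']; congr 1; ring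
      simp only [hP, smul_smul]
      rw [show u y ^ p * ((1 - p) * v y ^ (1 - p - 1) * v y) =
        (u y ^ p * v y ^ (1 - p)) * (1 - p) by rw [← r2]; ring,
        show v y ^ (1 - p) * (p * u y ^ (p - 1) * u y) =
        (u y ^ p * v y ^ (1 - p)) * p by rw [← r1]; ring]
      module
    have := ((e3.fmul (hgH y hy)).indicator hD hy).gradient
    rw [this]; module
  have q1 := hu.eq F₁ hF1 hFc1 (ht1.trans hD1)
  have q2 := hv.eq F₂ hF2 hFc2 (ht2.trans hD1)
  have i1 := hu.integrable_flux hp hF1 hFc1 (ht1.trans hD1)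
  have i2 := hv.integrable_flux hp hF2 hFc2 (ht2.trans hD1)
  have hrhs : (∫ y, (-V y * u y ^ (p - 1)) * F₁ y) = ∫ y, (-V y * v y ^ (p - 1)) * F₂ y := by
    congr 1; ext y
    by_cases hy : y ∈ D
    · have f1 : F₁ y = u y * H y := indicator_of_mem hy H₁
      have f2 : F₂ y = (u y ^ p * v y ^ (1 - p)) * H y := indicator_of_mem hy H₂
      have hu0 := hupos y (hD1 hy)
      have hv0 := hvpos y (hD1 hy)
      have r1 : u y ^ (p - 1) * u y = u y ^ p := rpow_sub_one_mul_self hp hu0.le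
      have r2 : v y ^ (p - 1) * v y ^ (1 - p) = 1 := by
        rw [← Real.rpow_add hv0]; simp
      rw [f1, f2]
      linear_combination (-V y * H y) * r1 + V y * H y * u y ^ p * r2
    · have f1 : F₁ y = 0 := indicator_of_notMem hy H₁
      have f2 : F₂ y = 0 := indicator_of_notMem hy H₂
      simp [f1, f2]
  have hle : ∫ y, (⟪flux p (gradient u y), gradient F₁ y⟫ - ⟪flux p (gradient v y), gradient F₂ y⟫)
      ≤ 0 := by
    rw [integral_sub i1 i2, q1, q2, hrhs, sub_self]
  have hform : ∀ y ∈ D,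
      ⟪flux p (gradient u y), gradient F₁ y⟫ - ⟪flux p (gradient v y), gradient F₂ y⟫ =
      u y ^ p * (h' y * ⟪flux p (a y) - flux p (b y), a y - b y⟫ +
        H y * (‖a y‖ ^ p - p * ⟪flux p (b y), a y⟫ + (p - 1) * ‖b y‖ ^ p)) := by
    intro y hy
    have hu0 := hupos y (hD1 hy)
    have hv0 := hvpos y (hD1 hy)
    have r1 : u y ^ (p - 1) * u y = u y ^ p := rpow_sub_one_mul_self hp hu0.le
    have r2 : v y ^ (p - 1) * v y ^ (1 - p) = 1 := by
      rw [← Real.rpow_add hv0]; simp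
    rw [hgF1 y hy, hgF2 y hy, hgu y hy, hgv y hy, flux_smul hp hu0.le, flux_smul hp hv0.le]
    simp only [inner_add_right, inner_sub_right, inner_sub_left, real_inner_smul_left,
      real_inner_smul_right, inner_flux_self hp]
    have r3 : v y ^ (p - 1) * P y = u y ^ p := by
      simp only [hP]; linear_combination (u y ^ p) * r2
    linear_combination (h' y * (‖a y‖ ^ p - ⟪flux p (a y), b y⟫) + H y * ‖a y‖ ^ p) * r1 -
      (h' y * (⟪flux p (b y), a y⟫ - ‖b y‖ ^ p) +
        H y * (p * ⟪flux p (b y), a y⟫ - (p - 1) * ‖b y‖ ^ p)) * r3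
  have hH0 : ∀ y, 0 ≤ H y := fun y => by simp only [hH]; positivity
  have hh0 : ∀ y, 0 ≤ h' y := fun y => by simp only [hh']; positivity
  have hz : ∀ y, ⟪flux p (gradient u y), gradient F₁ y⟫ -
      ⟪flux p (gradient v y), gradient F₂ y⟫ = 0 := by
    refine eq_zero_of_integral_eq_zero ?_ (i1.sub i2) ?_ hle
    · refine continuous_of_continuousOn_of_eq_zero hD hK.isClosed hKD ?_ ?_
      · exact (((hu.continuousOn_flux hp).mono hD1).inner
          hF1.continuous_gradient'.continuousOn).sub (((hv.continuousOn_flux hp).mono hD1).inner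
          hF2.continuous_gradient'.continuousOn)
      · intro y hy
        rw [gradient_eq_zero_of_notMem fun h => hy (tsupport_indicator_subset hK h01 h),
          gradient_eq_zero_of_notMem fun h => hy (tsupport_indicator_subset hK h02 h)]; simp
    · intro y
      by_cases hy : y ∈ D
      · rw [hform y hy]
        have hu0 := hupos y (hD1 hy)
        exact mul_nonneg (by positivity) (add_nonneg (mul_nonneg (hh0 y) (flux_monotone hp _ _))
          (mul_nonneg (hH0 y) (picone_nonneg hp _ _)))
      · rw [gradient_eq_zero_of_notMem fun h => hy (ht1 h),
          gradient_eq_zero_of_notMem fun h => hy (ht2 h)]; simp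
  have hg0 : ∀ y, gradient F y = 0 := by
    intro y
    by_cases hy : y ∈ D
    · have h5 := hz y
      have hu0 : 0 < u y ^ p := Real.rpow_pos_of_pos (hupos y (hD1 hy)) _
      rw [hform y hy, mul_eq_zero, or_iff_right hu0.ne'] at h5
      have h6 := mul_nonneg (hh0 y) (flux_monotone hp (a y) (b y))
      have h7 := mul_nonneg (hH0 y) (picone_nonneg hp (a y) (b y))
      have h8 : h' y * ⟪flux p (a y) - flux p (b y), a y - b y⟫ = 0 := by linarith
      rw [hgF y hy]
      rcases mul_eq_zero.1 h8 with h | h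
      · rw [h, zero_smul]
      · rw [eq_of_inner_flux_sub_eq_zero hp h, sub_self, smul_zero]
    · exact gradient_eq_zero_of_notMem fun h => hy (ht h)
  have hFx := eq_zero_of_gradient_eq_zero hd hF hFc hg0 x
  have hFx' : F x = (max (w x) 0) ^ (2 : ℝ) := indicator_of_mem hx H
  rw [hFx', Real.rpow_eq_zero (le_max_right _ _) (by norm_num)] at hFx
  have := le_max_left (w x) 0
  rw [hFx] at this
  simp only [hw] at this
  linarith

/-! ### Sobolev's inequality and the basic iteration lemma -/

lemma integrable_norm_gradient {f : Eu d → ℝ} (hf : ContDiff ℝ 1 f) (hc : HasCompactSupport f) :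
    Integrable fun x => ‖gradient f x‖ :=
  hf.continuous_gradient'.norm.integrable_of_hasCompactSupport
    (HasCompactSupport.intro hc fun x hx => by rw [gradient_eq_zero_of_notMem hx, norm_zero])

/-- The `W^{1,1}` Sobolev inequality combined with Hölder's inequality on the support. -/
lemma exists_sobolev_const (hd : 2 ≤ d) : ∃ C : ℝ, 0 < C ∧ ∀ (f : Eu d → ℝ) (S : Set (Eu d)),
    ContDiff ℝ 1 f → HasCompactSupport f → MeasurableSet S → volume S ≠ ∞ →
    (∀ x, 0 ≤ f x) → (∀ x ∉ S, f x = 0) →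
    ∫ x, f x ≤ C * (∫ x, ‖gradient f x‖) * (volume.real S) ^ ((1 : ℝ) / d) := by
  have hd1 : (1 : ℝ) < d := by exact_mod_cast hd
  have hq := Real.HolderConjugate.conjExponent hd1
  set q := Real.conjExponent (d : ℝ) with hqdef
  have hq' : Real.HolderConjugate (Module.finrank ℝ (Eu d) : ℝ) q := by
    simpa using hq
  set C₀ := lintegralPowLePowLIntegralFDerivConst (volume : Measure (Eu d)) q
  refine ⟨(C₀ : ℝ) ^ (1 / q) + 1, by positivity, fun f S hf hc hS hSf h0 hfS => ?_⟩
  have h1 := lintegral_pow_le_pow_lintegral_fderiv (volume : Measure (Eu d)) hf hc hq'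
  have h2 := ENNReal.lintegral_mul_le_Lp_mul_Lq (volume : Measure (Eu d)) hq.symm
    (f := fun x => ‖f x‖ₑ) (g := S.indicator 1) hf.continuous.enorm.aemeasurable
    (measurable_one.indicator hS).aemeasurable
  have e1 : ∀ x, ((fun x => ‖f x‖ₑ) * S.indicator (1 : Eu d → ℝ≥0∞)) x = ‖f x‖ₑ := by
    intro x
    by_cases hx : x ∈ S
    · simp [hx]
    · simp [hx, hfS x hx]
  have e2 : ∫⁻ x, (S.indicator (1 : Eu d → ℝ≥0∞) x) ^ (d : ℝ) = volume S := by
    rw [← lintegral_indicator_one hS]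
    congr 1; ext x
    by_cases hx : x ∈ S
    · simp [hx]
    · simp only [hx, not_false_eq_true, indicator_of_notMem]
      rw [ENNReal.zero_rpow_of_pos (by linarith)]
  simp only [e1, e2] at h2
  have h3 : ∫⁻ x, ‖f x‖ₑ ≤ (C₀ : ℝ≥0∞) ^ (1 / q) * (∫⁻ x, ‖fderiv ℝ f x‖ₑ) *
      (volume S) ^ ((1 : ℝ) / d) := by
    refine h2.trans (mul_le_mul_left ?_ _)
    refine (ENNReal.rpow_le_rpow h1 (by have := hq.symm.pos; positivity)).trans ?_
    rw [ENNReal.mul_rpow_of_nonneg _ _ (by have := hq.symm.pos; positivity), ← ENNReal.rpow_mul,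
      mul_one_div_cancel hq.symm.pos.ne', ENNReal.rpow_one]
  have i1 : Integrable f := hf.continuous.integrable_of_hasCompactSupport hc
  have i2 : Integrable (fun x => fderiv ℝ f x) :=
    (hf.continuous_fderiv (by norm_num)).integrable_of_hasCompactSupport (hc.fderiv ℝ)
  have h4 := ENNReal.toReal_mono (by
    refine ENNReal.mul_ne_top (ENNReal.mul_ne_top ?_ i2.hasFiniteIntegral.ne) ?_
    · exact ENNReal.rpow_ne_top_of_nonneg (by have := hq.symm.pos; positivity) ENNReal.coe_ne_top
    · exact ENNReal.rpow_ne_top_of_nonneg (by positivity) hSf) h3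
  rw [ENNReal.toReal_mul, ENNReal.toReal_mul, ← ENNReal.toReal_rpow, ← ENNReal.toReal_rpow,
    ← integral_norm_eq_lintegral_enorm i1.aestronglyMeasurable,
    ← integral_norm_eq_lintegral_enorm i2.aestronglyMeasurable] at h4
  simp only [Real.norm_of_nonneg (h0 _), ← norm_gradient_eq] at h4
  refine h4.trans ?_
  have i3 : 0 ≤ ∫ x, ‖gradient f x‖ := integral_nonneg fun _ => norm_nonneg _
  gcongr
  · simp
  · rfl

/-- Fast geometric convergence. -/
lemma exists_iteration_const (hd : 0 < d) {C b : ℝ} (hC : 0 < C) (hb : 1 < b) :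
    ∃ δ : ℝ, 0 < δ ∧ ∀ Y : ℕ → ℝ, (∀ j, 0 ≤ Y j) → Y 0 ≤ δ →
      (∀ j, Y (j + 1) ≤ C * b ^ j * Y j * (Y j) ^ ((1 : ℝ) / d)) → Tendsto Y atTop (𝓝 0) := by
  have hd' : (0 : ℝ) < d := by exact_mod_cast hd
  have hb0 : 0 < b := by linarith
  set q : ℝ := (b ^ d)⁻¹ with hq
  have hq0 : 0 < q := by positivity
  have hq1 : q < 1 := inv_lt_one_of_one_lt₀ (one_lt_pow₀ hb hd.ne')
  refine ⟨(q / C) ^ d, by positivity, fun Y hY0 hYδ hY => ?_⟩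
  have hdr : (((q / C) ^ d : ℝ)) ^ ((1 : ℝ) / d) = q / C := by
    rw [← Real.rpow_natCast, ← Real.rpow_mul (by positivity), mul_one_div_cancel hd'.ne',
      Real.rpow_one]
  have hqr : ∀ j : ℕ, (q ^ j) ^ ((1 : ℝ) / d) = (b ^ j)⁻¹ := by
    intro j
    rw [hq, inv_pow, ← pow_mul, mul_comm d j, pow_mul, ← Real.rpow_natCast _ d,
      Real.inv_rpow (by positivity), ← Real.rpow_mul (by positivity), mul_one_div_cancel hd'.ne',
      Real.rpow_one]
  have key : ∀ j, Y j ≤ (q / C) ^ d * q ^ j := by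
    intro j
    induction j with
    | zero => simpa using hYδ
    | succ j ih =>
      refine (hY j).trans ?_
      have h1 : (Y j) ^ ((1 : ℝ) / d) ≤ q / C * (b ^ j)⁻¹ := by
        refine (Real.rpow_le_rpow (hY0 j) ih (by positivity)).trans ?_
        rw [Real.mul_rpow (by positivity) (by positivity), hdr, hqr]
      calc C * b ^ j * Y j * (Y j) ^ ((1 : ℝ) / d)
          ≤ C * b ^ j * ((q / C) ^ d * q ^ j) * (q / C * (b ^ j)⁻¹) := by
            gcongr
            exact Real.rpow_nonneg (hY0 j) _
        _ = (q / C) ^ d * q ^ (j + 1) := by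
            have := pow_pos hb0 j
            field_simp
            ring
  refine squeeze_zero hY0 key ?_
  simpa using (tendsto_pow_atTop_nhds_zero_of_lt_one hq0.le hq1).const_mul ((q / C) ^ d)

/-! ### Elementary inequalities -/

lemma young_cutoff (hp : 1 < p) {m : ℕ} (hm : p ≤ m) {s a b : ℝ} (hs0 : 0 ≤ s) (hs1 : s ≤ 1)
    (ha : 0 ≤ a) (hb : 0 ≤ b) {ε : ℝ} (hε : 0 < ε) (hε1 : ε ≤ 1) :
    m * s ^ (m - 1) * a ^ (p - 1) * b ≤ ε * (s ^ m * a ^ p) + (m / ε * b) ^ p := by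
  have hm1 : 1 ≤ m := by
    have : (1 : ℝ) < m := hp.trans_le hm
    exact_mod_cast this.le
  have hms : s ^ (m - 1) * s = s ^ m := by
    rw [← pow_succ, Nat.sub_add_cancel hm1]
  rcases le_total (m / ε * b) (s * a) with h | h
  · have h' : m * b ≤ ε * (s * a) := by
      rw [div_mul_eq_mul_div, div_le_iff₀ hε] at h; linarith
    have h2 : 0 ≤ (m / ε * b) ^ p := by positivity
    calc m * s ^ (m - 1) * a ^ (p - 1) * b = s ^ (m - 1) * a ^ (p - 1) * (m * b) := by ring
      _ ≤ s ^ (m - 1) * a ^ (p - 1) * (ε * (s * a)) := by gcongr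
      _ = ε * ((s ^ (m - 1) * s) * (a ^ (p - 1) * a)) := by ring
      _ = ε * (s ^ m * a ^ p) := by rw [hms, rpow_sub_one_mul_self hp ha]
      _ ≤ _ := by linarith
  · have h1 : s ^ (m - 1) ≤ s ^ (p - 1) := by
      rw [← Real.rpow_natCast]
      apply Real.rpow_le_rpow_of_exponent_ge' hs0 hs1 (by linarith)
      rw [Nat.cast_sub hm1]; simpa using hm
    have h2 : 0 ≤ ε * (s ^ m * a ^ p) := by positivity
    have hmb : m * b ≤ m / ε * b := by
      gcongr
      rw [le_div_iff₀ hε]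
      nlinarith [(Nat.cast_nonneg m : (0 : ℝ) ≤ m)]
    calc m * s ^ (m - 1) * a ^ (p - 1) * b = (s ^ (m - 1) * a ^ (p - 1)) * (m * b) := by ring
      _ ≤ (s ^ (p - 1) * a ^ (p - 1)) * (m / ε * b) := by gcongr
      _ = (s * a) ^ (p - 1) * (m / ε * b) := by rw [Real.mul_rpow hs0 ha]
      _ ≤ (m / ε * b) ^ (p - 1) * (m / ε * b) := by
          gcongr
      _ = (m / ε * b) ^ p := rpow_sub_one_mul_self hp (by positivity)
      _ ≤ _ := by linarith

lemma rpow_sub_one_mul_le_add (hp : 1 < p) {s a : ℝ} (hs : 0 ≤ s) (ha : 0 ≤ a) :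
    s ^ (p - 1) * a ≤ s ^ p + a ^ p := by
  have h1 : 0 ≤ s ^ p := by positivity
  have h2 : 0 ≤ a ^ p := by positivity
  rcases le_total s a with h | h
  · have : s ^ (p - 1) * a ≤ a ^ (p - 1) * a := by
      gcongr
    rw [rpow_sub_one_mul_self hp ha] at this
    linarith
  · have : s ^ (p - 1) * a ≤ s ^ (p - 1) * s := by gcongr
    rw [rpow_sub_one_mul_self hp hs] at this
    linarith

/-! ### Cutoff functions -/

/-- A `C¹` cutoff function of the ball of radius `R`. -/
def cutoff (R : ℝ) (x : Eu d) : ℝ := (max (R ^ 2 - ‖x‖ ^ 2) 0) ^ (2 : ℝ)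

lemma contDiff_cutoff (R : ℝ) : ContDiff ℝ 1 (cutoff R : Eu d → ℝ) :=
  (contDiff_max_rpow one_lt_two).comp (contDiff_const.sub (contDiff_norm_sq ℝ))

lemma cutoff_nonneg (R : ℝ) (x : Eu d) : 0 ≤ cutoff R x := by unfold cutoff; positivity

lemma cutoff_le {R : ℝ} (x : Eu d) : cutoff R x ≤ (R ^ 2) ^ 2 := by
  unfold cutoff
  rw [Real.rpow_two]
  have : max (R ^ 2 - ‖x‖ ^ 2) 0 ≤ R ^ 2 := max_le (by nlinarith [norm_nonneg x]) (by positivity)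
  gcongr

lemma cutoff_eq_zero {R : ℝ} (hR : 0 ≤ R) {x : Eu d} (hx : x ∉ closedBall (0 : Eu d) R) :
    cutoff R x = 0 := by
  rw [mem_closedBall_zero_iff, not_le] at hx
  unfold cutoff
  rw [max_eq_right (by nlinarith), Real.zero_rpow (by norm_num)]

lemma le_cutoff {r R : ℝ} (hr : 0 ≤ r) (hrR : r ≤ R) {x : Eu d} (hx : x ∈ closedBall (0 : Eu d) r) :
    (R ^ 2 - r ^ 2) ^ 2 ≤ cutoff R x := by
  rw [mem_closedBall_zero_iff] at hx
  unfold cutoff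
  rw [Real.rpow_two]
  have : 0 ≤ R ^ 2 - r ^ 2 := by nlinarith
  have h2 : R ^ 2 - r ^ 2 ≤ max (R ^ 2 - ‖x‖ ^ 2) 0 :=
    le_max_of_le_left (by nlinarith [norm_nonneg x])
  gcongr

lemma norm_gradient_cutoff_le {R : ℝ} (hR : 0 ≤ R) (x : Eu d) :
    ‖gradient (cutoff R) x‖ ≤ 4 * R ^ 3 := by
  have h1 : HasGradientAt (fun y : Eu d => R ^ 2 - ‖y‖ ^ 2) (-(2 : ℝ) • x) x := by
    have h2 := (hasStrictFDerivAt_norm_sq x).hasFDerivAt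
    have e : InnerProductSpace.toDual ℝ (Eu d) ((2 : ℝ) • x) = 2 • innerSL ℝ x := by
      ext y; simp
    have h3 : HasGradientAt (fun y : Eu d => ‖y‖ ^ 2) ((2 : ℝ) • x) x := by
      rw [hasGradientAt_iff_hasFDerivAt, e]; exact h2
    simpa using (hasGradientAt_const x (R ^ 2)).fsub h3
  have h2 := (HasGradientAt.fcomp (f := fun y : Eu d => R ^ 2 - ‖y‖ ^ 2)
    (hasDerivAt_max_rpow one_lt_two (R ^ 2 - ‖x‖ ^ 2)) h1).gradient
  rw [show (2 : ℝ) - 1 = 1 by norm_num, Real.rpow_one] at h2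
  change gradient (cutoff R) x = _ at h2
  rw [h2, norm_smul, norm_smul]
  simp only [norm_neg, Real.norm_ofNat, norm_mul]
  rw [Real.norm_of_nonneg (le_max_right _ _)]
  rcases le_total ‖x‖ R with h | h
  · have : max (R ^ 2 - ‖x‖ ^ 2) 0 ≤ R ^ 2 := max_le (by nlinarith [norm_nonneg x]) (by positivity)
    have h3 : max (R ^ 2 - ‖x‖ ^ 2) 0 * ‖x‖ ≤ R ^ 2 * R := by gcongr
    nlinarith
  · rw [max_eq_right (by nlinarith [norm_nonneg x])]
    have : 0 ≤ 4 * R ^ 3 := by positivity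
    simpa using this

/-! ### De Giorgi iteration -/

lemma rpow_sq_le_add (hp : 1 < p) {t : ℝ} (ht : 0 < t) : t ^ (2 : ℝ) ≤ t ^ (p + 1) + 1 := by
  rcases le_total t 1 with h | h
  · have := Real.rpow_le_one ht.le h (by norm_num : (0 : ℝ) ≤ 2)
    have : 0 ≤ t ^ (p + 1) := by positivity
    linarith
  · have := Real.rpow_le_rpow_of_exponent_le h (by linarith : (2 : ℝ) ≤ p + 1)
    linarith

set_option maxHeartbeats 1600000 in
/-- One step of the De Giorgi iteration. -/
lemma exists_deGiorgi_step (hd : 2 ≤ d) (hp : 1 < p) {Λ : ℝ} (hΛ : 0 ≤ Λ) :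
    ∃ C : ℝ, 0 < C ∧ ∃ m n : ℕ, ∀ (Ω : Set (Eu d)) (w g : Eu d → ℝ) (r R k l : ℝ),
      PSol p Ω w g → closedBall 0 R ⊆ Ω → 0 ≤ r → r < R → R ≤ 1 → 0 ≤ k → k < l → l ≤ k + 1 →
      (∀ x ∈ closedBall 0 R, 0 < w x → g x ≤ Λ) →
      ∫ x in closedBall 0 r, (max (w x - l) 0) ^ (p + 1) ≤
        C * (((l - k)⁻¹) ^ n * ((R ^ 2 - r ^ 2)⁻¹) ^ m) *
          (∫ x in closedBall 0 R, (max (w x - k) 0) ^ (p + 1)) *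
          (∫ x in closedBall 0 R, (max (w x - k) 0) ^ (p + 1)) ^ ((1 : ℝ) / d) := by
  obtain ⟨C₀, hC₀, hsob⟩ := exists_sobolev_const hd
  obtain ⟨m, hm⟩ := exists_nat_ge p
  obtain ⟨n, hn⟩ := exists_nat_ge (p + 1)
  set A : ℝ := (p + 1 + 4 * m) + (p + 1) * (2 * Λ + (m * 4) ^ p) with hA
  have hA0 : 0 < A := by positivity
  refine ⟨C₀ * A, by positivity, 2 * m, 2 * n, ?_⟩
  intro Ω w g r R k l hw hRΩ hr hrR hR1 hk hkl hlk hg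
  set B := closedBall (0 : Eu d) R
  have hBc : IsCompact B := isCompact_closedBall 0 R
  have hR0 : 0 ≤ R := hr.trans hrR.le
  set h := l - k with hh
  have hh0 : 0 < h := by simp only [hh]; linarith
  have hh1 : h ≤ 1 := by simp only [hh]; linarith
  set v : Eu d → ℝ := fun x => max (w x - l) 0 with hv
  have hv0 : ∀ x, 0 ≤ v x := fun x => le_max_right _ _
  set ζ : Eu d → ℝ := cutoff R with hζ
  have hζ0 : ∀ x, 0 ≤ ζ x := cutoff_nonneg R
  have hζ1 : ∀ x, ζ x ≤ 1 := fun x => (cutoff_le x).trans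
    (pow_le_one₀ (by positivity) (pow_le_one₀ hR0 hR1))
  have hζg : ∀ x, ‖gradient ζ x‖ ≤ 4 := fun x => (norm_gradient_cutoff_le hR0 x).trans (by
    have := pow_le_one₀ (n := 3) hR0 hR1; linarith)
  have hζs : ContDiff ℝ 1 ζ := contDiff_cutoff R
  set a : Eu d → ℝ := fun x => ‖gradient w x‖ with ha
  have ha0 : ∀ x, 0 ≤ a x := fun x => norm_nonneg _
  have hwc : ContinuousOn w B := hw.contDiffOn.continuousOn.mono hRΩ
  have hvc : ContinuousOn v B := (hwc.sub continuousOn_const).sup continuousOn_const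
  have hac : ContinuousOn a B :=
    ((hw.contDiffOn.continuousOn_gradient hw.isOpen).mono hRΩ).norm
  have hζc : ContinuousOn ζ B := hζs.continuous.continuousOn
  have hapc : ContinuousOn (fun x => a x ^ p) B := hac.rpow_const fun _ _ => Or.inr (by linarith)
  have hvpc : ContinuousOn (fun x => v x ^ (p + 1)) B :=
    hvc.rpow_const fun _ _ => Or.inr (by linarith)
  have hm1 : 1 ≤ m := by
    have : (1 : ℝ) < m := hp.trans_le hm
    exact_mod_cast this.le
  -- test functions
  have hζm : ∀ x, HasGradientAt (fun y => ζ y ^ m) ((m * ζ x ^ (m - 1)) • gradient ζ x) x :=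
    fun x => (hζs.hasGradientAt' x).fcomp (hasDerivAt_pow m (ζ x))
  have hvg : ∀ q : ℝ, 1 < q → ∀ x ∈ Ω,
      HasGradientAt (fun y => v y ^ q) ((q * v x ^ (q - 1)) • gradient w x) x := by
    intro q hq x hx
    have e1 : HasGradientAt (fun y => w y - l) (gradient w x) x := by
      simpa using (hw.hasGradientAt hx).fsub (hasGradientAt_const x l)
    exact HasGradientAt.fcomp (f := fun y => w y - l) (hasDerivAt_max_rpow hq (w x - l)) e1
  have htest : ∀ q : ℝ, 1 < q → ContDiffOn ℝ 1 (fun y => ζ y ^ m * v y ^ q) Ω := fun q hq =>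
    (hζs.pow m).contDiffOn.mul ((contDiff_max_rpow hq).comp_contDiffOn
      (hw.contDiffOn.sub contDiffOn_const))
  have htest0 : ∀ q : ℝ, ∀ x ∈ Ω, x ∉ B → ζ x ^ m * v x ^ q = 0 := by
    intro q x _ hx
    rw [hζ, cutoff_eq_zero hR0 hx, zero_pow (by omega), zero_mul]
  have htestg : ∀ q : ℝ, 1 < q → ∀ x ∈ Ω,
      gradient (Ω.indicator fun y => ζ y ^ m * v y ^ q) x =
        (ζ x ^ m * (q * v x ^ (q - 1))) • gradient w x +
        (v x ^ q * (m * ζ x ^ (m - 1))) • gradient ζ x := by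
    intro q hq x hx
    have := (((hζm x).fmul (hvg q hq x hx)).indicator hw.isOpen hx).gradient
    rw [this, smul_smul, smul_smul]
  set F := Ω.indicator fun y => ζ y ^ m * v y ^ (2 : ℝ) with hF
  set f := Ω.indicator fun y => ζ y ^ m * v y ^ (p + 1) with hf
  have hF1 : ContDiff ℝ 1 F :=
    contDiff_indicator hw.isOpen hBc hRΩ (htest 2 one_lt_two) (htest0 2)
  have hF2 : HasCompactSupport F := hasCompactSupport_indicator hBc (htest0 2)
  have hF3 : tsupport F ⊆ B := tsupport_indicator_subset hBc (htest0 2)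
  have hf1 : ContDiff ℝ 1 f :=
    contDiff_indicator hw.isOpen hBc hRΩ (htest (p + 1) (by linarith)) (htest0 (p + 1))
  have hf2 : HasCompactSupport f := hasCompactSupport_indicator hBc (htest0 (p + 1))
  have hf3 : tsupport f ⊆ B := tsupport_indicator_subset hBc (htest0 (p + 1))
  -- the superlevel set
  set S : Set (Eu d) := {x ∈ B | l < w x} with hS
  have hSm : MeasurableSet S := by
    have h1 : S = B ∩ (Ω ∩ w ⁻¹' Ioi l) := by
      ext x; constructor
      · rintro ⟨h1, h2⟩; exact ⟨h1, hRΩ h1, h2⟩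
      · rintro ⟨h1, _, h2⟩; exact ⟨h1, h2⟩
    rw [h1]
    exact isClosed_closedBall.measurableSet.inter
      (hw.contDiffOn.continuousOn.isOpen_inter_preimage hw.isOpen isOpen_Ioi).measurableSet
  have hSf : volume S ≠ ∞ :=
    ne_top_of_le_ne_top hBc.measure_lt_top.ne (measure_mono fun x hx => hx.1)
  set Y := ∫ x in B, (max (w x - k) 0) ^ (p + 1) with hY
  have hYi : IntegrableOn (fun x => (max (w x - k) 0) ^ (p + 1)) B :=
    (((hwc.sub continuousOn_const).sup continuousOn_const).rpow_const
      fun _ _ => Or.inr (by linarith)).integrableOn_compact hBc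
  have hY0 : 0 ≤ Y := integral_nonneg fun x => by positivity
  have hvi : IntegrableOn (fun x => v x ^ (p + 1)) B := hvpc.integrableOn_compact hBc
  have hvY : ∫ x in B, v x ^ (p + 1) ≤ Y := by
    refine setIntegral_mono_on hvi hYi isClosed_closedBall.measurableSet fun x _ => ?_
    have : v x ≤ max (w x - k) 0 := max_le_max (by linarith) le_rfl
    exact Real.rpow_le_rpow (hv0 x) this (by linarith)
  have hSi : IntegrableOn (S.indicator fun _ => (1 : ℝ)) B :=
    ((integrable_indicator_iff hSm).2 (integrableOn_const hSf)).integrableOn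
  have hSint : ∫ x in B, S.indicator (fun _ => (1 : ℝ)) x = volume.real S := by
    rw [setIntegral_indicator hSm, inter_eq_self_of_subset_right (fun x hx => hx.1)]
    simp
  have hSY : volume.real S ≤ (h⁻¹) ^ n * Y := by
    have h1 : volume.real S * h ^ (p + 1) ≤ Y := by
      rw [← hSint, ← integral_mul_const]
      refine setIntegral_mono_on (hSi.mul_const _) hYi isClosed_closedBall.measurableSet
        fun x _ => ?_
      by_cases hx : x ∈ S
      · rw [indicator_of_mem hx, one_mul]
        refine Real.rpow_le_rpow hh0.le (le_max_of_le_left ?_) (by linarith)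
        have := hx.2; simp only [hh]; linarith
      · rw [indicator_of_notMem hx, zero_mul]; positivity
    have h2 : h ^ n ≤ h ^ (p + 1) := by
      rw [← Real.rpow_natCast]
      exact Real.rpow_le_rpow_of_exponent_ge hh0 hh1 hn
    have h3 : volume.real S * h ^ n ≤ Y :=
      (mul_le_mul_of_nonneg_left h2 measureReal_nonneg).trans h1
    rw [inv_pow, ← div_eq_inv_mul, le_div_iff₀ (by positivity)]
    exact h3
  -- energy estimate
  set E := ∫ x in B, ζ x ^ m * v x * a x ^ p with hE
  have hEi : IntegrableOn (fun x => ζ x ^ m * v x * a x ^ p) B :=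
    (((hζc.pow m).mul hvc).mul hapc).integrableOn_compact hBc
  have hEle : E ≤ Λ * (Y + volume.real S) + (m * 4) ^ p * Y := by
    have heq := hw.eq F hF1 hF2 (hF3.trans hRΩ)
    rw [← setIntegral_eq_integral_of_forall_compl_eq_zero (s := B)
      (fun x hx => by rw [gradient_eq_zero_of_notMem fun h => hx (hF3 h), inner_zero_right]),
      ← setIntegral_eq_integral_of_forall_compl_eq_zero (s := B)
      (f := fun x => g x * F x) (fun x hx => by
        rw [image_eq_zero_of_notMem_tsupport fun h => hx (hF3 h), mul_zero])] at heq
    have hlow : E - (m * 4) ^ p * ∫ x in B, v x ^ (p + 1) ≤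
        ∫ x in B, ⟪flux p (gradient w x), gradient F x⟫ := by
      rw [hE, ← integral_const_mul, ← integral_sub hEi (hvi.const_mul _)]
      refine setIntegral_mono_on (hEi.sub (hvi.const_mul _))
        (hw.integrable_flux hp hF1 hF2 (hF3.trans hRΩ)).integrableOn
        isClosed_closedBall.measurableSet fun x hx => ?_
      rw [htestg 2 one_lt_two x (hRΩ hx), inner_add_right, real_inner_smul_right,
        real_inner_smul_right, inner_flux_self hp, show (2 : ℝ) - 1 = 1 by norm_num, Real.rpow_one]
      have h1 := young_cutoff hp hm (hζ0 x) (hζ1 x) (ha0 x)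
        (mul_nonneg (hv0 x) zero_le_four) one_pos le_rfl
      have h2 : -(a x ^ (p - 1) * 4) ≤ ⟪flux p (gradient w x), gradient ζ x⟫ := by
        refine neg_le_of_abs_le ((abs_inner_flux_le hp _ _).trans ?_)
        have := hζg x
        gcongr
      have h3 : 0 ≤ v x ^ (2 : ℝ) * (m * ζ x ^ (m - 1)) := by
        have := hζ0 x; have := hv0 x; positivity
      have h4 := mul_le_mul_of_nonneg_left h2 h3
      have h5 := mul_le_mul_of_nonneg_left h1 (hv0 x)
      have h6 : v x ^ (p + 1) = v x ^ p * v x := by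
        rw [Real.rpow_add_one' (hv0 x) (by linarith)]
      have h7 : (m / 1 * (v x * 4)) ^ p = (m * 4) ^ p * v x ^ p := by
        rw [← Real.mul_rpow (by positivity) (hv0 x)]; congr 1; ring
      rw [h7] at h5
      rw [h6]
      rw [Real.rpow_two] at h4 ⊢
      change ζ x ^ m * v x * a x ^ p - _ ≤ ζ x ^ m * (2 * v x) * a x ^ p + _
      linarith
    have hup : ∫ x in B, g x * F x ≤ Λ * (∫ x in B, v x ^ (p + 1)) + Λ * volume.real S := by
      rw [← hSint, ← mul_add, ← integral_add hvi hSi, ← integral_const_mul]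
      refine setIntegral_mono_on
        (hw.integrable_rhs hF1.continuous hF2 (hF3.trans hRΩ)).integrableOn
        ((hvi.add hSi).const_mul _) isClosed_closedBall.measurableSet fun x hx => ?_
      have e1 : F x = ζ x ^ m * v x ^ (2 : ℝ) := indicator_of_mem (hRΩ hx) _
      rw [e1]
      have hz1 : ζ x ^ m ≤ 1 := pow_le_one₀ (hζ0 x) (hζ1 x)
      have hz0 : 0 ≤ ζ x ^ m := pow_nonneg (hζ0 x) _
      by_cases hxS : l < w x
      · have hvx : 0 < v x := lt_max_of_lt_left (by linarith)
        rw [indicator_of_mem (show x ∈ S from ⟨hx, hxS⟩)]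
        have h1 : 0 ≤ ζ x ^ m * v x ^ (2 : ℝ) := by positivity
        have h2 : ζ x ^ m * v x ^ (2 : ℝ) ≤ v x ^ (p + 1) + 1 := by
          have h3 : 0 ≤ v x ^ (2 : ℝ) := by positivity
          exact (mul_le_of_le_one_left h3 hz1).trans (rpow_sq_le_add hp hvx)
        calc g x * (ζ x ^ m * v x ^ (2 : ℝ)) ≤ Λ * (ζ x ^ m * v x ^ (2 : ℝ)) :=
              mul_le_mul_of_nonneg_right (hg x hx (by linarith)) h1
          _ ≤ _ := by gcongr
      · have hvx : v x = 0 := max_eq_right (by linarith)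
        rw [hvx, Real.zero_rpow (by norm_num), Real.zero_rpow (by linarith)]
        have : 0 ≤ S.indicator (fun _ => (1 : ℝ)) x := indicator_nonneg (by simp) x
        rw [mul_zero, mul_zero, zero_add]; positivity
    rw [heq] at hlow
    have h1 : (m * 4 : ℝ) ^ p * ∫ x in B, v x ^ (p + 1) ≤ (m * 4) ^ p * Y := by gcongr
    have h2 : Λ * ∫ x in B, v x ^ (p + 1) ≤ Λ * Y := by gcongr
    linarith
  -- gradient estimate
  have hgle : ∫ x, ‖gradient f x‖ ≤ (p + 1 + 4 * m) * Y + (p + 1) * E := by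
    rw [← setIntegral_eq_integral_of_forall_compl_eq_zero (s := B)
      (fun x hx => by rw [gradient_eq_zero_of_notMem fun h => hx (hf3 h), norm_zero])]
    have h1 : ∫ x in B, ‖gradient f x‖ ≤
        ∫ x in B, ((p + 1 + 4 * m) * v x ^ (p + 1) + (p + 1) * (ζ x ^ m * v x * a x ^ p)) := by
      refine setIntegral_mono_on (integrable_norm_gradient hf1 hf2).integrableOn
        ((hvi.const_mul _).add (hEi.const_mul _)) isClosed_closedBall.measurableSet fun x hx => ?_
      have hz1 : ζ x ^ m ≤ 1 := pow_le_one₀ (hζ0 x) (hζ1 x)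
      have hz0 : 0 ≤ ζ x ^ m := pow_nonneg (hζ0 x) _
      have hz2 : ζ x ^ (m - 1) ≤ 1 := pow_le_one₀ (hζ0 x) (hζ1 x)
      have hz3 : 0 ≤ ζ x ^ (m - 1) := pow_nonneg (hζ0 x) _
      have hvx := hv0 x
      have hax := ha0 x
      rw [htestg (p + 1) (by linarith) x (hRΩ hx), add_sub_cancel_right]
      refine (norm_add_le _ _).trans ?_
      rw [norm_smul, norm_smul, Real.norm_of_nonneg (by positivity),
        Real.norm_of_nonneg (by positivity)]
      have h2 : v x ^ (p + 1) = v x ^ p * v x := Real.rpow_add_one' hvx (by linarith)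
      have h3 : v x ^ p * a x ≤ v x ^ (p + 1) + v x * a x ^ p := by
        have := mul_le_mul_of_nonneg_left (rpow_sub_one_mul_le_add hp hvx hax) hvx
        rw [← rpow_sub_one_mul_self hp hvx] at this
        rw [h2, ← rpow_sub_one_mul_self hp hvx]
        linarith
      have h4 : ζ x ^ m * (v x ^ p * a x) ≤ v x ^ (p + 1) + ζ x ^ m * v x * a x ^ p := by
        have := mul_le_mul_of_nonneg_left h3 hz0
        have h5 : ζ x ^ m * v x ^ (p + 1) ≤ v x ^ (p + 1) :=
          mul_le_of_le_one_left (by positivity) hz1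
        linarith
      have h5 : v x ^ (p + 1) * (m * ζ x ^ (m - 1)) * ‖gradient ζ x‖ ≤
          v x ^ (p + 1) * (m * 1) * 4 := by
        have := hζg x
        gcongr
      have h6 := mul_le_mul_of_nonneg_left h4 (by linarith : 0 ≤ p + 1)
      change ζ x ^ m * ((p + 1) * v x ^ p) * a x + _ ≤ _
      linarith
    rw [integral_add (hvi.const_mul _) (hEi.const_mul _), integral_const_mul,
      integral_const_mul] at h1
    have h2 : (p + 1 + 4 * m) * ∫ x in B, v x ^ (p + 1) ≤ (p + 1 + 4 * m) * Y := by gcongr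
    linarith
  -- Sobolev
  have hfx : ∀ x ∈ B, f x = ζ x ^ m * v x ^ (p + 1) := fun x hx => indicator_of_mem (hRΩ hx) _
  have hf0 : ∀ x, 0 ≤ f x := fun x => indicator_nonneg (fun y _ =>
    mul_nonneg (pow_nonneg (hζ0 y) _) (Real.rpow_nonneg (hv0 y) _)) x
  have hs := hsob f S hf1 hf2 hSm hSf hf0 fun x hx => by
    by_cases hxB : x ∈ B
    · have hvx : v x = 0 := max_eq_right (by
        by_contra h; exact hx ⟨hxB, by linarith⟩)
      rw [hfx x hxB, hvx, Real.zero_rpow (by linarith), mul_zero]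
    · exact image_eq_zero_of_notMem_tsupport fun h => hxB (hf3 h)
  set s := R ^ 2 - r ^ 2 with hsdef
  have hs0 : 0 < s := by simp only [hsdef]; nlinarith
  have hlow : s ^ (2 * m) * ∫ x in closedBall 0 r, v x ^ (p + 1) ≤ ∫ x, f x := by
    have hsub : closedBall (0 : Eu d) r ⊆ B := closedBall_subset_closedBall hrR.le
    rw [← integral_const_mul]
    have hfi : Integrable f := hf1.continuous.integrable_of_hasCompactSupport hf2
    have h1 : ∫ x in closedBall 0 r, f x ≤ ∫ x, f x :=
      setIntegral_le_integral hfi (Eventually.of_forall hf0)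
    refine le_trans ?_ h1
    refine setIntegral_mono_on ((hvi.mono_set hsub).const_mul _) hfi.integrableOn
      isClosed_closedBall.measurableSet fun x hx => ?_
    rw [hfx x (hsub hx), pow_mul]
    have := le_cutoff hr hrR.le hx
    have := hv0 x
    gcongr
  -- conclusion
  set T := (h⁻¹) ^ n with hT
  have hT1 : 1 ≤ T := one_le_pow₀ ((one_le_inv₀ hh0).2 hh1)
  have hYT : Y ≤ T * Y := le_mul_of_one_le_left hY0 hT1
  have hSr : (volume.real S) ^ ((1 : ℝ) / d) ≤ T * Y ^ ((1 : ℝ) / d) := by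
    refine (Real.rpow_le_rpow measureReal_nonneg hSY (by positivity)).trans ?_
    rw [Real.mul_rpow (by positivity) hY0]
    gcongr
    have hd1 : (1 : ℝ) / d ≤ 1 := by
      rw [div_le_one (by positivity)]; exact_mod_cast (by omega : 1 ≤ d)
    simpa using Real.rpow_le_rpow_of_exponent_le hT1 hd1
  have hgA : ∫ x, ‖gradient f x‖ ≤ A * (T * Y) := by
    refine hgle.trans ?_
    have h1 : (p + 1) * E ≤ (p + 1) * (Λ * (T * Y + T * Y) + (m * 4) ^ p * (T * Y)) := by
      gcongr
      refine hEle.trans ?_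
      gcongr
    have h2 : (p + 1 + 4 * m) * Y ≤ (p + 1 + 4 * m) * (T * Y) := by gcongr
    rw [hA]; linarith
  have hfin : s ^ (2 * m) * ∫ x in closedBall 0 r, v x ^ (p + 1) ≤
      C₀ * (A * (T * Y)) * (T * Y ^ ((1 : ℝ) / d)) := by
    refine hlow.trans (hs.trans ?_)
    gcongr
  rw [inv_pow s, mul_comm 2 n, pow_mul (h⁻¹), ← hT]
  have hsm : 0 < s ^ (2 * m) := by positivity
  calc ∫ x in closedBall 0 r, v x ^ (p + 1)
      = (s ^ (2 * m))⁻¹ * (s ^ (2 * m) * ∫ x in closedBall 0 r, v x ^ (p + 1)) := by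
        field_simp
    _ ≤ (s ^ (2 * m))⁻¹ * (C₀ * (A * (T * Y)) * (T * Y ^ ((1 : ℝ) / d))) := by gcongr
    _ = _ := by ring

/-- De Giorgi's local maximum principle at the centre of the unit ball. -/
lemma exists_deGiorgi_bound (hd : 2 ≤ d) (hp : 1 < p) {Λ : ℝ} (hΛ : 0 ≤ Λ) :
    ∃ δ : ℝ, 0 < δ ∧ ∀ (Ω : Set (Eu d)) (w g : Eu d → ℝ),
      PSol p Ω w g → closedBall 0 1 ⊆ Ω → (∀ x ∈ closedBall 0 1, 0 < w x → g x ≤ Λ) →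
      ∫ x in closedBall 0 1, (max (w x) 0) ^ (p + 1) ≤ δ → w 0 ≤ 1 := by
  obtain ⟨C, hC, m, n, hstep⟩ := exists_deGiorgi_step hd hp hΛ
  obtain ⟨δ, hδ, hiter⟩ := exists_iteration_const (d := d) (by omega)
    (C := C * (2 ^ n * 4 ^ m)) (b := 2 * (2 ^ n * 2 ^ m)) (by positivity) (by
      have h1 : (1 : ℝ) ≤ 2 ^ n := one_le_pow₀ (by norm_num)
      have h2 : (1 : ℝ) ≤ 2 ^ m := one_le_pow₀ (by norm_num)
      nlinarith)
  refine ⟨δ, hδ, fun Ω w g hw hΩ hg hY => ?_⟩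
  set t : ℕ → ℝ := fun j => (1 / 2) ^ j with ht
  have ht0 : ∀ j, 0 < t j := fun j => by positivity
  have ht1 : ∀ j, t j ≤ 1 := fun j => pow_le_one₀ (by norm_num) (by norm_num)
  have hts : ∀ j, t (j + 1) = t j / 2 := fun j => by simp only [ht, pow_succ]; ring
  set Y : ℕ → ℝ := fun j =>
    ∫ x in closedBall (0 : Eu d) ((1 + t j) / 2), (max (w x - (1 - t j)) 0) ^ (p + 1) with hYd
  have hY0 : ∀ j, 0 ≤ Y j := fun j => integral_nonneg fun x => by positivity
  have hYz : Y 0 ≤ δ := by simpa [hYd, ht] using hY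
  have hlim : Tendsto Y atTop (𝓝 0) := by
    refine hiter Y hY0 hYz fun j => ?_
    have h0 := ht0 j
    have h1 := ht1 j
    have key := hstep Ω w g ((1 + t (j + 1)) / 2) ((1 + t j) / 2) (1 - t j) (1 - t (j + 1)) hw
      ((closedBall_subset_closedBall (by linarith)).trans hΩ) (by linarith [ht0 (j + 1)])
      (by linarith [hts j]) (by linarith) (by linarith) (by linarith [hts j])
      (by linarith [ht0 (j + 1)])
      fun x hx => hg x (closedBall_subset_closedBall (by linarith) hx)
    have e1 : ((1 - t (j + 1)) - (1 - t j))⁻¹ = 2 * 2 ^ j := by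
      rw [hts]; simp only [ht, one_div, inv_pow]; field_simp; ring
    have e2 : ((((1 + t j) / 2) ^ 2 - ((1 + t (j + 1)) / 2) ^ 2)⁻¹) ≤ 4 * 2 ^ j := by
      have : t j / 4 ≤ ((1 + t j) / 2) ^ 2 - ((1 + t (j + 1)) / 2) ^ 2 := by
        rw [hts]; nlinarith
      refine (inv_anti₀ (by positivity) this).trans (le_of_eq ?_)
      simp only [ht, one_div, inv_pow]; field_simp
    have e3 : 0 ≤ ((((1 + t j) / 2) ^ 2 - ((1 + t (j + 1)) / 2) ^ 2)⁻¹) := by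
      rw [hts]; exact inv_nonneg.2 (by nlinarith)
    refine key.trans ?_
    have e4 : (2 * 2 ^ j : ℝ) ^ n * (4 * 2 ^ j) ^ m ≤
        (2 ^ n * 4 ^ m) * (2 * (2 ^ n * 2 ^ m)) ^ j := by
      have e5 : (2 * 2 ^ j : ℝ) ^ n * (4 * 2 ^ j) ^ m =
        (2 ^ n * 4 ^ m) * (2 ^ n * 2 ^ m) ^ j := by ring
      rw [e5]
      have : (0 : ℝ) < 2 ^ n * 2 ^ m := by positivity
      exact mul_le_mul_of_nonneg_left (pow_le_pow_left₀ this.le (by linarith) j) (by positivity)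
    have hY1 := hY0 j
    rw [e1]
    calc _ ≤ C * ((2 * 2 ^ j) ^ n * (4 * 2 ^ j) ^ m) * Y j * Y j ^ ((1 : ℝ) / d) := by gcongr
      _ ≤ C * ((2 ^ n * 4 ^ m) * (2 * (2 ^ n * 2 ^ m)) ^ j) * Y j * Y j ^ ((1 : ℝ) / d) := by
        gcongr
      _ = _ := by ring
  by_contra! hcon
  have hwc : ContinuousAt w 0 :=
    hw.contDiffOn.continuousOn.continuousAt (hw.isOpen.mem_nhds (hΩ (by simp)))
  set η := (w 0 - 1) / 2 with hη
  have hη0 : 0 < η := by simp only [hη]; linarith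
  have hev : ∀ᶠ x in 𝓝 (0 : Eu d), 1 + η < w x :=
    hwc.eventually (lt_mem_nhds (by simp only [hη]; linarith))
  obtain ⟨ε, hε, hεw⟩ := Metric.eventually_nhds_iff_ball.1 hev
  set ρ := min (ε / 2) (1 / 2) with hρ
  have hρ0 : 0 < ρ := by positivity
  have hlow : ∀ j, η ^ (p + 1) * volume.real (closedBall (0 : Eu d) ρ) ≤ Y j := by
    intro j
    have h0 := ht0 j
    have h1 := ht1 j
    have hsub : closedBall (0 : Eu d) ρ ⊆ closedBall 0 ((1 + t j) / 2) :=
      closedBall_subset_closedBall ((min_le_right _ _).trans (by linarith))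
    have hi : IntegrableOn (fun x => (max (w x - (1 - t j)) 0) ^ (p + 1))
        (closedBall (0 : Eu d) ((1 + t j) / 2)) :=
      ((((hw.contDiffOn.continuousOn.mono hΩ).mono
        (closedBall_subset_closedBall (by linarith))).sub continuousOn_const).sup
          continuousOn_const |>.rpow_const fun _ _ => Or.inr (by linarith)).integrableOn_compact
        (isCompact_closedBall _ _)
    have e1 : ∫ x in closedBall (0 : Eu d) ρ, η ^ (p + 1) =
        η ^ (p + 1) * volume.real (closedBall (0 : Eu d) ρ) := by
      rw [setIntegral_const, smul_eq_mul, mul_comm]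
    rw [← e1]
    refine le_trans ?_ (setIntegral_mono_set hi (Eventually.of_forall fun x => by
      change (0 : ℝ) ≤ (max (w x - (1 - t j)) 0) ^ (p + 1); positivity)
      (Eventually.of_forall hsub))
    refine setIntegral_mono_on (integrableOn_const (isCompact_closedBall _ _).measure_lt_top.ne)
      (hi.mono_set hsub) isClosed_closedBall.measurableSet fun x hx => ?_
    refine Real.rpow_le_rpow hη0.le (le_max_of_le_left ?_) (by linarith)
    have := hεw x (closedBall_subset_ball ((min_le_left _ _).trans_lt (by linarith)) hx)
    linarith
  have hpos : 0 < η ^ (p + 1) * volume.real (closedBall (0 : Eu d) ρ) :=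
    mul_pos (by positivity) (ENNReal.toReal_pos (measure_closedBall_pos _ _ hρ0).ne'
      (isCompact_closedBall _ _).measure_lt_top.ne)
  have := ge_of_tendsto' hlim hlow
  linarith

/-! ### A Poincaré inequality -/

lemma lintegral_comp_add_smul_le {G : Eu d → ℝ≥0∞} (hG : Measurable G) {t : ℝ} (ht : 1 / 2 ≤ t)
    (a : Eu d) : ∫⁻ x, G (a + t • x) ≤ 2 ^ d * ∫⁻ x, G x := by
  have ht0 : 0 < t := by linarith
  have h1 : ∫⁻ x, G (a + t • x) = ∫⁻ y, G (a + y) ∂(Measure.map (fun x : Eu d => t • x) volume) :=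
    (lintegral_map (hG.comp (measurable_const_add a)) (measurable_const_smul t)).symm
  rw [h1, Measure.map_addHaar_smul _ ht0.ne', lintegral_smul_measure, smul_eq_mul,
    lintegral_add_left_eq_self]
  gcongr
  have h2 : (2 : ℝ≥0∞) ^ d = ENNReal.ofReal (2 ^ d) := by
    rw [ENNReal.ofReal_pow (by norm_num)]; simp
  rw [h2]
  refine ENNReal.ofReal_le_ofReal ?_
  rw [finrank_euclideanSpace_fin, abs_of_pos (by positivity), ← inv_pow]
  refine pow_le_pow_left₀ (by positivity) ?_ d
  rw [inv_le_comm₀ ht0 (by norm_num)]; linarith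

lemma enorm_sub_le_lintegral_gradient {Ω B : Set (Eu d)} (hΩ : IsOpen Ω) {f : Eu d → ℝ}
    (hf : ContDiffOn ℝ 1 f Ω) (hB : Convex ℝ B) (hBΩ : B ⊆ Ω) {x z : Eu d} (hx : x ∈ B)
    (hz : z ∈ B) (hxz : ‖x - z‖ ≤ 2) :
    ‖f x - f z‖ₑ ≤
      ∫⁻ t in Ioc (0 : ℝ) 1, 2 * B.indicator (fun y => ‖gradient f y‖ₑ) (z + t • (x - z)) := by
  have hmem : ∀ t ∈ Icc (0 : ℝ) 1, z + t • (x - z) ∈ B := fun t ht =>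
    hB.add_smul_sub_mem hz hx ht
  have hder : ∀ t ∈ uIcc (0 : ℝ) 1, HasDerivAt (fun s : ℝ => f (z + s • (x - z)))
      ⟪gradient f (z + t • (x - z)), x - z⟫ t := by
    intro t ht
    rw [uIcc_of_le zero_le_one] at ht
    have h1 := (hf.hasGradientAt' hΩ (hBΩ (hmem t ht))).hasFDerivAt
    have h2 : HasDerivAt (fun s : ℝ => z + s • (x - z)) (x - z) t := by
      simpa using ((hasDerivAt_id t).smul_const (x - z)).const_add z
    have h3 := h1.comp_hasDerivAt t h2
    rw [InnerProductSpace.toDual_apply_apply] at h3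
    exact h3
  have hcont : ContinuousOn (fun t : ℝ => ⟪gradient f (z + t • (x - z)), x - z⟫) (uIcc 0 1) := by
    rw [uIcc_of_le zero_le_one]
    refine ContinuousOn.inner ?_ continuousOn_const
    exact (hf.continuousOn_gradient hΩ).comp (by fun_prop) fun t ht => hBΩ (hmem t ht)
  have h := intervalIntegral.integral_eq_sub_of_hasDerivAt hder hcont.intervalIntegrable
  simp only [one_smul, zero_smul, add_zero, add_sub_cancel] at h
  rw [← h, intervalIntegral.integral_of_le zero_le_one]
  refine (enorm_integral_le_lintegral_enorm _).trans ?_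
  refine setLIntegral_mono' measurableSet_Ioc fun t ht => ?_
  rw [indicator_of_mem (hmem t ⟨ht.1.le, ht.2⟩)]
  have h3 : ‖⟪gradient f (z + t • (x - z)), x - z⟫‖ ≤ 2 * ‖gradient f (z + t • (x - z))‖ := by
    refine (norm_inner_le_norm _ _).trans ?_
    rw [mul_comm]; gcongr
  have h4 := ENNReal.ofReal_le_ofReal h3
  rw [ENNReal.ofReal_mul (by norm_num), ofReal_norm, ofReal_norm] at h4
  simpa using h4

/-- Poincaré inequality on balls for functions vanishing on a set of positive measure. -/
lemma exists_poincare_const (d : ℕ) : ∃ C : ℝ, 0 < C ∧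
    ∀ (Ω Z : Set (Eu d)) (f : Eu d → ℝ) (r : ℝ),
    IsOpen Ω → ContDiffOn ℝ 1 f Ω → r ≤ 1 → closedBall 0 r ⊆ Ω → Z ⊆ closedBall 0 r →
    MeasurableSet Z → (∀ z ∈ Z, f z = 0) →
    volume.real Z * ∫ x in closedBall 0 r, |f x| ≤
      C * ∫ x in closedBall 0 r, ‖gradient f x‖ := by
  refine ⟨2 * 2 ^ d * volume.real (closedBall (0 : Eu d) 1), ?_, ?_⟩
  · have : 0 < volume.real (closedBall (0 : Eu d) 1) :=
      ENNReal.toReal_pos (measure_closedBall_pos _ _ one_pos).ne'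
        (isCompact_closedBall _ _).measure_lt_top.ne
    positivity
  intro Ω Z f r hΩ hf hr hBΩ hZB hZm hZ
  set B := closedBall (0 : Eu d) r with hB
  have hBc : IsCompact B := isCompact_closedBall 0 r
  have hBm : MeasurableSet B := isClosed_closedBall.measurableSet
  set G : Eu d → ℝ≥0∞ := B.indicator fun y => ‖gradient f y‖ₑ with hGd
  have hgc : ContinuousOn (gradient f) B := (hf.continuousOn_gradient hΩ).mono hBΩ
  have hfc : ContinuousOn f B := hf.continuousOn.mono hBΩ
  have hG : Measurable G := by
    classical
    rw [hGd, ← piecewise_eq_indicator]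
    exact hgc.enorm.measurable_piecewise continuousOn_const hBm
  have hGB : ∫⁻ x, G x = ∫⁻ x in B, ‖gradient f x‖ₑ := lintegral_indicator hBm _
  set μ := volume.restrict B with hμ
  have hμB : μ univ ≤ volume (closedBall (0 : Eu d) 1) := by
    rw [hμ, Measure.restrict_apply_univ]
    exact measure_mono (closedBall_subset_closedBall hr)
  have : IsFiniteMeasure μ := ⟨hμB.trans_lt (isCompact_closedBall _ _).measure_lt_top⟩
  have hmeas : Measurable fun q : (Eu d × Eu d) × ℝ =>
      2 * G (q.1.1 + q.2 • (q.1.2 - q.1.1)) := by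
    refine (hG.comp ?_).const_mul 2
    fun_prop
  set K := ∫⁻ x, G x with hK
  have hslice : ∀ t ∈ Ioc (0 : ℝ) 1,
      ∫⁻ q, 2 * G (q.1 + t • (q.2 - q.1)) ∂(μ.prod μ) ≤
        2 * (2 ^ d * K) * volume (closedBall (0 : Eu d) 1) := by
    intro t ht
    have hm : Measurable fun q : Eu d × Eu d => G (q.1 + t • (q.2 - q.1)) :=
      hG.comp (by fun_prop)
    rw [lintegral_const_mul _ hm, mul_assoc]
    gcongr
    have hbound : ∀ J : Eu d → ℝ≥0∞, (∀ z, J z ≤ 2 ^ d * K) →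
        ∫⁻ z, J z ∂μ ≤ 2 ^ d * K * volume (closedBall (0 : Eu d) 1) := by
      intro J hJ
      refine (lintegral_mono hJ).trans ?_
      rw [lintegral_const]
      gcongr
    rcases le_total (1 / 2) t with h | h
    · rw [lintegral_prod _ hm.aemeasurable]
      refine hbound _ fun z => ?_
      refine (setLIntegral_le_lintegral _ _).trans ?_
      refine le_trans (le_of_eq ?_) (lintegral_comp_add_smul_le hG h ((1 - t) • z))
      congr 1; ext x; congr 1; module
    · rw [lintegral_prod_symm _ hm.aemeasurable]
      refine hbound _ fun x => ?_
      refine (setLIntegral_le_lintegral _ _).trans ?_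
      refine le_trans (le_of_eq ?_)
        (lintegral_comp_add_smul_le hG (by linarith : 1 / 2 ≤ 1 - t) (t • x))
      congr 1; ext x; congr 1; module
  have hmain : volume Z * ∫⁻ x in B, ‖f x‖ₑ ≤
      2 * (2 ^ d * K) * volume (closedBall (0 : Eu d) 1) := by
    have h1 : volume Z * ∫⁻ x in B, ‖f x‖ₑ ≤ ∫⁻ z in Z, ∫⁻ x, ‖f x - f z‖ₑ ∂μ := by
      have : ∀ z ∈ Z, ∫⁻ x in B, ‖f x‖ₑ ≤ ∫⁻ x, ‖f x - f z‖ₑ ∂μ := by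
        intro z hz; rw [hZ z hz]; simp [hμ]
      rw [mul_comm, ← setLIntegral_const]
      exact setLIntegral_mono' hZm this
    have h2 : ∫⁻ z in Z, ∫⁻ x, ‖f x - f z‖ₑ ∂μ ≤ ∫⁻ z, ∫⁻ x, ‖f x - f z‖ₑ ∂μ ∂μ :=
      lintegral_mono_set hZB
    have h3 : ∫⁻ z, ∫⁻ x, ‖f x - f z‖ₑ ∂μ ∂μ ≤
        ∫⁻ z, ∫⁻ x, (∫⁻ t in Ioc (0 : ℝ) 1, 2 * G (z + t • (x - z))) ∂μ ∂μ := by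
      refine setLIntegral_mono' hBm fun z hz => setLIntegral_mono' hBm fun x hx => ?_
      refine enorm_sub_le_lintegral_gradient hΩ hf (convex_closedBall 0 r) hBΩ hx hz ?_
      rw [hB, mem_closedBall_zero_iff] at hx hz
      exact (norm_sub_le _ _).trans (by linarith)
    have h4 : ∫⁻ z, ∫⁻ x, (∫⁻ t in Ioc (0 : ℝ) 1, 2 * G (z + t • (x - z))) ∂μ ∂μ =
        ∫⁻ t in Ioc (0 : ℝ) 1, ∫⁻ q, 2 * G (q.1 + t • (q.2 - q.1)) ∂(μ.prod μ) := by
      rw [← lintegral_lintegral_swap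
        (f := fun (q : Eu d × Eu d) (t : ℝ) => 2 * G (q.1 + t • (q.2 - q.1))) hmeas.aemeasurable,
        lintegral_prod _ hmeas.lintegral_prod_right'.aemeasurable]
    refine h1.trans (h2.trans (h3.trans (h4.le.trans ?_)))
    refine (setLIntegral_mono' measurableSet_Ioc hslice).trans ?_
    simp
  have hfi : IntegrableOn f B := hfc.integrableOn_compact hBc
  have hgi : IntegrableOn (gradient f) B := hgc.integrableOn_compact hBc
  have e1 : ∫ x in B, |f x| = (∫⁻ x in B, ‖f x‖ₑ).toReal := by
    rw [← integral_norm_eq_lintegral_enorm hfi.aestronglyMeasurable]; rfl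
  have e2 : ∫ x in B, ‖gradient f x‖ = K.toReal := by
    rw [hGB, integral_norm_eq_lintegral_enorm hgi.aestronglyMeasurable]
  have hKf : K ≠ ∞ := by rw [hGB]; exact hgi.2.ne
  have hfin : 2 * (2 ^ d * K) * volume (closedBall (0 : Eu d) 1) ≠ ∞ :=
    ENNReal.mul_ne_top (ENNReal.mul_ne_top ENNReal.ofNat_ne_top
      (ENNReal.mul_ne_top (ENNReal.pow_ne_top ENNReal.ofNat_ne_top) hKf))
      (isCompact_closedBall _ _).measure_lt_top.ne
  have := ENNReal.toReal_mono hfin hmain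
  rw [e1, e2]
  simp only [ENNReal.toReal_mul, ENNReal.toReal_pow, ENNReal.toReal_ofNat] at this
  simp only [measureReal_def]
  linarith

/-! ### The logarithmic energy estimate -/

lemma exists_log_energy_const (d : ℕ) (hp : 1 < p) {Λ : ℝ} (hΛ : 0 ≤ Λ) :
    ∃ C : ℝ, 0 < C ∧ ∀ (Ω : Set (Eu d)) (u g : Eu d → ℝ),
      PSol p Ω u g → (∀ x ∈ Ω, 0 < u x) → closedBall 0 1 ⊆ Ω →
      (∀ x ∈ closedBall 0 1, |g x| ≤ Λ * u x ^ (p - 1)) →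
      ∫ x in closedBall 0 (3 / 4), (‖gradient u x‖ / u x) ^ p ≤ C := by
  obtain ⟨m, hm⟩ := exists_nat_ge p
  have hm1 : 1 ≤ m := by
    have : (1 : ℝ) < m := hp.trans_le hm
    exact_mod_cast this.le
  set ε : ℝ := min ((p - 1) / 2) 1 with hε
  have hε0 : 0 < ε := lt_min (by linarith) one_pos
  set A : ℝ := (m / ε * 4) ^ p with hA
  have hA0 : 0 ≤ A := by positivity
  set s : ℝ := (1 ^ 2 - (3 / 4) ^ 2) ^ 2 with hs
  have hs0 : 0 < s := by rw [hs]; norm_num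
  set β := volume.real (closedBall (0 : Eu d) 1) with hβ
  have hβ0 : 0 ≤ β := measureReal_nonneg
  refine ⟨(Λ + A + 1) * (β + 1) * ((p - 1) / 2)⁻¹ * (s ^ m)⁻¹, by
    have : 0 < (p - 1) / 2 := by linarith
    positivity, ?_⟩
  intro Ω u g hu hpos hBΩ hg
  set B := closedBall (0 : Eu d) 1 with hB
  have hBc : IsCompact B := isCompact_closedBall 0 1
  have hBm : MeasurableSet B := isClosed_closedBall.measurableSet
  set ζ : Eu d → ℝ := cutoff 1 with hζ
  have hζ0 : ∀ x, 0 ≤ ζ x := cutoff_nonneg 1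
  have hζ1 : ∀ x, ζ x ≤ 1 := fun x => (cutoff_le x).trans (by norm_num)
  have hζg : ∀ x, ‖gradient ζ x‖ ≤ 4 := fun x => (norm_gradient_cutoff_le zero_le_one x).trans
    (by norm_num)
  have hζs : ContDiff ℝ 1 ζ := contDiff_cutoff 1
  set a : Eu d → ℝ := fun x => ‖gradient u x‖ / u x with ha
  have ha0 : ∀ x ∈ B, 0 ≤ a x := fun x hx => div_nonneg (norm_nonneg _) (hpos x (hBΩ hx)).le
  have huc : ContinuousOn u B := hu.contDiffOn.continuousOn.mono hBΩ
  have hac : ContinuousOn a B :=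
    ((hu.contDiffOn.continuousOn_gradient hu.isOpen).mono hBΩ).norm.div huc
      fun x hx => (hpos x (hBΩ hx)).ne'
  have hapc : ContinuousOn (fun x => a x ^ p) B := hac.rpow_const fun _ _ => Or.inr (by linarith)
  have hζc : ContinuousOn ζ B := hζs.continuous.continuousOn
  have hζm : ∀ x, HasGradientAt (fun y => ζ y ^ m) ((m * ζ x ^ (m - 1)) • gradient ζ x) x :=
    fun x => (hζs.hasGradientAt' x).fcomp (hasDerivAt_pow m (ζ x))
  have hup : ∀ x ∈ Ω, HasGradientAt (fun y => u y ^ (1 - p))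
      (((1 - p) * u x ^ (1 - p - 1)) • gradient u x) x := fun x hx =>
    (hu.hasGradientAt hx).fcomp (Real.hasDerivAt_rpow_const (Or.inl (hpos x hx).ne'))
  have htest : ContDiffOn ℝ 1 (fun y => ζ y ^ m * u y ^ (1 - p)) Ω :=
    (hζs.pow m).contDiffOn.mul (hu.contDiffOn.rpow_const_of_ne fun x hx => (hpos x hx).ne')
  have htest0 : ∀ x ∈ Ω, x ∉ B → ζ x ^ m * u x ^ (1 - p) = 0 := by
    intro x _ hx
    rw [hζ, cutoff_eq_zero zero_le_one hx, zero_pow (by omega), zero_mul]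
  set F := Ω.indicator fun y => ζ y ^ m * u y ^ (1 - p) with hF
  have hF1 : ContDiff ℝ 1 F := contDiff_indicator hu.isOpen hBc hBΩ htest htest0
  have hF2 : HasCompactSupport F := hasCompactSupport_indicator hBc htest0
  have hF3 : tsupport F ⊆ B := tsupport_indicator_subset hBc htest0
  have hEi : IntegrableOn (fun x => ζ x ^ m * a x ^ p) B :=
    ((hζc.pow m).mul hapc).integrableOn_compact hBc
  have hci : ∀ c : ℝ, IntegrableOn (fun _ : Eu d => c) B := fun c =>
    integrableOn_const hBc.measure_lt_top.ne
  have heq := hu.eq F hF1 hF2 (hF3.trans hBΩ)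
  rw [← setIntegral_eq_integral_of_forall_compl_eq_zero (s := B)
    (fun x hx => by rw [gradient_eq_zero_of_notMem fun h => hx (hF3 h), inner_zero_right]),
    ← setIntegral_eq_integral_of_forall_compl_eq_zero (s := B)
    (f := fun x => g x * F x) (fun x hx => by
      rw [image_eq_zero_of_notMem_tsupport fun h => hx (hF3 h), mul_zero])] at heq
  have hlow : ∫ x in B, ((p - 1) / 2 * (ζ x ^ m * a x ^ p) - A) ≤
      ∫ x in B, -⟪flux p (gradient u x), gradient F x⟫ := by
    refine setIntegral_mono_on ((hEi.const_mul _).sub (hci A))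
      (hu.integrable_flux hp hF1 hF2 (hF3.trans hBΩ)).integrableOn.neg hBm fun x hx => ?_
    have hux := hpos x (hBΩ hx)
    have hFg : gradient F x = (ζ x ^ m * ((1 - p) * u x ^ (1 - p - 1))) • gradient u x +
        (u x ^ (1 - p) * (m * ζ x ^ (m - 1))) • gradient ζ x := by
      have := (((hζm x).fmul (hup x (hBΩ hx))).indicator hu.isOpen (hBΩ hx)).gradient
      rw [this, smul_smul, smul_smul]
    rw [hFg, inner_add_right, real_inner_smul_right, real_inner_smul_right, inner_flux_self hp]
    have e1 : u x ^ (1 - p - 1) * ‖gradient u x‖ ^ p = a x ^ p := by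
      rw [ha, Real.div_rpow (norm_nonneg _) hux.le, show 1 - p - 1 = -p by ring,
        Real.rpow_neg hux.le]
      field_simp
    have e2 : u x ^ (1 - p) * ‖gradient u x‖ ^ (p - 1) = a x ^ (p - 1) := by
      rw [ha, Real.div_rpow (norm_nonneg _) hux.le, show 1 - p = -(p - 1) by ring,
        Real.rpow_neg hux.le]
      field_simp
    have h1 := young_cutoff hp hm (hζ0 x) (hζ1 x) (ha0 x hx) zero_le_four hε0 (min_le_right _ _)
    have h2 : ⟪flux p (gradient u x), gradient ζ x⟫ ≤ ‖gradient u x‖ ^ (p - 1) * 4 := by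
      refine (le_of_abs_le (abs_inner_flux_le hp _ _)).trans ?_
      have := hζg x
      gcongr
    have h3 : 0 ≤ u x ^ (1 - p) * (m * ζ x ^ (m - 1)) := by
      have := hζ0 x; positivity
    have h4 := mul_le_mul_of_nonneg_left h2 h3
    have h5 : u x ^ (1 - p) * (m * ζ x ^ (m - 1)) * (‖gradient u x‖ ^ (p - 1) * 4) =
        m * ζ x ^ (m - 1) * a x ^ (p - 1) * 4 := by rw [← e2]; ring
    have h6 : ζ x ^ m * ((1 - p) * u x ^ (1 - p - 1)) * ‖gradient u x‖ ^ p =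
        (1 - p) * (ζ x ^ m * a x ^ p) := by rw [← e1]; ring
    have h7 : ε * (ζ x ^ m * a x ^ p) ≤ (p - 1) / 2 * (ζ x ^ m * a x ^ p) := by
      have := hζ0 x; have := ha0 x hx
      gcongr
      exact min_le_left _ _
    rw [h6]
    linarith
  have hup : ∫ x in B, -(g x * F x) ≤ ∫ x in B, Λ := by
    refine setIntegral_mono_on
      (hu.integrable_rhs hF1.continuous hF2 (hF3.trans hBΩ)).integrableOn.neg (hci Λ) hBm
      fun x hx => ?_
    have hux := hpos x (hBΩ hx)
    have e1 : F x = ζ x ^ m * u x ^ (1 - p) := indicator_of_mem (hBΩ hx) _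
    have hz1 : ζ x ^ m ≤ 1 := pow_le_one₀ (hζ0 x) (hζ1 x)
    have hz0 : 0 ≤ ζ x ^ m := pow_nonneg (hζ0 x) _
    have e2 : u x ^ (p - 1) * u x ^ (1 - p) = 1 := by
      rw [← Real.rpow_add hux]; simp
    calc -(g x * F x) = -g x * (ζ x ^ m * u x ^ (1 - p)) := by rw [e1]; ring
      _ ≤ (Λ * u x ^ (p - 1)) * (ζ x ^ m * u x ^ (1 - p)) := by
        gcongr
        exact (neg_le_abs _).trans (hg x hx)
      _ = Λ * ζ x ^ m * (u x ^ (p - 1) * u x ^ (1 - p)) := by ring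
      _ ≤ Λ := by rw [e2, mul_one]; exact mul_le_of_le_one_right hΛ hz1
  rw [integral_neg] at hlow hup
  rw [heq] at hlow
  rw [integral_sub (hEi.const_mul _) (hci A), integral_const_mul, setIntegral_const,
    smul_eq_mul, ← hβ] at hlow
  rw [setIntegral_const, smul_eq_mul, ← hβ] at hup
  have hsub : closedBall (0 : Eu d) (3 / 4) ⊆ B := closedBall_subset_closedBall (by norm_num)
  have hin : s ^ m * ∫ x in closedBall 0 (3 / 4), a x ^ p ≤ ∫ x in B, ζ x ^ m * a x ^ p := by
    rw [← integral_const_mul]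
    refine le_trans ?_ (setIntegral_mono_set hEi ((ae_restrict_iff' hBm).2
      (Eventually.of_forall fun x hx => ?_)) (Eventually.of_forall hsub))
    · refine setIntegral_mono_on (((hapc.integrableOn_compact hBc).mono_set hsub).const_mul _)
        (hEi.mono_set hsub) isClosed_closedBall.measurableSet fun x hx => ?_
      have := le_cutoff (by norm_num) (by norm_num : (3 / 4 : ℝ) ≤ 1) hx
      have := ha0 x (hsub hx)
      gcongr
    · have := ha0 x hx
      have := hζ0 x
      change 0 ≤ ζ x ^ m * a x ^ p
      positivity
  have hp2 : 0 < (p - 1) / 2 := by linarith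
  rw [← div_eq_mul_inv, le_div_iff₀ (by positivity), ← div_eq_mul_inv, le_div_iff₀ hp2]
  have h1 := mul_le_mul_of_nonneg_left hin hp2.le
  have h2 : (Λ + A + 1) * (β + 1) = β * Λ + β * A + β + Λ + A + 1 := by ring
  linarith

/-! ### From measure estimates to pointwise lower bounds -/

lemma PSol.measurableSet_sublevel {Ω B : Set (Eu d)} {u g : Eu d → ℝ} (hu : PSol p Ω u g)
    (hB : IsClosed B) (hBΩ : B ⊆ Ω) (a : ℝ) : MeasurableSet (B ∩ {x | u x < a}) := by
  have h1 : B ∩ {x | u x < a} = B ∩ (Ω ∩ u ⁻¹' Iio a) := by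
    ext x; constructor
    · rintro ⟨h1, h2⟩; exact ⟨h1, hBΩ h1, h2⟩
    · rintro ⟨h1, _, h2⟩; exact ⟨h1, h2⟩
  rw [h1]
  exact hB.measurableSet.inter
    (hu.contDiffOn.continuousOn.isOpen_inter_preimage hu.isOpen isOpen_Iio).measurableSet

lemma exists_sublevel_measure_const (d : ℕ) (hp : 1 < p) {Λ : ℝ} (hΛ : 0 ≤ Λ) :
    ∃ K : ℝ, 0 < K ∧ ∀ (Ω : Set (Eu d)) (u g : Eu d → ℝ) (N : ℝ),
      PSol p Ω u g → (∀ x ∈ Ω, 0 < u x) → closedBall 0 1 ⊆ Ω →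
      (∀ x ∈ closedBall 0 1, |g x| ≤ Λ * u x ^ (p - 1)) → 1 < N →
      volume.real (closedBall 0 (1 / 4) ∩ {x | 1 ≤ u x}) *
        ((N - 1) * volume.real (closedBall 0 (3 / 4) ∩ {x | u x < Real.exp (-N)})) ≤ K := by
  obtain ⟨C₁, hC₁, hpoin⟩ := exists_poincare_const d
  obtain ⟨C₂, hC₂, hlog⟩ := exists_log_energy_const d hp hΛ
  set β := volume.real (closedBall (0 : Eu d) (3 / 4)) with hβ
  have hβ0 : 0 ≤ β := measureReal_nonneg
  refine ⟨C₁ * (β + C₂), by positivity, fun Ω u g N hu hpos hΩ hg hN => ?_⟩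
  set B := closedBall (0 : Eu d) (3 / 4) with hB
  have hBΩ : B ⊆ Ω := (closedBall_subset_closedBall (by norm_num)).trans hΩ
  have hBc : IsCompact B := isCompact_closedBall _ _
  have hBm : MeasurableSet B := isClosed_closedBall.measurableSet
  have huc : ContinuousOn u B := hu.contDiffOn.continuousOn.mono hBΩ
  set H : ℝ → ℝ := fun t => √(1 + (max t 0) ^ (2 : ℝ)) - 1 with hH
  have hone : ∀ t : ℝ, 0 < 1 + (max t 0) ^ (2 : ℝ) := fun t => by positivity
  have hHs : ContDiff ℝ 1 H :=
    ((contDiff_const.add (contDiff_max_rpow one_lt_two)).sqrt fun t => (hone t).ne').sub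
      contDiff_const
  have hH' : ∀ t, ∃ c : ℝ, HasDerivAt H c t ∧ |c| ≤ 1 := by
    intro t
    refine ⟨_, (((hasDerivAt_max_rpow one_lt_two t).const_add 1).sqrt (hone t).ne').sub_const 1, ?_⟩
    have h0 : 0 ≤ max t 0 := le_max_right _ _
    rw [show (2 : ℝ) - 1 = 1 by norm_num, Real.rpow_one, Real.rpow_two,
      abs_of_nonneg (by positivity), div_le_one (by positivity)]
    exact mul_le_mul_of_nonneg_left (Real.le_sqrt_of_sq_le (by linarith)) zero_le_two
  have hH0 : ∀ t, 0 ≤ H t := fun t => by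
    have : 1 ≤ √(1 + (max t 0) ^ (2 : ℝ)) := by
      rw [Real.one_le_sqrt]; simp
    simp only [hH]; linarith
  have hHN : ∀ t, N ≤ t → N - 1 ≤ H t := fun t ht => by
    have : t ≤ √(1 + (max t 0) ^ (2 : ℝ)) := by
      refine Real.le_sqrt_of_sq_le ?_
      rw [max_eq_left (by linarith), Real.rpow_two]; linarith
    simp only [hH]; linarith
  set f : Eu d → ℝ := fun x => H (-Real.log (u x)) with hf
  have hf1 : ContDiffOn ℝ 1 f Ω :=
    hHs.comp_contDiffOn (hu.contDiffOn.log fun x hx => (hpos x hx).ne').neg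
  have hfg : ∀ x ∈ B, ‖gradient f x‖ ≤ ‖gradient u x‖ / u x := by
    intro x hx
    have hux := hpos x (hBΩ hx)
    obtain ⟨c, hc, hc1⟩ := hH' (-Real.log (u x))
    have h1 := ((hu.hasGradientAt (hBΩ hx)).fcomp (Real.hasDerivAt_log hux.ne')).fneg
    have h2 := (HasGradientAt.fcomp (f := fun y => -Real.log (u y)) hc h1).gradient
    rw [h2, norm_smul, norm_neg, norm_smul, Real.norm_eq_abs, norm_inv,
      Real.norm_of_nonneg hux.le, div_eq_inv_mul]
    exact mul_le_of_le_one_left (by positivity) hc1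
  have hZm : MeasurableSet (closedBall 0 (1 / 4) ∩ {x | 1 ≤ u x}) :=
    ((huc.mono (closedBall_subset_closedBall (by norm_num))).preimage_isClosed_of_isClosed
      isClosed_closedBall isClosed_Ici).measurableSet
  have hSm := hu.measurableSet_sublevel isClosed_closedBall hBΩ (Real.exp (-N))
  have key := hpoin Ω (closedBall 0 (1 / 4) ∩ {x | 1 ≤ u x}) f (3 / 4) hu.isOpen hf1
    (by norm_num) hBΩ (inter_subset_left.trans (closedBall_subset_closedBall (by norm_num)))
    hZm (fun z hz => by
      have : max (-Real.log (u z)) 0 = 0 := max_eq_right (by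
        have := Real.log_nonneg hz.2; linarith)
      simp [hf, hH, this])
  have hgc : ContinuousOn (fun x => ‖gradient f x‖) B :=
    ((hf1.continuousOn_gradient hu.isOpen).mono hBΩ).norm
  have hac : ContinuousOn (fun x => ‖gradient u x‖ / u x) B :=
    ((hu.contDiffOn.continuousOn_gradient hu.isOpen).mono hBΩ).norm.div huc
      fun x hx => (hpos x (hBΩ hx)).ne'
  have hap : IntegrableOn (fun x => (‖gradient u x‖ / u x) ^ p) B :=
    (hac.rpow_const fun _ _ => Or.inr (by linarith)).integrableOn_compact hBc
  have hci : IntegrableOn (fun _ : Eu d => (1 : ℝ)) B := integrableOn_const hBc.measure_lt_top.ne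
  have h1 : ∫ x in B, ‖gradient f x‖ ≤ β + C₂ := by
    have h2 : ∫ x in B, ‖gradient f x‖ ≤ ∫ x in B, (1 + (‖gradient u x‖ / u x) ^ p) := by
      refine setIntegral_mono_on (hgc.integrableOn_compact hBc) (hci.add hap) hBm fun x hx => ?_
      have := rpow_sub_one_mul_le_add hp zero_le_one
        (div_nonneg (norm_nonneg (gradient u x)) (hpos x (hBΩ hx)).le)
      rw [Real.one_rpow, Real.one_rpow, one_mul] at this
      exact (hfg x hx).trans this
    rw [integral_add hci hap, setIntegral_const, smul_eq_mul, mul_one] at h2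
    linarith [hlog Ω u g hu hpos hΩ hg]
  have h2 : (N - 1) * volume.real (B ∩ {x | u x < Real.exp (-N)}) ≤ ∫ x in B, |f x| := by
    have hfi : IntegrableOn (fun x => |f x|) B :=
      (hf1.continuousOn.mono hBΩ).abs.integrableOn_compact hBc
    rw [mul_comm, ← smul_eq_mul, ← setIntegral_const]
    have hsub : B ∩ {x | u x < Real.exp (-N)} ⊆ B := inter_subset_left
    refine le_trans ?_ (setIntegral_mono_set hfi (Eventually.of_forall fun x => abs_nonneg _)
      (Eventually.of_forall hsub))
    refine setIntegral_mono_on (integrableOn_const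
      (ne_top_of_le_ne_top hBc.measure_lt_top.ne (measure_mono inter_subset_left)))
      (hfi.mono_set inter_subset_left) hSm fun x hx => ?_
    refine (hHN _ ?_).trans (le_abs_self _)
    have := (Real.log_lt_iff_lt_exp (hpos x (hBΩ hx.1))).2 hx.2
    linarith
  calc _ ≤ _ := mul_le_mul_of_nonneg_left h2 measureReal_nonneg
    _ ≤ _ := key
    _ ≤ _ := by gcongr

lemma exists_lower_bound (hd : 2 ≤ d) (hp : 1 < p) {Λ θ : ℝ} (hΛ : 0 ≤ Λ) (hθ : 0 < θ) :
    ∃ c : ℝ, 0 < c ∧ ∀ (Ω : Set (Eu d)) (u g : Eu d → ℝ),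
      PSol p Ω u g → (∀ x ∈ Ω, 0 < u x) → closedBall 0 1 ⊆ Ω →
      (∀ x ∈ closedBall 0 1, |g x| ≤ Λ * u x ^ (p - 1)) →
      θ ≤ volume.real (closedBall 0 (1 / 4) ∩ {x | 1 ≤ u x}) →
      ∀ y ∈ closedBall (0 : Eu d) (1 / 2), c ≤ u y := by
  obtain ⟨K, hK, hmeas⟩ := exists_sublevel_measure_const d hp hΛ
  obtain ⟨δ, hδ, hdg⟩ := exists_deGiorgi_bound hd hp (Λ := Λ * 2 ^ (p - 1)) (by positivity)
  set N : ℝ := 1 + K * (2 ^ (p + 1) * 4 ^ d) / (θ * δ) with hN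
  have hN1 : 0 < N - 1 := by simp only [hN, add_sub_cancel_left]; positivity
  refine ⟨Real.exp (-N) / 2, by positivity, fun Ω u g hu hpos hΩ hg hvol y hy => ?_⟩
  set S := closedBall (0 : Eu d) (3 / 4) ∩ {x | u x < Real.exp (-N)} with hS
  have hSf : volume S ≠ ∞ := ne_top_of_le_ne_top (isCompact_closedBall _ _).measure_lt_top.ne
    (measure_mono inter_subset_left)
  have hm := hmeas Ω u g N hu hpos hΩ hg (by linarith)
  have hSδ : 2 ^ (p + 1) * (4 ^ d * volume.real S) ≤ δ := by
    have h1 : θ * ((N - 1) * volume.real S) ≤ K :=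
      (mul_le_mul_of_nonneg_right hvol (by positivity)).trans hm
    have h2 : θ * (N - 1) * δ = K * (2 ^ (p + 1) * 4 ^ d) := by
      simp only [hN, add_sub_cancel_left]; field_simp
    have h3 : 0 < θ * (N - 1) := by positivity
    refine le_of_mul_le_mul_left ?_ h3
    rw [h2]
    have h4 : (0 : ℝ) ≤ 2 ^ (p + 1) * 4 ^ d := by positivity
    have := mul_le_mul_of_nonneg_right h1 h4
    linarith
  have hq : (0 : ℝ) < 1 / 4 := by norm_num
  have hmap : ∀ x ∈ closedBall (0 : Eu d) 1, y + (1 / 4 : ℝ) • x ∈ closedBall (0 : Eu d) (3 / 4) := by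
    intro x hx
    rw [mem_closedBall_zero_iff] at hx hy ⊢
    refine (norm_add_le _ _).trans ?_
    rw [norm_smul, Real.norm_of_nonneg hq.le]; linarith
  have hsub : closedBall (0 : Eu d) (3 / 4) ⊆ closedBall 0 1 :=
    closedBall_subset_closedBall (by norm_num)
  have hw := (((hu.rescale hp y hq).const_mul hp (c := 2 * Real.exp N) (by positivity)).const_sub
    hp 2)
  have hexp : Real.exp N * Real.exp (-N) = 1 := by rw [← Real.exp_add]; simp
  have := hdg _ _ _ hw (fun x hx => hΩ (hsub (hmap x hx))) (fun x hx hwx => ?_) ?_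
  · simp only [smul_zero, add_zero] at this
    have h0 := Real.exp_pos (-N)
    nlinarith
  · set z := y + (1 / 4 : ℝ) • x
    have hz := hmap x hx
    have huz := hpos z (hΩ (hsub hz))
    have h1 : Real.exp N * u z ≤ 1 := by linarith
    have h2 : (1 / 4 : ℝ) ^ p ≤ 1 := Real.rpow_le_one hq.le (by norm_num) (by linarith)
    have h3 : (Real.exp N) ^ (p - 1) * u z ^ (p - 1) ≤ 1 := by
      rw [← Real.mul_rpow (by positivity) huz.le]
      exact Real.rpow_le_one (by positivity) h1 (by linarith)
    have h4 : -g z ≤ Λ * u z ^ (p - 1) := (neg_le_abs _).trans (hg z (hsub hz))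
    calc -((2 * Real.exp N) ^ (p - 1) * ((1 / 4) ^ p * g z))
        = (2 * Real.exp N) ^ (p - 1) * ((1 / 4) ^ p * -g z) := by ring
      _ ≤ (2 * Real.exp N) ^ (p - 1) * ((1 / 4) ^ p * (Λ * u z ^ (p - 1))) := by gcongr
      _ = (1 / 4) ^ p * (Λ * 2 ^ (p - 1) * ((Real.exp N) ^ (p - 1) * u z ^ (p - 1))) := by
        rw [Real.mul_rpow (by norm_num) (by positivity)]; ring
      _ ≤ 1 * (Λ * 2 ^ (p - 1) * 1) := by gcongr
      _ = _ := by ring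
  · set T : Set (Eu d) := (fun x => (1 / 4 : ℝ) • x) ⁻¹' ((fun x => y + x) ⁻¹' S) with hT
    have hTv : volume.real T = 4 ^ d * volume.real S := by
      rw [measureReal_def, hT, Measure.addHaar_preimage_smul _ hq.ne', measure_preimage_add,
        ENNReal.toReal_mul, finrank_euclideanSpace_fin, ENNReal.toReal_ofReal (abs_nonneg _),
        abs_of_pos (by positivity), measureReal_def]
      simp
    have hTf : volume T ≠ ∞ := by
      rw [hT, Measure.addHaar_preimage_smul _ hq.ne', measure_preimage_add]
      exact ENNReal.mul_ne_top ENNReal.ofReal_ne_top hSf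
    have hwc := hw.contDiffOn.continuousOn.mono
      (fun x hx => hΩ (hsub (hmap x hx)) :
        closedBall (0 : Eu d) 1 ⊆ (fun x => y + (1 / 4 : ℝ) • x) ⁻¹' Ω)
    have hwi : IntegrableOn (fun x => (max (2 - 2 * Real.exp N * u (y + (1 / 4 : ℝ) • x)) 0) ^ (p + 1))
        (closedBall (0 : Eu d) 1) :=
      ((hwc.sup continuousOn_const).rpow_const
        fun _ _ => Or.inr (by linarith)).integrableOn_compact (isCompact_closedBall _ _)
    have hTm : MeasurableSet T :=
      ((hu.measurableSet_sublevel isClosed_closedBall (hsub.trans hΩ) _).preimage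
        (measurable_const_add y)).preimage (measurable_const_smul _)
    have hTi : Integrable (T.indicator fun _ => (2 : ℝ) ^ (p + 1)) :=
      (integrable_indicator_iff hTm).2 (integrableOn_const hTf)
    calc ∫ x in closedBall 0 1, (max (2 - 2 * Real.exp N * u (y + (1 / 4 : ℝ) • x)) 0) ^ (p + 1)
        ≤ ∫ x in closedBall 0 1, T.indicator (fun _ => (2 : ℝ) ^ (p + 1)) x := by
          refine setIntegral_mono_on hwi hTi.integrableOn isClosed_closedBall.measurableSet
            fun x hx => ?_
          have hux := hpos _ (hΩ (hsub (hmap x hx)))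
          by_cases hxT : x ∈ T
          · rw [indicator_of_mem hxT]
            refine Real.rpow_le_rpow (le_max_right _ _) (max_le ?_ zero_le_two) (by linarith)
            have := mul_pos (Real.exp_pos N) hux
            linarith
          · rw [indicator_of_notMem hxT, max_eq_right, Real.zero_rpow (by linarith)]
            have h1 : Real.exp (-N) ≤ u (y + (1 / 4 : ℝ) • x) := by
              by_contra! h
              exact hxT ⟨hmap x hx, h⟩
            have h2 := mul_le_mul_of_nonneg_left h1 (Real.exp_pos N).le
            linarith
      _ ≤ ∫ x, T.indicator (fun _ => (2 : ℝ) ^ (p + 1)) x :=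
          setIntegral_le_integral hTi (Eventually.of_forall fun x =>
            indicator_nonneg (fun _ _ => by positivity) x)
      _ = 2 ^ (p + 1) * (4 ^ d * volume.real S) := by
          rw [integral_indicator hTm, setIntegral_const, smul_eq_mul, hTv, mul_comm]
      _ ≤ δ := hSδ

/-! ### The Harnack inequality -/

lemma add_smul_mem_closedBall {z x : Eu d} {R s : ℝ} (hR : 0 ≤ R) (hx : x ∈ closedBall (0 : Eu d) s) :
    z + R • x ∈ closedBall z (R * s) := by
  rw [mem_closedBall_zero_iff] at hx
  rw [mem_closedBall, dist_eq_norm, add_sub_cancel_left, norm_smul, Real.norm_of_nonneg hR]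
  gcongr

lemma exists_lower_bound_rescaled (hd : 2 ≤ d) (hp : 1 < p) {θ : ℝ} (hθ : 0 < θ) :
    ∃ c : ℝ, 0 < c ∧ ∀ (Ω : Set (Eu d)) (u g : Eu d → ℝ) (z : Eu d) (R a : ℝ),
      PSol p Ω u g → (∀ x ∈ Ω, 0 < u x) → (∀ x ∈ Ω, |g x| ≤ u x ^ (p - 1)) →
      0 < R → R ≤ 6 → closedBall z R ⊆ Ω → 0 < a →
      θ ≤ volume.real (closedBall (0 : Eu d) (1 / 4) ∩ {x | a ≤ u (z + R • x)}) →
      ∀ y ∈ closedBall z (R / 2), c * a ≤ u y := by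
  obtain ⟨c, hc, h⟩ := exists_lower_bound hd hp (Λ := 6 ^ p) (by positivity) hθ
  refine ⟨c, hc, fun Ω u g z R a hu hpos hg hR hR6 hΩ ha hvol y hy => ?_⟩
  have hv := (hu.rescale hp z hR).const_mul hp (inv_nonneg.2 ha.le)
  have hmem : ∀ x ∈ closedBall (0 : Eu d) 1, z + R • x ∈ Ω := fun x hx =>
    hΩ (by simpa using add_smul_mem_closedBall (z := z) hR.le hx)
  have key := h _ _ _ hv (fun x hx => mul_pos (inv_pos.2 ha) (hpos _ hx)) hmem (fun x hx => ?_) ?_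
    (R⁻¹ • (y - z)) ?_
  · rw [smul_smul, mul_inv_cancel₀ hR.ne', one_smul, add_sub_cancel] at key
    rwa [← div_eq_inv_mul, le_div_iff₀ ha] at key
  · have hux := hpos _ (hmem x hx)
    rw [abs_mul, abs_mul, abs_of_nonneg (by positivity : 0 ≤ (a⁻¹) ^ (p - 1)),
      abs_of_nonneg (by positivity : 0 ≤ R ^ p), Real.mul_rpow (by positivity) hux.le]
    have h1 := hg _ (hmem x hx)
    have h2 : R ^ p ≤ 6 ^ p := Real.rpow_le_rpow hR.le hR6 (by linarith)
    calc (a⁻¹) ^ (p - 1) * (R ^ p * |g (z + R • x)|) ≤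
        (a⁻¹) ^ (p - 1) * (6 ^ p * u (z + R • x) ^ (p - 1)) := by gcongr
      _ = _ := by ring
  · convert hvol using 5 with x
    rw [← div_eq_inv_mul, one_le_div ha]
  · rw [mem_closedBall, dist_eq_norm] at hy
    rw [mem_closedBall_zero_iff, norm_smul, norm_inv, Real.norm_of_nonneg hR.le, inv_mul_le_iff₀ hR]
    linarith

lemma exists_doubling_exponent (hd : 2 ≤ d) (hp : 1 < p) :
    ∃ n : ℕ, ∀ (Ω : Set (Eu d)) (u g : Eu d → ℝ) (z : Eu d) (ρ a : ℝ),
      PSol p Ω u g → (∀ x ∈ Ω, 0 < u x) → (∀ x ∈ Ω, |g x| ≤ u x ^ (p - 1)) →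
      0 < ρ → 4 * ρ ≤ 6 → closedBall z (4 * ρ) ⊆ Ω → 0 < a → (∀ x ∈ closedBall z ρ, a ≤ u x) →
      ∀ y ∈ closedBall z (2 * ρ), a * (1 / 2) ^ n ≤ u y := by
  have hθ : 0 < volume.real (closedBall (0 : Eu d) (1 / 4)) :=
    ENNReal.toReal_pos (measure_closedBall_pos _ _ (by norm_num)).ne'
      (isCompact_closedBall _ _).measure_lt_top.ne
  obtain ⟨c, hc, h⟩ := exists_lower_bound_rescaled hd hp hθ
  obtain ⟨n, hn⟩ := exists_pow_lt_of_lt_one hc (by norm_num : (1 / 2 : ℝ) < 1)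
  refine ⟨n, fun Ω u g z ρ a hu hpos hg hρ hρ6 hΩ ha hle y hy => ?_⟩
  have := h Ω u g z (4 * ρ) a hu hpos hg (by positivity) hρ6 hΩ ha ?_ y
    (closedBall_subset_closedBall (by linarith) hy)
  · rw [mul_comm]
    exact (mul_le_mul_of_nonneg_right hn.le ha.le).trans this
  · refine le_of_eq ?_
    congr 1
    refine (inter_eq_self_of_subset_left fun x hx => hle _ ?_).symm
    exact closedBall_subset_closedBall (by linarith) (add_smul_mem_closedBall (by positivity) hx)

lemma exists_superlevel_measure (hd : 2 ≤ d) (hp : 1 < p) :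
    ∃ θ : ℝ, 0 < θ ∧ ∀ (Ω : Set (Eu d)) (u g : Eu d → ℝ) (z : Eu d) (R : ℝ),
      PSol p Ω u g → (∀ x ∈ Ω, 0 < u x) → (∀ x ∈ Ω, |g x| ≤ u x ^ (p - 1)) →
      0 < R → R ≤ 4 → closedBall z R ⊆ Ω → (∀ x ∈ closedBall z R, u x ≤ 2 * u z) →
      θ ≤ volume.real (closedBall (0 : Eu d) (1 / 4) ∩ {x | u z / 2 ≤ u (z + R • x)}) := by
  obtain ⟨δ, hδ, hdg⟩ := exists_deGiorgi_bound hd hp (Λ := 3 ^ (p - 1) * 2 ^ (p - 1))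
    (by positivity)
  refine ⟨δ / ((9 / 2) ^ (p + 1) * 4 ^ d), by positivity,
    fun Ω u g z R hu hpos hg hR hR4 hΩ hle => ?_⟩
  set S := closedBall (0 : Eu d) (1 / 4) ∩ {x | u z / 2 ≤ u (z + R • x)} with hS
  set T : Set (Eu d) := (fun x => (1 / 4 : ℝ) • x) ⁻¹' S with hT
  have hz : 0 < u z := hpos z (hΩ (mem_closedBall_self hR.le))
  have hR0 : 0 < R / 4 := by positivity
  have hSm : MeasurableSet S := by
    have hc : ContinuousOn (fun x => u (z + R • x)) (closedBall (0 : Eu d) (1 / 4)) := by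
      refine hu.contDiffOn.continuousOn.comp (by fun_prop) fun x hx => hΩ ?_
      exact closedBall_subset_closedBall (by linarith) (add_smul_mem_closedBall hR.le hx)
    exact (hc.preimage_isClosed_of_isClosed isClosed_closedBall isClosed_Ici).measurableSet
  have hSf : volume S ≠ ∞ := ne_top_of_le_ne_top (isCompact_closedBall _ _).measure_lt_top.ne
    (measure_mono inter_subset_left)
  have hTm : MeasurableSet T := hSm.preimage (measurable_const_smul _)
  have hTv : volume.real T = 4 ^ d * volume.real S := by
    rw [measureReal_def, hT, Measure.addHaar_preimage_smul _ (by norm_num),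
      ENNReal.toReal_mul, finrank_euclideanSpace_fin, ENNReal.toReal_ofReal (abs_nonneg _),
      abs_of_pos (by positivity), measureReal_def]
    simp
  have hTf : volume T ≠ ∞ := by
    rw [hT, Measure.addHaar_preimage_smul _ (by norm_num)]
    exact ENNReal.mul_ne_top ENNReal.ofReal_ne_top hSf
  have hTi : Integrable (T.indicator fun _ => (9 / 2 : ℝ) ^ (p + 1)) :=
    (integrable_indicator_iff hTm).2 (integrableOn_const hTf)
  have hmem : ∀ x ∈ closedBall (0 : Eu d) 1, z + (R / 4) • x ∈ closedBall z R := fun x hx =>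
    closedBall_subset_closedBall (by linarith) (add_smul_mem_closedBall hR0.le hx)
  by_contra! hlt
  rw [lt_div_iff₀ (by positivity)] at hlt
  have hw := (hu.rescale hp z hR0).const_mul_add hp (c := 3 / u z) (by positivity) (-(3 / 2))
  have hwc := hw.contDiffOn.continuousOn.mono (fun x hx => hΩ (hmem x hx) :
    closedBall (0 : Eu d) 1 ⊆ (fun x => z + (R / 4) • x) ⁻¹' Ω)
  have hwi : IntegrableOn (fun x => (max (3 / u z * u (z + (R / 4) • x) + -(3 / 2)) 0) ^ (p + 1))
      (closedBall (0 : Eu d) 1) :=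
    ((hwc.sup continuousOn_const).rpow_const
      fun _ _ => Or.inr (by linarith)).integrableOn_compact (isCompact_closedBall _ _)
  have := hdg _ _ _ hw (fun x hx => hΩ (hmem x hx)) (fun x hx _ => ?_) ?_
  · rw [smul_zero, add_zero, div_mul_cancel₀ _ hz.ne'] at this
    norm_num at this
  · set y := z + (R / 4) • x
    have huy := hpos y (hΩ (hmem x hx))
    have h1 : u y / u z ≤ 2 := by
      rw [div_le_iff₀ hz]; exact hle y (hmem x hx)
    have h2 : (R / 4) ^ p ≤ 1 := Real.rpow_le_one hR0.le (by linarith) (by linarith)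
    have h3 : (u y / u z) ^ (p - 1) ≤ 2 ^ (p - 1) :=
      Real.rpow_le_rpow (by positivity) h1 (by linarith)
    have h4 : g y ≤ u y ^ (p - 1) := (le_abs_self _).trans (hg y (hΩ (hmem x hx)))
    calc (3 / u z) ^ (p - 1) * ((R / 4) ^ p * g y)
        ≤ (3 / u z) ^ (p - 1) * ((R / 4) ^ p * u y ^ (p - 1)) := by gcongr
      _ = (R / 4) ^ p * (3 ^ (p - 1) * (u y / u z) ^ (p - 1)) := by
        rw [Real.div_rpow (by norm_num) hz.le, Real.div_rpow huy.le hz.le]; ring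
      _ ≤ 1 * (3 ^ (p - 1) * 2 ^ (p - 1)) := by gcongr
      _ = _ := one_mul _
  · calc ∫ x in closedBall 0 1, (max (3 / u z * u (z + (R / 4) • x) + -(3 / 2)) 0) ^ (p + 1)
        ≤ ∫ x in closedBall 0 1, T.indicator (fun _ => (9 / 2 : ℝ) ^ (p + 1)) x := by
          refine setIntegral_mono_on hwi hTi.integrableOn isClosed_closedBall.measurableSet
            fun x hx => ?_
          have huy := hpos _ (hΩ (hmem x hx))
          have h1 : u (z + (R / 4) • x) / u z ≤ 2 := by
            rw [div_le_iff₀ hz]; exact hle _ (hmem x hx)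
          have h2 : 3 / u z * u (z + (R / 4) • x) = 3 * (u (z + (R / 4) • x) / u z) := by ring
          by_cases hxT : x ∈ T
          · rw [indicator_of_mem hxT]
            refine Real.rpow_le_rpow (le_max_right _ _) (max_le ?_ (by norm_num)) (by linarith)
            linarith
          · rw [indicator_of_notMem hxT, max_eq_right, Real.zero_rpow (by linarith)]
            by_contra! h
            refine hxT ⟨?_, ?_⟩
            · rw [mem_closedBall_zero_iff] at hx ⊢
              rw [norm_smul, Real.norm_of_nonneg (by norm_num)]; linarith
            · have h3 : 1 / 2 ≤ u (z + (R / 4) • x) / u z := by linarith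
              rw [le_div_iff₀ hz] at h3
              have e : z + R • (1 / 4 : ℝ) • x = z + (R / 4) • x := by
                rw [smul_smul]; congr 2; ring
              change u z / 2 ≤ u (z + R • (1 / 4 : ℝ) • x)
              rw [e]; linarith
      _ ≤ ∫ x, T.indicator (fun _ => (9 / 2 : ℝ) ^ (p + 1)) x :=
          setIntegral_le_integral hTi (Eventually.of_forall fun x =>
            indicator_nonneg (fun _ _ => by positivity) x)
      _ = volume.real S * ((9 / 2) ^ (p + 1) * 4 ^ d) := by
          rw [integral_indicator hTm, setIntegral_const, smul_eq_mul, hTv]; ring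
      _ ≤ δ := hlt.le

/-- Harnack inequality at unit scale. -/
lemma exists_harnack_const (hd : 2 ≤ d) (hp : 1 < p) :
    ∃ C : ℝ, 1 ≤ C ∧ ∀ (Ω : Set (Eu d)) (u g : Eu d → ℝ),
      PSol p Ω u g → (∀ x ∈ Ω, 0 < u x) → (∀ x ∈ Ω, |g x| ≤ u x ^ (p - 1)) →
      closedBall 0 8 ⊆ Ω →
      ∀ x ∈ closedBall (0 : Eu d) (1 / 2), ∀ y ∈ closedBall (0 : Eu d) (1 / 2),
        u x ≤ C * u y := by
  obtain ⟨n, hdoub⟩ := exists_doubling_exponent hd hp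
  obtain ⟨θ, hθ, hsup⟩ := exists_superlevel_measure hd hp
  obtain ⟨c, hc, hlow⟩ := exists_lower_bound_rescaled hd hp hθ
  set N := n + 1 with hN
  set σ : ℝ := 1 / (2 * (N + 1)) with hσ
  have hσ0 : 0 < σ := by positivity
  have hσ1 : σ ≤ 1 / 2 := by
    rw [hσ, div_le_div_iff₀ (by positivity) (by norm_num)]
    have : (0 : ℝ) ≤ N := by positivity
    linarith
  have hσN : 1 / 2 ≤ (1 - σ) ^ N := by
    have h1 := one_add_mul_le_pow (by linarith : (-2 : ℝ) ≤ -σ) N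
    have h2 : (N : ℝ) * σ ≤ 1 / 2 := by
      rw [hσ, mul_one_div, div_le_div_iff₀ (by positivity) (by norm_num)]; linarith
    rw [← sub_eq_add_neg] at h1
    linarith
  set K : ℝ := c / 2 * (σ / 6) ^ N * (1 / 2) ^ N with hK
  have hK0 : 0 < K := by positivity
  refine ⟨max K⁻¹ 1, le_max_right _ _, fun Ω u g hu hpos hg hΩ x hx y hy => ?_⟩
  have hB1 : closedBall (0 : Eu d) 1 ⊆ Ω := (closedBall_subset_closedBall (by norm_num)).trans hΩ
  have hux := hpos x (hB1 (closedBall_subset_closedBall (by norm_num) hx))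
  have huy := hpos y (hB1 (closedBall_subset_closedBall (by norm_num) hy))
  obtain ⟨x₀, hx₀, hmax⟩ := (isCompact_closedBall (0 : Eu d) 1).exists_isMaxOn
    ⟨0, mem_closedBall_self zero_le_one⟩
    (f := fun z => (1 - ‖z‖) ^ N * u z)
    (((continuousOn_const.sub continuousOn_id.norm).pow N).mul
      (hu.contDiffOn.continuousOn.mono hB1))
  have hmax' : ∀ z ∈ closedBall (0 : Eu d) 1, (1 - ‖z‖) ^ N * u z ≤ (1 - ‖x₀‖) ^ N * u x₀ :=
    fun z hz => hmax hz
  set t := 1 - ‖x₀‖ with ht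
  have hx₀n : ‖x₀‖ ≤ 1 := mem_closedBall_zero_iff.1 hx₀
  have hu0 := hpos x₀ (hB1 hx₀)
  have htx : (1 / 2) ^ N * u x ≤ t ^ N * u x₀ := by
    refine le_trans ?_ (hmax' x (closedBall_subset_closedBall (by norm_num) hx))
    have : ‖x‖ ≤ 1 / 2 := mem_closedBall_zero_iff.1 hx
    gcongr
    linarith
  have ht0 : 0 < t := by
    rcases (sub_nonneg.2 hx₀n).eq_or_lt with h | h
    · have h1 : t = 0 := h.symm
      rw [h1, hN, zero_pow (by omega), zero_mul] at htx
      have : 0 < (1 / 2 : ℝ) ^ (n + 1) * u x := by positivity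
      linarith
    · exact h
  have ht1 : t ≤ 1 := by have := norm_nonneg x₀; linarith
  set R := σ * t with hR
  have hR0 : 0 < R := by positivity
  have hR1 : R ≤ 1 / 2 := by nlinarith
  have hball : ∀ s ≤ (7 : ℝ), closedBall x₀ s ⊆ Ω := fun s hs =>
    (closedBall_subset_closedBall' (by rw [dist_zero_right]; linarith)).trans hΩ
  have h2 : ∀ z ∈ closedBall x₀ R, u z ≤ 2 * u x₀ := by
    intro z hz
    have hz1 : ‖z‖ ≤ ‖x₀‖ + R := by
      have := norm_le_norm_add_norm_sub' z x₀
      rw [mem_closedBall, dist_eq_norm] at hz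
      linarith
    have hz2 : (1 - σ) * t ≤ 1 - ‖z‖ := by linarith
    have hz3 : 0 ≤ (1 - σ) * t := by nlinarith
    have hzm : z ∈ closedBall (0 : Eu d) 1 := by
      rw [mem_closedBall_zero_iff]; linarith
    have huz := hpos z (hB1 hzm)
    have h3 : ((1 - σ) * t) ^ N * u z ≤ t ^ N * u x₀ :=
      (mul_le_mul_of_nonneg_right (pow_le_pow_left₀ hz3 hz2 N) huz.le).trans (hmax' z hzm)
    rw [mul_pow, mul_comm ((1 - σ) ^ N), mul_assoc] at h3
    have h4 := le_of_mul_le_mul_left h3 (by positivity)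
    have h5 := mul_le_mul_of_nonneg_right hσN huz.le
    linarith
  have hstart := hlow Ω u g x₀ R (u x₀ / 2) hu hpos hg hR0 (by linarith) (hball R (by linarith))
    (by positivity) (hsup Ω u g x₀ R hu hpos hg hR0 (by linarith) (hball R (by linarith)) h2)
  set ρ := R / 2 with hρ
  have hρ0 : 0 < ρ := by positivity
  set a := c * (u x₀ / 2) with ha
  have ha0 : 0 < a := by positivity
  have hchain : ∀ k : ℕ, 2 ^ k * ρ ≤ 3 → ∀ z ∈ closedBall x₀ (2 ^ k * ρ),
      a * ((1 / 2) ^ N) ^ k ≤ u z := by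
    intro k
    induction k with
    | zero => intro _ z hz; simpa using hstart z (by simpa using hz)
    | succ k ih =>
      intro hk z hz
      have e : (2 : ℝ) ^ (k + 1) * ρ = 2 * (2 ^ k * ρ) := by ring
      rw [e] at hk hz
      have hpk : 0 < 2 ^ k * ρ := by positivity
      have := hdoub Ω u g x₀ (2 ^ k * ρ) (a * ((1 / 2) ^ N) ^ k) hu hpos hg hpk (by linarith)
        (hball _ (by linarith)) (by positivity) (ih (by linarith)) z hz
      refine le_trans ?_ this
      rw [pow_succ, ← mul_assoc]
      gcongr _ * ?_
      exact pow_le_pow_of_le_one (by norm_num) (by norm_num) (by omega)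
  obtain ⟨k, hk1, hk2⟩ := exists_nat_pow_near (x := 3 / ρ) (y := 2)
    (by rw [le_div_iff₀ hρ0]; linarith) one_lt_two
  rw [le_div_iff₀ hρ0] at hk1
  rw [div_lt_iff₀ hρ0, pow_succ] at hk2
  have hy' : y ∈ closedBall x₀ (2 ^ k * ρ) := by
    rw [mem_closedBall, dist_eq_norm]
    have := norm_sub_le y x₀
    have : ‖y‖ ≤ 1 / 2 := mem_closedBall_zero_iff.1 hy
    linarith
  have hfin := hchain k hk1 y hy'
  have hpk : ρ / 3 ≤ (1 / 2 : ℝ) ^ k := by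
    rw [one_div, inv_pow, le_inv_comm₀ (by positivity) (by positivity), inv_div,
      le_div_iff₀ hρ0]
    exact hk1
  have h6 : K * u x ≤ u y := by
    refine le_trans ?_ hfin
    calc K * u x = c / 2 * (σ / 6) ^ N * ((1 / 2) ^ N * u x) := by rw [hK]; ring
      _ ≤ c / 2 * (σ / 6) ^ N * (t ^ N * u x₀) := by gcongr
      _ = a * (ρ / 3) ^ N := by rw [ha, hρ, hR]; ring_nf
      _ ≤ a * ((1 / 2) ^ k) ^ N := by gcongr
      _ = _ := by rw [← pow_mul, ← pow_mul, mul_comm k]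
  have h7 : u x ≤ K⁻¹ * u y := by rwa [← div_eq_inv_mul, le_div_iff₀ hK0, mul_comm]
  exact h7.trans (by gcongr; exact le_max_left _ _)

/-- Harnack inequality, scale-invariant form. -/
lemma exists_harnack (hd : 2 ≤ d) (hp : 1 < p) :
    ∃ C : ℝ, 1 ≤ C ∧ ∀ (Ω : Set (Eu d)) (u g : Eu d → ℝ) (z : Eu d) (R : ℝ),
      PSol p Ω u g → (∀ x ∈ Ω, 0 < u x) → 0 < R → closedBall z (8 * R) ⊆ Ω →
      (∀ x ∈ Ω, R ^ p * |g x| ≤ u x ^ (p - 1)) →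
      ∀ x ∈ closedBall z (R / 2), ∀ y ∈ closedBall z (R / 2), u x ≤ C * u y := by
  obtain ⟨C, hC, h⟩ := exists_harnack_const hd hp
  refine ⟨C, hC, fun Ω u g z R hu hpos hR hΩ hg x hx y hy => ?_⟩
  have hmem : ∀ w ∈ closedBall z (R / 2), R⁻¹ • (w - z) ∈ closedBall (0 : Eu d) (1 / 2) := by
    intro w hw
    rw [mem_closedBall, dist_eq_norm] at hw
    rw [mem_closedBall_zero_iff, norm_smul, norm_inv, Real.norm_of_nonneg hR.le, inv_mul_le_iff₀ hR]
    linarith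
  have key := h _ _ _ (hu.rescale hp z hR) (fun x hx => hpos _ hx) (fun x hx => by
      rw [abs_mul, abs_of_nonneg (by positivity : 0 ≤ R ^ p)]; exact hg _ hx)
    (fun w hw => hΩ (by rw [mul_comm]; exact add_smul_mem_closedBall hR.le hw))
    _ (hmem x hx) _ (hmem y hy)
  simpa [smul_smul, mul_inv_cancel₀ hR.ne'] using key

/-- Oscillation decay. -/
lemma exists_osc_decay (hd : 2 ≤ d) (hp : 1 < p) :
    ∃ θ : ℝ, 0 < θ ∧ θ < 1 ∧ ∀ (Ω : Set (Eu d)) (u g : Eu d → ℝ) (z : Eu d) (R ω κ : ℝ),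
      PSol p Ω u g → 0 < R → closedBall z (16 * R) ⊆ Ω → 0 < κ →
      (∀ x ∈ closedBall z (16 * R), R ^ p * |g x| ≤ κ ^ (p - 1)) →
      (∀ x ∈ closedBall z (16 * R), ∀ y ∈ closedBall z (16 * R), u x - u y ≤ ω) →
      ∀ x ∈ closedBall z (R / 2), ∀ y ∈ closedBall z (R / 2), u x - u y ≤ θ * (ω + 2 * κ) := by
  obtain ⟨C₀, hC₀, h⟩ := exists_harnack hd hp
  set C := C₀ + 1 with hC
  refine ⟨(C - 1) / (C + 1), by apply div_pos <;> linarith,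
    by rw [div_lt_one] <;> linarith, fun Ω u g z R ω κ hu hR hΩ hκ hg hω x hx y hy => ?_⟩
  have hsub : ball z (16 * R) ⊆ Ω := ball_subset_closedBall.trans hΩ
  have hcont : ContinuousOn u (closedBall z (16 * R)) := hu.contDiffOn.continuousOn.mono hΩ
  have hne : (closedBall z (16 * R)).Nonempty := ⟨z, mem_closedBall_self (by positivity)⟩
  obtain ⟨a, ha, hmin⟩ := (isCompact_closedBall z (16 * R)).exists_isMinOn hne hcont
  obtain ⟨b, hb, hmax⟩ := (isCompact_closedBall z (16 * R)).exists_isMaxOn hne hcont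
  have hmin' : ∀ w ∈ closedBall z (16 * R), u a ≤ u w := fun w hw => hmin hw
  have hmax' : ∀ w ∈ closedBall z (16 * R), u w ≤ u b := fun w hw => hmax hw
  have hu' := hu.mono isOpen_ball hsub
  have h8 : closedBall z (8 * R) ⊆ ball z (16 * R) := closedBall_subset_ball (by linarith)
  have hmono : ∀ s : ℝ, κ ≤ s → κ ^ (p - 1) ≤ s ^ (p - 1) := fun s hs =>
    Real.rpow_le_rpow hκ.le hs (by linarith)
  have hlow := h _ _ _ z R (hu'.add_const hp (κ - u a))
    (fun w hw => by have := hmin' w (ball_subset_closedBall hw); linarith) hR h8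
    (fun w hw => (hg w (ball_subset_closedBall hw)).trans
      (hmono _ (by have := hmin' w (ball_subset_closedBall hw); linarith))) x hx y hy
  have hupp := h _ _ _ z R (hu'.const_sub hp (κ + u b))
    (fun w hw => by have := hmax' w (ball_subset_closedBall hw); linarith) hR h8
    (fun w hw => by
      rw [abs_neg]
      exact (hg w (ball_subset_closedBall hw)).trans
        (hmono _ (by have := hmax' w (ball_subset_closedBall hw); linarith))) y hy x hx
  have hab := hω b hb a ha
  have hx16 : x ∈ closedBall z (16 * R) := closedBall_subset_closedBall (by linarith) hx
  have hy16 : y ∈ closedBall z (16 * R) := closedBall_subset_closedBall (by linarith) hy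
  have e1 := hmin' y hy16
  have e2 := hmax' x hx16
  rw [div_mul_eq_mul_div, le_div_iff₀ (by linarith)]
  nlinarith

/-! ### Classical solutions are weak solutions -/

/-- The divergence of a vector field in terms of its derivative. -/
def trace (L : Eu d →L[ℝ] Eu d) : ℝ :=
  ∑ i, (L (EuclideanSpace.single i 1)) i

lemma trace_id : trace (ContinuousLinearMap.id ℝ (Eu d)) = d := by
  simp [trace]

lemma trace_add (L M : Eu d →L[ℝ] Eu d) : trace (L + M) = trace L + trace M := by
  simp [trace, Finset.sum_add_distrib]

lemma trace_smul (c : ℝ) (L : Eu d →L[ℝ] Eu d) : trace (c • L) = c * trace L := by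
  simp [trace, Finset.mul_sum]

lemma trace_smulRight (f : Eu d →L[ℝ] ℝ) (v : Eu d) : trace (f.smulRight v) = f v := by
  have : f v = f (∑ i, v i • EuclideanSpace.single i (1 : ℝ)) := by
    congr 1
    ext j
    simp [Finset.sum_apply, Pi.single_apply]
  rw [this, map_sum]
  simp [trace, mul_comm]

lemma continuous_trace : Continuous (trace : (Eu d →L[ℝ] Eu d) → ℝ) := by
  unfold trace
  fun_prop

lemma inner_eq_sum (a b : Eu d) : ⟪a, b⟫ = ∑ i, a i * b i := by
  simp [PiLp.inner_apply, mul_comm]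

lemma gradient_apply (F : Eu d → ℝ) (x : Eu d) (i : Fin d) :
    gradient F x i = fderiv ℝ F x (EuclideanSpace.single i 1) := by
  have : ⟪gradient F x, EuclideanSpace.single i (1 : ℝ)⟫ = fderiv ℝ F x (EuclideanSpace.single i 1) := by
    simp [gradient]
  rw [← this, EuclideanSpace.inner_single_right]
  simp

lemma integral_inner_gradient_eq {Ω : Set (Eu d)} (hΩ : IsOpen Ω) {W : Eu d → Eu d}
    {W' : Eu d → Eu d →L[ℝ] Eu d} (hW : ∀ x ∈ Ω, HasFDerivAt W (W' x) x)
    (hW' : ContinuousOn W' Ω) {F : Eu d → ℝ} (hF : ContDiff ℝ 1 F) (hc : HasCompactSupport F)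
    (hs : tsupport F ⊆ Ω) :
    ∫ x, ⟪W x, gradient F x⟫ = ∫ x, -trace (W' x) * F x := by
  have hWc : ContinuousOn W Ω := fun x hx => (hW x hx).continuousAt.continuousWithinAt
  have hF0 : ∀ x ∉ tsupport F, F x = 0 := fun x hx => image_eq_zero_of_notMem_tsupport hx
  have hcoord : ∀ i : Fin d, Continuous fun v : Eu d => v i := fun i => by fun_prop
  have i1 : ∀ i, Integrable fun x => W x i * gradient F x i := fun i =>
    integrable_of_continuousOn_of_eq_zero hΩ hc hs
      (((hcoord i).comp_continuousOn hWc).mul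
        ((hcoord i).comp hF.continuous_gradient').continuousOn)
      fun x hx => by rw [gradient_eq_zero_of_notMem hx]; simp
  have i2 : ∀ i, Integrable fun x => (W' x (EuclideanSpace.single i 1)) i * F x := fun i =>
    integrable_of_continuousOn_of_eq_zero hΩ hc hs
      (((hcoord i).comp_continuousOn (hW'.clm_apply continuousOn_const)).mul
        hF.continuous.continuousOn)
      fun x hx => by rw [hF0 x hx, mul_zero]
  have i3 : ∀ i, Integrable fun x => W x i * F x := fun i =>
    integrable_of_continuousOn_of_eq_zero hΩ hc hs
      (((hcoord i).comp_continuousOn hWc).mul hF.continuous.continuousOn)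
      fun x hx => by rw [hF0 x hx, mul_zero]
  have key : ∀ i, ∫ x, W x i * gradient F x i
      = -∫ x, (W' x (EuclideanSpace.single i 1)) i * F x := by
    intro i
    have := integral_bilinear_hasFDerivAt_right_eq_neg_left_of_integrable (μ := volume)
      (f := fun x => W x i) (f' := fun x => (EuclideanSpace.proj i).comp (W' x))
      (g := F) (g' := fderiv ℝ F) (v := EuclideanSpace.single i (1 : ℝ))
      (B := ContinuousLinearMap.mul ℝ ℝ) (by simpa using i2 i)
      (by simpa only [ContinuousLinearMap.mul_apply', gradient_apply] using i1 i)
      (by simpa using i3 i)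
      (fun x hx => (EuclideanSpace.proj (𝕜 := ℝ) i).hasFDerivAt.comp x (hW x (hs hx)))
      (fun x _ => (hF.differentiable (by norm_num) x).hasFDerivAt)
    simp only [ContinuousLinearMap.mul_apply'] at this
    simp only [gradient_apply]
    exact this
  simp only [inner_eq_sum]
  rw [integral_finsetSum _ fun i _ => i1 i, Finset.sum_congr rfl fun i _ => key i,
    Finset.sum_neg_distrib, ← integral_finsetSum _ fun i _ => i2 i, ← integral_neg]
  congr 1; ext x
  rw [trace, neg_mul, Finset.sum_mul]

/-- The derivative of the flux. -/
lemma hasFDerivAt_flux_comp {W : Eu d → Eu d} {W' : Eu d →L[ℝ] Eu d} {x : Eu d}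
    (hW : HasFDerivAt W W' x) (h0 : W x ≠ 0) :
    HasFDerivAt (fun y => flux p (W y))
      (‖W x‖ ^ (p - 2) • W' + (((p - 2) * ‖W x‖ ^ (p - 4)) • (innerSL ℝ (W x)).comp W').smulRight
        (W x)) x := by
  have hn : 0 < ‖W x‖ := norm_pos_iff.2 h0
  have h1 : HasFDerivAt (fun y => ‖W y‖ ^ 2) (2 • (innerSL ℝ (W x)).comp W') x := hW.norm_sq
  have h2 := h1.rpow_const (p := (p - 2) / 2) (Or.inl (by positivity))
  have e : (fun y => flux p (W y)) = fun y => (‖W y‖ ^ 2) ^ ((p - 2) / 2) • W y := by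
    ext1 y
    rw [flux, ← Real.rpow_natCast_mul (norm_nonneg _)]
    congr 2; push_cast; ring
  rw [e]
  refine (h2.smul hW).congr_fderiv ?_
  have e1 : (‖W x‖ ^ 2) ^ ((p - 2) / 2) = ‖W x‖ ^ (p - 2) := by
    rw [← Real.rpow_natCast_mul (norm_nonneg _)]; congr 1; push_cast; ring
  have e2 : (‖W x‖ ^ 2) ^ ((p - 2) / 2 - 1) = ‖W x‖ ^ (p - 4) := by
    rw [← Real.rpow_natCast_mul (norm_nonneg _)]; congr 1; push_cast; ring
  rw [e1, e2]
  congr 1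
  ext1 v
  simp only [ContinuousLinearMap.smulRight_apply, _root_.smul_apply, smul_eq_mul,
    two_smul, _root_.add_apply]
  congr 1; ring

lemma PSol.of_hasFDerivAt {Ω : Set (Eu d)} (hΩ : IsOpen Ω) {b : Eu d → ℝ}
    {G : Eu d → Eu d} {G' : Eu d → Eu d →L[ℝ] Eu d} (hb : ∀ x ∈ Ω, HasGradientAt b (G x) x)
    (hG : ∀ x ∈ Ω, HasFDerivAt G (G' x) x) (hG' : ContinuousOn G' Ω) (h0 : ∀ x ∈ Ω, G x ≠ 0) :
    PSol p Ω b fun x => -(‖G x‖ ^ (p - 4) *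
      (‖G x‖ ^ 2 * trace (G' x) + (p - 2) * ⟪G x, G' x (G x)⟫)) := by
  have hGc : ContinuousOn G Ω := fun x hx => (hG x hx).continuousAt.continuousWithinAt
  have hgrad : ∀ x ∈ Ω, gradient b x = G x := fun x hx => (hb x hx).gradient
  have hpow : ∀ q : ℝ, ContinuousOn (fun x => ‖G x‖ ^ q) Ω := fun q =>
    hGc.norm.rpow_const fun x hx => Or.inl (norm_ne_zero_iff.2 (h0 x hx))
  refine ⟨hΩ, ?_, ?_, ?_⟩
  · refine (contDiffOn_succ_iff_fderiv_of_isOpen (n := 0) hΩ).2 ⟨fun x hx =>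
      (hb x hx).differentiableAt.differentiableWithinAt, by simp, ?_⟩
    rw [contDiffOn_zero]
    refine ((InnerProductSpace.toDual ℝ (Eu d)).continuous.comp_continuousOn hGc).congr
      fun x hx => (hb x hx).hasFDerivAt.fderiv
  · exact ((hpow _).mul (((hGc.norm.pow 2).mul (continuous_trace.comp_continuousOn hG')).add
      (continuousOn_const.mul (hGc.inner (hG'.clm_apply hGc))))).neg
  · intro F hF hc hs
    have hW : ∀ x ∈ Ω, HasFDerivAt (fun y => flux p (G y)) _ x := fun x hx =>
      hasFDerivAt_flux_comp (p := p) (hG x hx) (h0 x hx)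
    have := integral_inner_gradient_eq hΩ hW (by
      refine ((hpow _).smul hG').add ?_
      have hL : ContinuousOn (fun x => ((p - 2) * ‖G x‖ ^ (p - 4)) •
          (innerSL ℝ (G x)).comp (G' x)) Ω :=
        (continuousOn_const.mul (hpow _)).smul
          (((innerSL ℝ).continuous.comp_continuousOn hGc).clm_comp hG')
      exact ((ContinuousLinearMap.smulRightL ℝ (Eu d) (Eu d)).continuous.comp_continuousOn
        hL).clm_apply hGc) hF hc hs
    rw [show (∫ x, ⟪flux p (gradient b x), gradient F x⟫) =
      ∫ x, ⟪flux p (G x), gradient F x⟫ from ?_, this]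
    · congr 1; ext x
      by_cases hx : x ∈ Ω
      · have hn : 0 < ‖G x‖ := norm_pos_iff.2 (h0 x hx)
        have e : ‖G x‖ ^ (p - 2) = ‖G x‖ ^ (p - 4) * ‖G x‖ ^ 2 := by
          rw [← Real.rpow_natCast, ← Real.rpow_add hn]; congr 1; push_cast; ring
        rw [trace_add, trace_smul, trace_smulRight, e]
        simp only [_root_.smul_apply, ContinuousLinearMap.comp_apply,
          innerSL_apply_apply, smul_eq_mul]
        ring
      · rw [image_eq_zero_of_notMem_tsupport fun h => hx (hs h), mul_zero, mul_zero]
    · congr 1; ext x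
      by_cases hx : x ∈ Ω
      · rw [hgrad x hx]
      · rw [gradient_eq_zero_of_notMem fun h => hx (hs h), inner_zero_right, inner_zero_right]

/-- `‖∇b‖^{4-p} Δ_p b` for `b x = F(‖x‖²) + H(‖x - y‖²)`, in terms of `a = 2F'`, `a' = 4F''`,
`b = 2H'`, `b' = 4H''`, `X = ‖x‖²`, `Y = ‖x - y‖²` and `I = ⟪x, x - y⟫`. -/
def radialOp (d : ℕ) (p a a' b b' X Y I : ℝ) : ℝ :=
  (a ^ 2 * X + 2 * a * b * I + b ^ 2 * Y) * ((d + p - 2) * (a + b) + a' * X + b' * Y) +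
    (p - 2) * (a' * (a * X + b * I) ^ 2 + b' * (a * I + b * Y) ^ 2)

lemma hasFDerivAt_radial {A A' : ℝ → ℝ} {y x : Eu d}
    (hA : HasDerivAt A (A' (‖x - y‖ ^ 2) / 2) (‖x - y‖ ^ 2)) :
    HasFDerivAt (fun x => A (‖x - y‖ ^ 2) • (x - y))
      (A (‖x - y‖ ^ 2) • ContinuousLinearMap.id ℝ (Eu d) +
        (A' (‖x - y‖ ^ 2) • innerSL ℝ (x - y)).smulRight (x - y)) x := by
  have h0 : HasFDerivAt (fun x : Eu d => x - y) (ContinuousLinearMap.id ℝ (Eu d)) x :=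
    (hasFDerivAt_id x).sub_const y
  refine ((hA.comp_hasFDerivAt x h0.norm_sq).smul h0).congr_fderiv ?_
  congr 1
  ext1 v
  simp only [ContinuousLinearMap.smulRight_apply, _root_.smul_apply, smul_eq_mul,
    two_smul, _root_.add_apply, ContinuousLinearMap.comp_apply, ContinuousLinearMap.id_apply]
  congr 1; ring

lemma hasGradientAt_radial {F A : ℝ → ℝ} {y x : Eu d}
    (hF : HasDerivAt F (A (‖x - y‖ ^ 2) / 2) (‖x - y‖ ^ 2)) :
    HasGradientAt (fun x => F (‖x - y‖ ^ 2)) (A (‖x - y‖ ^ 2) • (x - y)) x := by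
  rw [hasGradientAt_iff_hasFDerivAt]
  have h0 : HasFDerivAt (fun x : Eu d => x - y) (ContinuousLinearMap.id ℝ (Eu d)) x :=
    (hasFDerivAt_id x).sub_const y
  refine (hF.comp_hasFDerivAt x h0.norm_sq).congr_fderiv ?_
  ext1 v
  simp only [_root_.smul_apply, smul_eq_mul, two_smul, _root_.add_apply,
    ContinuousLinearMap.comp_apply, ContinuousLinearMap.id_apply, map_smul,
    InnerProductSpace.toDual_apply_apply, innerSL_apply_apply]
  ring

lemma exists_pSol_radial {Ω : Set (Eu d)} (hΩ : IsOpen Ω) {F A A' H B B' : ℝ → ℝ} {y : Eu d}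
    (hF : ∀ x ∈ Ω, HasDerivAt F (A (‖x‖ ^ 2) / 2) (‖x‖ ^ 2))
    (hA : ∀ x ∈ Ω, HasDerivAt A (A' (‖x‖ ^ 2) / 2) (‖x‖ ^ 2))
    (hA' : ContinuousOn (fun x : Eu d => A' (‖x‖ ^ 2)) Ω)
    (hH : ∀ x ∈ Ω, HasDerivAt H (B (‖x - y‖ ^ 2) / 2) (‖x - y‖ ^ 2))
    (hB : ∀ x ∈ Ω, HasDerivAt B (B' (‖x - y‖ ^ 2) / 2) (‖x - y‖ ^ 2))
    (hB' : ContinuousOn (fun x : Eu d => B' (‖x - y‖ ^ 2)) Ω)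
    (h0 : ∀ x ∈ Ω, A (‖x‖ ^ 2) • x + B (‖x - y‖ ^ 2) • (x - y) ≠ 0) :
    ∃ g, PSol p Ω (fun x => F (‖x‖ ^ 2) + H (‖x - y‖ ^ 2)) g ∧
      ∀ x ∈ Ω, 0 < radialOp d p (A (‖x‖ ^ 2)) (A' (‖x‖ ^ 2)) (B (‖x - y‖ ^ 2))
        (B' (‖x - y‖ ^ 2)) (‖x‖ ^ 2) (‖x - y‖ ^ 2) ⟪x, x - y⟫ → g x < 0 := by
  have hAc : ContinuousOn (fun x : Eu d => A (‖x‖ ^ 2)) Ω := fun x hx =>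
    (ContinuousAt.comp (f := fun x : Eu d => ‖x‖ ^ 2) (hA x hx).continuousAt
      (by fun_prop)).continuousWithinAt
  have hBc : ContinuousOn (fun x : Eu d => B (‖x - y‖ ^ 2)) Ω := fun x hx =>
    (ContinuousAt.comp (f := fun x : Eu d => ‖x - y‖ ^ 2) (hB x hx).continuousAt
      (by fun_prop)).continuousWithinAt
  have hrank : ∀ (A : Eu d → ℝ) (y : Eu d), ContinuousOn A Ω →
      ContinuousOn (fun x => (A x • innerSL ℝ (x - y)).smulRight (x - y)) Ω := fun A y hA =>
    ((ContinuousLinearMap.smulRightL ℝ (Eu d) (Eu d)).continuous.comp_continuousOn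
      (hA.smul ((innerSL ℝ).continuous.comp (continuous_id.sub continuous_const)).continuousOn
        )).clm_apply (continuousOn_id.sub continuousOn_const)
  have hr0 : ContinuousOn (fun x : Eu d => (A' (‖x‖ ^ 2) • innerSL ℝ x).smulRight x) Ω := by
    simpa only [sub_zero] using hrank _ 0 hA'
  refine ⟨_, PSol.of_hasFDerivAt (p := p) hΩ
    (G := fun x => A (‖x‖ ^ 2) • x + B (‖x - y‖ ^ 2) • (x - y))
    (G' := fun x => (A (‖x‖ ^ 2) • ContinuousLinearMap.id ℝ (Eu d) +
        (A' (‖x‖ ^ 2) • innerSL ℝ x).smulRight x) +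
      (B (‖x - y‖ ^ 2) • ContinuousLinearMap.id ℝ (Eu d) +
        (B' (‖x - y‖ ^ 2) • innerSL ℝ (x - y)).smulRight (x - y)))
    (fun x hx => ?_) (fun x hx => ?_) ?_ h0, fun x hx hpos => ?_⟩
  · refine HasGradientAt.fadd ?_ (hasGradientAt_radial (hH x hx))
    simpa only [sub_zero] using
      hasGradientAt_radial (F := F) (A := A) (y := 0) (x := x) (by simpa using hF x hx)
  · refine HasFDerivAt.add ?_ (hasFDerivAt_radial (hB x hx))
    simpa only [sub_zero] using
      hasFDerivAt_radial (A := A) (A' := A') (y := 0) (x := x) (by simpa using hA x hx)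
  · exact ((hAc.smul continuousOn_const).add hr0).add
      ((hBc.smul continuousOn_const).add (hrank _ y hB'))
  · have hn := norm_pos_iff.2 (h0 x hx)
    refine neg_neg_of_pos (mul_pos (Real.rpow_pos_of_pos hn _) (hpos.trans_eq ?_))
    set z := x - y with hz
    have hzx : ⟪z, x⟫ = ⟪x, z⟫ := real_inner_comm _ _
    rw [← real_inner_self_eq_norm_sq (A (‖x‖ ^ 2) • x + B (‖z‖ ^ 2) • z)]
    simp only [trace_add, trace_smul, trace_smulRight, trace_id, _root_.smul_apply,
      _root_.add_apply, ContinuousLinearMap.smulRight_apply, ContinuousLinearMap.id_apply,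
      innerSL_apply_apply, smul_eq_mul, inner_add_left, inner_add_right, real_inner_smul_left,
      real_inner_smul_right, hzx, real_inner_self_eq_norm_sq, norm_smul, mul_pow,
      Real.norm_eq_abs, sq_abs, radialOp]
    ring

/-! ### Radial barriers -/

lemma exists_primitive_rpow (k : ℝ) :
    ∃ f : ℝ → ℝ, f 1 = 0 ∧ ∀ t, 0 < t → HasDerivAt f (t ^ (-k)) t := by
  obtain ⟨f, hf⟩ : ∃ f : ℝ → ℝ, ∀ t, 0 < t → HasDerivAt f (t ^ (-k)) t := by
    by_cases hk : k = 1
    · refine ⟨Real.log, fun t ht => ?_⟩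
      rw [hk, Real.rpow_neg_one]
      exact Real.hasDerivAt_log ht.ne'
    · refine ⟨fun t => t ^ (1 - k) / (1 - k), fun t ht => ?_⟩
      have h := (Real.hasDerivAt_rpow_const (p := 1 - k) (Or.inl ht.ne')).div_const (1 - k)
      rwa [mul_div_cancel_left₀ _ (sub_ne_zero.2 (Ne.symm hk)),
        show 1 - k - 1 = -k by ring] at h
  exact ⟨fun t => f t - f 1, sub_self _, fun t ht => (hf t ht).sub_const _⟩

lemma strictMonoOn_of_hasDerivAt_rpow {k : ℝ} {f : ℝ → ℝ}
    (hf : ∀ t, 0 < t → HasDerivAt f (t ^ (-k)) t) : StrictMonoOn f (Ioi 0) := by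
  refine strictMonoOn_of_deriv_pos (convex_Ioi 0)
    (fun t ht => (hf t ht).continuousAt.continuousWithinAt) fun t ht => ?_
  rw [interior_Ioi] at ht
  rw [(hf t ht).deriv]
  exact Real.rpow_pos_of_pos ht _

/-- The exponent of the radial `p`-harmonic functions, in terms of `‖x‖²`. -/
def radialExp (d : ℕ) (p : ℝ) : ℝ := (d + p - 2) / (2 * (p - 1))

lemma radialExp_nonneg (hd : 2 ≤ d) (hp : 1 < p) : 0 ≤ radialExp d p := by
  have : (2 : ℝ) ≤ d := by exact_mod_cast hd
  exact div_nonneg (by linarith) (by linarith)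

lemma radialExp_mul (hp : 1 < p) : 2 * (p - 1) * radialExp d p = d + p - 2 := by
  rw [radialExp, mul_div_cancel₀]
  have : 0 < p - 1 := by linarith
  positivity

/-- The supersolution property of locally uniform limits: strict subsolutions lying below `U` on
the boundary of a domain lie below `U` inside. -/
def IsSuper (p : ℝ) (U : Eu d → ℝ) : Prop :=
  ∀ (D Ω : Set (Eu d)) (b g : Eu d → ℝ), PSol p Ω b g → IsOpen D → IsCompact (closure D) →
    closure D ⊆ Ω → 0 ∉ closure D → (∀ x ∈ closure D, g x < 0) →
    (∀ x ∈ frontier D, b x ≤ U x) → ∀ x ∈ D, b x ≤ U x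

lemma isCompact_closure_annulus (r₁ r₂ : ℝ) :
    IsCompact (closure {x : Eu d | r₁ < ‖x‖ ∧ ‖x‖ < r₂}) ∧
    closure {x : Eu d | r₁ < ‖x‖ ∧ ‖x‖ < r₂} ⊆ {x | r₁ ≤ ‖x‖ ∧ ‖x‖ ≤ r₂} := by
  have h : closure {x : Eu d | r₁ < ‖x‖ ∧ ‖x‖ < r₂} ⊆ {x | r₁ ≤ ‖x‖ ∧ ‖x‖ ≤ r₂} :=
    closure_minimal (fun x hx => ⟨hx.1.le, hx.2.le⟩)
      ((isClosed_le continuous_const continuous_norm).inter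
        (isClosed_le continuous_norm continuous_const))
  exact ⟨(isCompact_closedBall (0 : Eu d) r₂).of_isClosed_subset isClosed_closure
    fun x hx => mem_closedBall_zero_iff.2 (h hx).2, h⟩

lemma isOpen_annulus (r₁ r₂ : ℝ) : IsOpen {x : Eu d | r₁ < ‖x‖ ∧ ‖x‖ < r₂} :=
  (isOpen_lt continuous_const continuous_norm).inter (isOpen_lt continuous_norm continuous_const)

lemma norm_eq_of_mem_frontier_annulus {r₁ r₂ : ℝ} {x : Eu d}
    (hx : x ∈ frontier {x : Eu d | r₁ < ‖x‖ ∧ ‖x‖ < r₂}) : ‖x‖ = r₁ ∨ ‖x‖ = r₂ := by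
  rw [(isOpen_annulus r₁ r₂).frontier_eq] at hx
  have h1 := (isCompact_closure_annulus r₁ r₂).2 hx.1
  by_contra! h
  exact hx.2 ⟨lt_of_le_of_ne h1.1 (Ne.symm h.1), lt_of_le_of_ne h1.2 h.2⟩

/-- Three-spheres inequality. -/
lemma IsSuper.three_spheres (hd : 2 ≤ d) (hp : 1 < p) {U : Eu d → ℝ} (hU : IsSuper p U)
    {f : ℝ → ℝ} (hf : ∀ t, 0 < t → HasDerivAt f (t ^ (-radialExp d p)) t) {α β r₁ r₂ : ℝ}
    (hr : 0 < r₁) (h1 : ∀ x, ‖x‖ = r₁ → α * f (r₁ ^ 2) + β ≤ U x)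
    (h2 : ∀ x, ‖x‖ = r₂ → α * f (r₂ ^ 2) + β ≤ U x) {x : Eu d} (hx1 : r₁ < ‖x‖)
    (hx2 : ‖x‖ < r₂) : α * f (‖x‖ ^ 2) + β ≤ U x := by
  set k := radialExp d p with hk
  have hk0 := radialExp_nonneg hd hp
  have hkm := radialExp_mul (d := d) hp
  have hdp : 0 < (d : ℝ) + p - 2 := by
    have : (2 : ℝ) ≤ d := by exact_mod_cast hd
    linarith
  have hr2 : 0 < r₂ := hr.trans (hx1.trans hx2)
  have hlim : Tendsto (fun ε : ℝ => α * f (‖x‖ ^ 2) + β + ε * (‖x‖ ^ 2 - r₂ ^ 2)) (𝓝[>] 0)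
      (𝓝 (α * f (‖x‖ ^ 2) + β + 0 * (‖x‖ ^ 2 - r₂ ^ 2))) :=
    (Continuous.tendsto (by fun_prop) 0).mono_left nhdsWithin_le_nhds
  rw [zero_mul, add_zero] at hlim
  refine le_of_tendsto hlim ?_
  have hne : ∀ᶠ ε : ℝ in 𝓝[>] 0, 0 < ε ∧ ∀ t, 0 < t → t ≤ r₂ ^ 2 → α * t ^ (-k) + ε ≠ 0 := by
    rcases le_or_gt 0 α with hα | hα
    · filter_upwards [self_mem_nhdsWithin] with ε (hε : 0 < ε)
      refine ⟨hε, fun t ht _ => ?_⟩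
      have := mul_nonneg hα (Real.rpow_pos_of_pos ht (-k)).le
      linarith
    · have hc : 0 < -α * (r₂ ^ 2) ^ (-k) := mul_pos (by linarith) (by positivity)
      filter_upwards [Ioo_mem_nhdsGT hc] with ε hε
      refine ⟨hε.1, fun t ht ht2 => ?_⟩
      have := Real.rpow_le_rpow_of_nonpos ht ht2 (neg_nonpos.2 hk0)
      have := hε.2
      nlinarith
  filter_upwards [hne] with ε ⟨hε, hne⟩
  set Ω : Set (Eu d) := {x | 0 < ‖x‖ ^ 2 ∧ α * (‖x‖ ^ 2) ^ (-k) + ε ≠ 0} with hΩ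
  have hpow : ContinuousOn (fun x : Eu d => (‖x‖ ^ 2) ^ (-k)) {x | 0 < ‖x‖ ^ 2} := fun x hx =>
    ((continuous_norm.pow 2).continuousAt.rpow_const (Or.inl (ne_of_gt hx))).continuousWithinAt
  have hΩo : IsOpen Ω :=
    ((continuousOn_const.mul hpow).add continuousOn_const).isOpen_inter_preimage
      (isOpen_lt continuous_const (continuous_norm.pow 2)) isOpen_compl_singleton
  have hpow' : ContinuousOn (fun x : Eu d => (‖x‖ ^ 2) ^ (-k - 1)) Ω := fun x hx =>
    ((continuous_norm.pow 2).continuousAt.rpow_const (Or.inl (ne_of_gt hx.1))).continuousWithinAt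
  obtain ⟨g, hg, hgneg⟩ := exists_pSol_radial (p := p) hΩo (y := 0)
    (F := fun t => α * f t + β + ε * (t - r₂ ^ 2)) (A := fun t => 2 * (α * t ^ (-k) + ε))
    (A' := fun t => 4 * (α * (-k * t ^ (-k - 1)))) (H := fun _ => 0) (B := fun _ => 0)
    (B' := fun _ => 0)
    (fun x hx => by
      have h1 := ((((hf _ hx.1).const_mul α).add_const β).add
        (((hasDerivAt_id (‖x‖ ^ 2)).sub_const (r₂ ^ 2)).const_mul ε))
      refine h1.congr_deriv ?_
      ring)
    (fun x hx => by
      have h1 := (((Real.hasDerivAt_rpow_const (p := -k) (Or.inl (ne_of_gt hx.1))).const_mul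
        α).add_const ε).const_mul 2
      refine h1.congr_deriv ?_
      ring)
    (continuousOn_const.mul (continuousOn_const.mul (continuousOn_const.mul hpow')))
    (fun x _ => by simpa using hasDerivAt_const _ _)
    (fun x _ => by simpa using hasDerivAt_const _ _) continuousOn_const
    (fun x hx => by
      rw [zero_smul, add_zero]
      refine smul_ne_zero (mul_ne_zero two_ne_zero hx.2) fun h => ?_
      have := hx.1
      rw [h, norm_zero] at this
      norm_num at this)
  have hcl : closure {x : Eu d | r₁ < ‖x‖ ∧ ‖x‖ < r₂} ⊆ Ω := by
    intro y hy
    have hy' := (isCompact_closure_annulus r₁ r₂).2 hy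
    have hy0 : 0 < ‖y‖ := hr.trans_le hy'.1
    exact ⟨by positivity, hne _ (by positivity) (pow_le_pow_left₀ hy0.le hy'.2 2)⟩
  have := hU _ Ω _ g hg (isOpen_annulus r₁ r₂) (isCompact_closure_annulus r₁ r₂).1 hcl
    (fun h => by have := (hcl h).1; simp at this)
    (fun y hy => hgneg y (hcl hy) ?_) (fun y hy => ?_) x ⟨hx1, hx2⟩
  · simpa using this
  · obtain ⟨hX, hA⟩ := hcl hy
    set X := ‖y‖ ^ 2 with hXdef
    have e : X ^ (-k - 1) * X = X ^ (-k) := by rw [← Real.rpow_add_one hX.ne']; congr 1; ring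
    have e2 : radialOp d p (2 * (α * X ^ (-k) + ε)) (4 * (α * (-k * X ^ (-k - 1)))) 0 0 X
        (‖y - 0‖ ^ 2) ⟪y, y - 0⟫ = (2 * (α * X ^ (-k) + ε)) ^ 2 * X * (2 * (d + p - 2) * ε) := by
      have : radialOp d p (2 * (α * X ^ (-k) + ε)) (4 * (α * (-k * X ^ (-k - 1)))) 0 0 X
        (‖y - 0‖ ^ 2) ⟪y, y - 0⟫ = (2 * (α * X ^ (-k) + ε)) ^ 2 * X *
          (2 * (d + p - 2) * (α * X ^ (-k) + ε) -
            2 * α * (2 * (p - 1) * k) * (X ^ (-k - 1) * X)) := by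
        simp only [radialOp]; ring
      rw [this, e, hkm]; ring
    rw [e2]
    have := mul_ne_zero (two_ne_zero (α := ℝ)) hA
    positivity
  · rcases norm_eq_of_mem_frontier_annulus hy with h | h
    · have := h1 y h
      have h3 : r₁ ^ 2 < r₂ ^ 2 := pow_lt_pow_left₀ (hx1.trans hx2) hr.le two_ne_zero
      simp only [h, add_zero]
      nlinarith
    · have := h2 y h
      simp only [h, add_zero, sub_self, mul_zero]
      exact this

/-! ### The strong maximum principle at a contact point with a radial solution -/

lemma radialOp_perturb {a a' b b' X Y I ε : ℝ} (h : (d + p - 2) * a + (p - 1) * (a' * X) = 0) :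
    radialOp d p a a' (ε * b) (ε * b') X Y I = ε *
      (a ^ 2 * (X * ((d + p - 2) * b + b' * Y) + (p - 2) * b' * I ^ 2) +
        ε * (2 * a * b * I * ((d + p - 2) * b + b' * Y) +
          b ^ 2 * Y * ((d + p - 2) * a + a' * X) +
          (p - 2) * (a' * (b * I) ^ 2 + 2 * b' * a * I * b * Y)) +
        ε ^ 2 * (b ^ 2 * Y * ((d + p - 2) * b + b' * Y) + (p - 2) * b' * (b * Y) ^ 2)) := by
  have e : radialOp d p a a' (ε * b) (ε * b') X Y I = a * (a * X + 2 * ε * b * I) *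
      ((d + p - 2) * a + (p - 1) * (a' * X)) + ε *
      (a ^ 2 * (X * ((d + p - 2) * b + b' * Y) + (p - 2) * b' * I ^ 2) +
        ε * (2 * a * b * I * ((d + p - 2) * b + b' * Y) +
          b ^ 2 * Y * ((d + p - 2) * a + a' * X) +
          (p - 2) * (a' * (b * I) ^ 2 + 2 * b' * a * I * b * Y)) +
        ε ^ 2 * (b ^ 2 * Y * ((d + p - 2) * b + b' * Y) + (p - 2) * b' * (b * Y) ^ 2)) := by
    rw [radialOp]; ring
  rw [e, h, mul_zero, zero_add]

lemma hopf_linear_pos {κ E X Y I : ℝ} (hE : 0 < E) (hκ : 0 < κ) (hX : 0 < X)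
    (hI : I ^ 2 ≤ X * Y) (h1 : d + p - 2 < 2 * κ * Y) (h2 : d + p - 2 < 2 * κ * (p - 1) * Y) :
    0 < X * ((d + p - 2) * (-2 * κ * E) + 4 * κ ^ 2 * E * Y) + (p - 2) * (4 * κ ^ 2 * E) * I ^ 2
      := by
  have e : X * ((d + p - 2) * (-2 * κ * E) + 4 * κ ^ 2 * E * Y) +
      (p - 2) * (4 * κ ^ 2 * E) * I ^ 2 =
      2 * κ * E * (X * (2 * κ * Y - (d + p - 2)) + 2 * κ * ((p - 2) * I ^ 2)) := by ring
  rw [e]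
  refine mul_pos (by positivity) ?_
  rcases le_or_gt 2 p with h | h
  · have : 0 ≤ 2 * κ * ((p - 2) * I ^ 2) :=
      mul_nonneg (by positivity) (mul_nonneg (by linarith) (sq_nonneg _))
    have := mul_pos hX (sub_pos.2 h1)
    linarith
  · have h3 : 2 * κ * ((p - 2) * (X * Y)) ≤ 2 * κ * ((p - 2) * I ^ 2) :=
      mul_le_mul_of_nonneg_left (mul_le_mul_of_nonpos_left hI (by linarith)) (by positivity)
    have := mul_pos hX (sub_pos.2 h2)
    nlinarith

lemma exists_hopf_barrier (hd : 2 ≤ d) (hp : 1 < p) {f : ℝ → ℝ}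
    (hf : ∀ t, 0 < t → HasDerivAt f (t ^ (-radialExp d p)) t) (α β : ℝ) {x₁ y : Eu d}
    (hx₁ : x₁ ≠ 0) (hy : x₁ ≠ y) :
    ∃ δ > 0, ∃ κ > 0, ∀ ε, 0 < ε → ε < δ → ∀ c : ℝ, ∃ g : Eu d → ℝ,
      PSol p (ball x₁ δ) (fun x => α * f (‖x‖ ^ 2) + β +
        ε * (Real.exp (-κ * ‖x - y‖ ^ 2) + c)) g ∧ 0 ∉ ball x₁ δ ∧ ∀ x ∈ ball x₁ δ, g x < 0 := by
  set k := radialExp d p with hk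
  have hkm : 2 * (p - 1) * k = d + p - 2 := radialExp_mul (d := d) hp
  have hdp : 0 < (d : ℝ) + p - 2 := by
    have : (2 : ℝ) ≤ d := by exact_mod_cast hd
    linarith
  have hp1 : 0 < p - 1 := by linarith
  have hY1 : 0 < ‖x₁ - y‖ ^ 2 := pow_pos (norm_pos_iff.2 (sub_ne_zero.2 hy)) 2
  have hX1 : 0 < ‖x₁‖ ^ 2 := pow_pos (norm_pos_iff.2 hx₁) 2
  obtain ⟨κ, hκ, hκ1, hκ2⟩ : ∃ κ > 0, d + p - 2 < 2 * κ * ‖x₁ - y‖ ^ 2 ∧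
      d + p - 2 < 2 * κ * (p - 1) * ‖x₁ - y‖ ^ 2 := by
    have h1 : Tendsto (fun κ : ℝ => κ * (2 * ‖x₁ - y‖ ^ 2)) atTop atTop :=
      tendsto_id.atTop_mul_const (by positivity)
    have h2 : Tendsto (fun κ : ℝ => κ * (2 * (p - 1) * ‖x₁ - y‖ ^ 2)) atTop atTop :=
      tendsto_id.atTop_mul_const (by positivity)
    obtain ⟨κ, a, b, c⟩ := ((eventually_gt_atTop 0).and
      ((h1.eventually_gt_atTop ((d : ℝ) + p - 2)).and
        (h2.eventually_gt_atTop ((d : ℝ) + p - 2)))).exists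
    exact ⟨κ, a, by linarith, by linarith⟩
  set A : ℝ → ℝ := fun t => 2 * (α * t ^ (-k)) with hA
  set A' : ℝ → ℝ := fun t => 4 * (α * (-k * t ^ (-k - 1))) with hA'
  set B : ℝ → ℝ := fun t => -2 * κ * Real.exp (-κ * t) with hB
  set B' : ℝ → ℝ := fun t => 4 * κ ^ 2 * Real.exp (-κ * t) with hB'
  have hrel : ∀ x : Eu d, x ≠ 0 →
      (d + p - 2) * A (‖x‖ ^ 2) + (p - 1) * (A' (‖x‖ ^ 2) * ‖x‖ ^ 2) = 0 := by
    intro x hx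
    have hX : 0 < ‖x‖ ^ 2 := pow_pos (norm_pos_iff.2 hx) 2
    have e : (‖x‖ ^ 2) ^ (-k - 1) * ‖x‖ ^ 2 = (‖x‖ ^ 2) ^ (-k) := by
      rw [← Real.rpow_add_one hX.ne']; congr 1; ring
    have e2 : (d + p - 2) * A (‖x‖ ^ 2) + (p - 1) * (A' (‖x‖ ^ 2) * ‖x‖ ^ 2) =
      2 * (d + p - 2) * α * (‖x‖ ^ 2) ^ (-k) -
        2 * α * (2 * (p - 1) * k) * ((‖x‖ ^ 2) ^ (-k - 1) * ‖x‖ ^ 2) := by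
      simp only [hA, hA']; ring
    rw [e2, e, hkm]; ring
  have key : ∃ δ > 0, ∀ ε, 0 < ε → ε < δ → ∀ x ∈ ball x₁ δ, x ≠ 0 ∧
      A (‖x‖ ^ 2) • x + (ε * B (‖x - y‖ ^ 2)) • (x - y) ≠ 0 ∧
      0 < radialOp d p (A (‖x‖ ^ 2)) (A' (‖x‖ ^ 2)) (ε * B (‖x - y‖ ^ 2))
        (ε * B' (‖x - y‖ ^ 2)) (‖x‖ ^ 2) (‖x - y‖ ^ 2) ⟪x, x - y⟫ := by
    have hev0 : ∀ᶠ x in 𝓝 x₁, x ≠ 0 := isOpen_ne.mem_nhds hx₁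
    by_cases hα : α = 0
    · have hev : ∀ᶠ x in 𝓝 x₁, x ≠ y ∧ d + p - 2 < 2 * κ * (p - 1) * ‖x - y‖ ^ 2 :=
        (eventually_ne_nhds hy).and ((isOpen_lt continuous_const (by fun_prop)).mem_nhds hκ2)
      obtain ⟨δ, hδ, hball⟩ := Metric.eventually_nhds_iff_ball.1 (hev0.and hev)
      refine ⟨δ, hδ, fun ε hε _ x hx => ?_⟩
      obtain ⟨h0, hxy, hlt⟩ := hball x hx
      have hA0 : A (‖x‖ ^ 2) = 0 := by simp [hA, hα]
      have hA0' : A' (‖x‖ ^ 2) = 0 := by simp [hA', hα]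
      have hE := Real.exp_pos (-κ * ‖x - y‖ ^ 2)
      have hYp : 0 < ‖x - y‖ ^ 2 := pow_pos (norm_pos_iff.2 (sub_ne_zero.2 hxy)) 2
      refine ⟨h0, ?_, ?_⟩
      · rw [hA0, zero_smul, zero_add]
        refine smul_ne_zero (mul_ne_zero hε.ne' ?_) (sub_ne_zero.2 hxy)
        simp only [hB]
        have : 0 < 2 * κ * Real.exp (-κ * ‖x - y‖ ^ 2) := by positivity
        linarith
      · rw [hA0, hA0']
        have e : radialOp d p 0 0 (ε * B (‖x - y‖ ^ 2)) (ε * B' (‖x - y‖ ^ 2)) (‖x‖ ^ 2)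
            (‖x - y‖ ^ 2) ⟪x, x - y⟫ = ε ^ 3 * (2 * κ * Real.exp (-κ * ‖x - y‖ ^ 2)) ^ 3 *
              ‖x - y‖ ^ 2 * (2 * κ * (p - 1) * ‖x - y‖ ^ 2 - (d + p - 2)) := by
          simp only [radialOp, hB, hB']; ring
        rw [e]
        exact mul_pos (by positivity) (sub_pos.2 hlt)
    · set Φ : ℝ × Eu d → ℝ := fun q =>
        A (‖q.2‖ ^ 2) ^ 2 * (‖q.2‖ ^ 2 * ((d + p - 2) * B (‖q.2 - y‖ ^ 2) +
          B' (‖q.2 - y‖ ^ 2) * ‖q.2 - y‖ ^ 2) +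
          (p - 2) * B' (‖q.2 - y‖ ^ 2) * ⟪q.2, q.2 - y⟫ ^ 2) +
        q.1 * (2 * A (‖q.2‖ ^ 2) * B (‖q.2 - y‖ ^ 2) * ⟪q.2, q.2 - y⟫ *
          ((d + p - 2) * B (‖q.2 - y‖ ^ 2) + B' (‖q.2 - y‖ ^ 2) * ‖q.2 - y‖ ^ 2) +
          B (‖q.2 - y‖ ^ 2) ^ 2 * ‖q.2 - y‖ ^ 2 * ((d + p - 2) * A (‖q.2‖ ^ 2) +
            A' (‖q.2‖ ^ 2) * ‖q.2‖ ^ 2) +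
          (p - 2) * (A' (‖q.2‖ ^ 2) * (B (‖q.2 - y‖ ^ 2) * ⟪q.2, q.2 - y⟫) ^ 2 +
            2 * B' (‖q.2 - y‖ ^ 2) * A (‖q.2‖ ^ 2) * ⟪q.2, q.2 - y⟫ * B (‖q.2 - y‖ ^ 2) *
              ‖q.2 - y‖ ^ 2)) +
        q.1 ^ 2 * (B (‖q.2 - y‖ ^ 2) ^ 2 * ‖q.2 - y‖ ^ 2 * ((d + p - 2) * B (‖q.2 - y‖ ^ 2) +
          B' (‖q.2 - y‖ ^ 2) * ‖q.2 - y‖ ^ 2) +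
          (p - 2) * B' (‖q.2 - y‖ ^ 2) * (B (‖q.2 - y‖ ^ 2) * ‖q.2 - y‖ ^ 2) ^ 2) with hΦ
      have cX : ContinuousAt (fun q : ℝ × Eu d => ‖q.2‖ ^ 2) (0, x₁) := by fun_prop
      have cA : ContinuousAt (fun q : ℝ × Eu d => A (‖q.2‖ ^ 2)) (0, x₁) :=
        continuousAt_const.mul (continuousAt_const.mul (cX.rpow_const (Or.inl hX1.ne')))
      have cA' : ContinuousAt (fun q : ℝ × Eu d => A' (‖q.2‖ ^ 2)) (0, x₁) :=
        continuousAt_const.mul (continuousAt_const.mul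
          (continuousAt_const.mul (cX.rpow_const (Or.inl hX1.ne'))))
      have cB : ContinuousAt (fun q : ℝ × Eu d => B (‖q.2 - y‖ ^ 2)) (0, x₁) := by
        simp only [hB]; fun_prop
      have cB' : ContinuousAt (fun q : ℝ × Eu d => B' (‖q.2 - y‖ ^ 2)) (0, x₁) := by
        simp only [hB']; fun_prop
      have cY : ContinuousAt (fun q : ℝ × Eu d => ‖q.2 - y‖ ^ 2) (0, x₁) := by fun_prop
      have cI : ContinuousAt (fun q : ℝ × Eu d => ⟪q.2, q.2 - y⟫) (0, x₁) := by fun_prop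
      have cG : ContinuousAt (fun q : ℝ × Eu d =>
          A (‖q.2‖ ^ 2) • q.2 + (q.1 * B (‖q.2 - y‖ ^ 2)) • (q.2 - y)) (0, x₁) :=
        (cA.smul continuousAt_snd).add
          ((continuousAt_fst.mul cB).smul (continuousAt_snd.sub continuousAt_const))
      have cΦ : ContinuousAt Φ (0, x₁) := by
        have gen : ∀ a a' b b' X Y I : ℝ × Eu d → ℝ, ContinuousAt a (0, x₁) →
            ContinuousAt a' (0, x₁) → ContinuousAt b (0, x₁) → ContinuousAt b' (0, x₁) →
            ContinuousAt X (0, x₁) → ContinuousAt Y (0, x₁) → ContinuousAt I (0, x₁) →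
            ContinuousAt (fun q => a q ^ 2 * (X q * ((d + p - 2) * b q + b' q * Y q) +
              (p - 2) * b' q * I q ^ 2) +
            q.1 * (2 * a q * b q * I q * ((d + p - 2) * b q + b' q * Y q) +
              b q ^ 2 * Y q * ((d + p - 2) * a q + a' q * X q) +
              (p - 2) * (a' q * (b q * I q) ^ 2 + 2 * b' q * a q * I q * b q * Y q)) +
            q.1 ^ 2 * (b q ^ 2 * Y q * ((d + p - 2) * b q + b' q * Y q) +
              (p - 2) * b' q * (b q * Y q) ^ 2)) (0, x₁) := by
          intro a a' b b' X Y I h1 h2 h3 h4 h5 h6 h7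
          fun_prop
        exact gen _ _ _ _ _ _ _ cA cA' cB cB' cX cY cI
      have hA1 : A (‖x₁‖ ^ 2) ≠ 0 :=
        mul_ne_zero two_ne_zero (mul_ne_zero hα (Real.rpow_pos_of_pos hX1 _).ne')
      have hΦ0 : 0 < Φ (0, x₁) := by
        have hI : ⟪x₁, x₁ - y⟫ ^ 2 ≤ ‖x₁‖ ^ 2 * ‖x₁ - y‖ ^ 2 := by
          rw [← mul_pow]
          exact sq_le_sq' (neg_le_of_abs_le (abs_real_inner_le_norm _ _)) (real_inner_le_norm _ _)
        have := hopf_linear_pos (d := d) (Real.exp_pos (-κ * ‖x₁ - y‖ ^ 2)) hκ hX1 hI hκ1 hκ2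
        have h3 := mul_pos (pow_pos (abs_pos.2 hA1) 2) this
        rw [sq_abs] at h3
        simp only [hΦ, zero_mul, zero_pow two_ne_zero, add_zero]
        exact h3
      have hev : ∀ᶠ q : ℝ × Eu d in 𝓝 (0, x₁), q.2 ≠ 0 ∧
          A (‖q.2‖ ^ 2) • q.2 + (q.1 * B (‖q.2 - y‖ ^ 2)) • (q.2 - y) ≠ 0 ∧ 0 < Φ q := by
        refine (continuousAt_snd.eventually_ne hx₁).and ((cG.eventually_ne ?_).and
          (cΦ.eventually (lt_mem_nhds hΦ0)))
        simpa using ⟨hA1, hx₁⟩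
      obtain ⟨δ, hδ, hball⟩ := Metric.eventually_nhds_iff_ball.1 hev
      refine ⟨δ, hδ, fun ε hε hεδ x hx => ?_⟩
      obtain ⟨h0, hG, hpos⟩ := hball (ε, x) (by
        rw [← ball_prod_same]
        exact ⟨by simpa [abs_of_pos hε] using hεδ, hx⟩)
      refine ⟨h0, hG, ?_⟩
      rw [radialOp_perturb (hrel x h0)]
      exact mul_pos hε hpos
  obtain ⟨δ, hδ, hkey⟩ := key
  refine ⟨δ, hδ, κ, hκ, fun ε hε hεδ c => ?_⟩
  have hpos : ∀ x ∈ ball x₁ δ, 0 < ‖x‖ ^ 2 := fun x hx =>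
    pow_pos (norm_pos_iff.2 (hkey ε hε hεδ x hx).1) 2
  obtain ⟨g, hg, hgneg⟩ := exists_pSol_radial (p := p) (isOpen_ball (x := x₁) (ε := δ)) (y := y)
    (F := fun t => α * f t + β) (A := A) (A' := A')
    (H := fun t => ε * (Real.exp (-κ * t) + c)) (B := fun t => ε * B t) (B' := fun t => ε * B' t)
    (fun x hx => by
      refine (((hf _ (hpos x hx)).const_mul α).add_const β).congr_deriv ?_
      simp only [hA]; ring)
    (fun x hx => by
      refine (((Real.hasDerivAt_rpow_const (p := -k) (Or.inl (hpos x hx).ne')).const_mul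
        α).const_mul 2).congr_deriv ?_
      simp only [hA']; ring)
    (fun x hx => (continuousAt_const.mul (continuousAt_const.mul (continuousAt_const.mul
      ((continuous_norm.pow 2).continuousAt.rpow_const
        (Or.inl (hpos x hx).ne'))))).continuousWithinAt)
    (fun x _ => by
      have h1 := (((hasDerivAt_id (‖x - y‖ ^ 2)).const_mul (-κ)).exp.add_const c).const_mul ε
      refine h1.congr_deriv ?_
      simp only [hB, id]; ring)
    (fun x _ => by
      have h1 := ((((hasDerivAt_id (‖x - y‖ ^ 2)).const_mul (-κ)).exp).const_mul
        (-2 * κ)).const_mul ε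
      refine h1.congr_deriv ?_
      simp only [hB', id]; ring)
    (by simp only [hB']; fun_prop) (fun x hx => (hkey ε hε hεδ x hx).2.1)
  exact ⟨g, hg, fun h => (hkey ε hε hεδ 0 h).1 rfl,
    fun x hx => hgneg x hx (hkey ε hε hεδ x hx).2.2⟩

/-- Hopf lemma: `U` cannot touch a radial solution at a point of the boundary of a ball in which
it lies strictly above it. -/
lemma IsSuper.not_contact (hd : 2 ≤ d) (hp : 1 < p) {U : Eu d → ℝ} (hU : IsSuper p U)
    (hUc : ContinuousOn U {0}ᶜ) {f : ℝ → ℝ}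
    (hf : ∀ t, 0 < t → HasDerivAt f (t ^ (-radialExp d p)) t) {α β : ℝ}
    (hle : ∀ x, x ≠ 0 → α * f (‖x‖ ^ 2) + β ≤ U x) {x₁ y : Eu d} (hx₁ : x₁ ≠ 0) (hy : x₁ ≠ y)
    (heq : U x₁ = α * f (‖x₁‖ ^ 2) + β)
    (hlt : ∀ x, x ≠ 0 → x ≠ x₁ → ‖x - y‖ ≤ ‖x₁ - y‖ → α * f (‖x‖ ^ 2) + β < U x) : False := by
  obtain ⟨δ, hδ, κ, hκ, hbar⟩ := exists_hopf_barrier hd hp hf α β hx₁ hy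
  have h0 : (0 : Eu d) ∉ ball x₁ δ := by
    obtain ⟨g, -, h, -⟩ := hbar (δ / 2) (by linarith) (by linarith) 0
    exact h
  set E₀ := Real.exp (-κ * ‖x₁ - y‖ ^ 2) with hE₀
  set h : Eu d → ℝ := fun x => Real.exp (-κ * ‖x - y‖ ^ 2) - E₀ with hh
  have hhc : Continuous h := by simp only [hh]; fun_prop
  have hh1 : ∀ x, h x ≤ 1 := by
    intro x
    have h1 : Real.exp (-κ * ‖x - y‖ ^ 2) ≤ 1 := Real.exp_le_one_iff.2 (by
      have : 0 ≤ κ * ‖x - y‖ ^ 2 := by positivity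
      linarith)
    have := Real.exp_pos (-κ * ‖x₁ - y‖ ^ 2)
    simp only [hh, hE₀]; linarith
  set b₀ : Eu d → ℝ := fun x => α * f (‖x‖ ^ 2) + β with hb₀
  have hb₀c : ContinuousOn b₀ {0}ᶜ := fun x hx =>
    ((continuousAt_const.mul (ContinuousAt.comp (f := fun x : Eu d => ‖x‖ ^ 2)
      (hf _ (pow_pos (norm_pos_iff.2 hx) 2)).continuousAt (by fun_prop))).add
      continuousAt_const).continuousWithinAt
  set S := sphere x₁ (δ / 2) with hS
  have hSb : S ⊆ ball x₁ δ := fun x hx => by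
    rw [mem_sphere] at hx; rw [mem_ball]; linarith
  have hS0 : ∀ x ∈ S, x ≠ 0 := fun x hx h => h0 (h ▸ hSb hx)
  have hSx : ∀ x ∈ S, x ≠ x₁ := fun x hx h => by
    rw [h, hS, mem_sphere, dist_self] at hx; linarith
  have hScomp : IsCompact S := isCompact_sphere _ _
  have hwc : ContinuousOn (fun x => U x - b₀ x) S := (hUc.sub hb₀c).mono fun x hx => hS0 x hx
  have hK1 : IsCompact (S ∩ (fun x => U x - b₀ x) ⁻¹' Iic 0) :=
    hScomp.of_isClosed_subset (hwc.preimage_isClosed_of_isClosed hScomp.isClosed isClosed_Iic)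
      inter_subset_left
  obtain ⟨η, hη, hK1η⟩ := hK1.exists_forall_le' (f := fun x => -h x) hhc.neg.continuousOn
    (a := 0) (fun x hx => by
      by_contra! hcon
      have h1 : E₀ ≤ Real.exp (-κ * ‖x - y‖ ^ 2) := by
        simp only [hh] at hcon; linarith
      rw [hE₀, Real.exp_le_exp] at h1
      have h2 : ‖x - y‖ ^ 2 ≤ ‖x₁ - y‖ ^ 2 := by nlinarith
      have h3 := hlt x (hS0 x hx.1) (hSx x hx.1)
        ((pow_le_pow_iff_left₀ (norm_nonneg _) (norm_nonneg _) two_ne_zero).1 h2)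
      have h4 : U x - b₀ x ≤ 0 := hx.2
      simp only [hb₀] at h4
      linarith)
  have hK2 : IsCompact (S ∩ h ⁻¹' Ici (-(η / 2))) :=
    hScomp.inter_right (isClosed_Ici.preimage hhc)
  obtain ⟨c, hc, hK2c⟩ := hK2.exists_forall_le' (f := fun x => U x - b₀ x) (a := 0)
    (hwc.mono inter_subset_left) (fun x hx => by
      by_contra! hcon
      have h1 := hK1η x ⟨hx.1, hcon⟩
      have h2 : -(η / 2) ≤ h x := hx.2
      linarith)
  set ε := min (δ / 2) (c / (1 + η)) with hε
  have hε0 : 0 < ε := lt_min (by linarith) (by positivity)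
  obtain ⟨g, hg, -, hgneg⟩ := hbar ε hε0 ((min_le_left _ _).trans_lt (by linarith)) (η / 2 - E₀)
  have hcl : closure (ball x₁ (δ / 2)) ⊆ ball x₁ δ := by
    rw [closure_ball _ (by linarith)]
    exact closedBall_subset_ball (by linarith)
  have := hU _ _ _ g hg isOpen_ball
    ((isCompact_closedBall x₁ (δ / 2)).of_isClosed_subset isClosed_closure closure_ball_subset_closedBall)
    hcl (fun h => h0 (hcl h)) (fun x hx => hgneg x (hcl hx)) (fun x hx => ?_) x₁
    (mem_ball_self (by linarith))
  · rw [heq, ← hE₀] at this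
    have : 0 < ε * (E₀ + (η / 2 - E₀)) := by
      rw [add_sub_cancel]; positivity
    linarith
  · rw [frontier_ball _ (by linarith)] at hx
    change b₀ x + ε * (Real.exp (-κ * ‖x - y‖ ^ 2) + (η / 2 - E₀)) ≤ U x
    have e : Real.exp (-κ * ‖x - y‖ ^ 2) + (η / 2 - E₀) = h x + η / 2 := by
      simp only [hh]; ring
    rw [e]
    rcases le_or_gt (-(η / 2)) (h x) with h1 | h1
    · have h2 := hK2c x ⟨hx, h1⟩
      have h3 : ε * (h x + η / 2) ≤ ε * (1 + η) :=
        mul_le_mul_of_nonneg_left (by have := hh1 x; linarith) hε0.le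
      have h4 : ε * (1 + η) ≤ c := by
        rw [← le_div_iff₀ (by positivity)]; exact min_le_right _ _
      linarith
    · have h2 := hle x (hS0 x hx)
      have h3 : ε * (h x + η / 2) ≤ 0 := mul_nonpos_of_nonneg_of_nonpos hε0.le (by linarith)
      simp only [hb₀]
      linarith

lemma isPreconnected_compl_zero (hd : 2 ≤ d) : IsPreconnected ({0}ᶜ : Set (Eu d)) := by
  have hrank : 1 < Module.rank ℝ (Eu d) := by
    rw [rank_eq_card_basis (EuclideanSpace.basisFun (Fin d) ℝ).toBasis, Fintype.card_fin]
    exact_mod_cast hd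
  exact (isConnected_compl_singleton_of_one_lt_rank hrank (0 : Eu d)).isPreconnected

/-- Strong maximum principle for the difference with a radial solution. -/
lemma IsSuper.eq_of_contact (hd : 2 ≤ d) (hp : 1 < p) {U : Eu d → ℝ} (hU : IsSuper p U)
    (hUc : ContinuousOn U {0}ᶜ) {f : ℝ → ℝ}
    (hf : ∀ t, 0 < t → HasDerivAt f (t ^ (-radialExp d p)) t) {α β : ℝ}
    (hle : ∀ x, x ≠ 0 → α * f (‖x‖ ^ 2) + β ≤ U x) {x₁ : Eu d} (hx₁ : x₁ ≠ 0)
    (heq : U x₁ = α * f (‖x₁‖ ^ 2) + β) {x : Eu d} (hx : x ≠ 0) :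
    U x = α * f (‖x‖ ^ 2) + β := by
  set w : Eu d → ℝ := fun x => U x - (α * f (‖x‖ ^ 2) + β) with hw
  have hwc : ContinuousOn w {0}ᶜ := hUc.sub fun x hx =>
    ((continuousAt_const.mul (ContinuousAt.comp (f := fun x : Eu d => ‖x‖ ^ 2)
      (hf _ (pow_pos (norm_pos_iff.2 hx) 2)).continuousAt (by fun_prop))).add
      continuousAt_const).continuousWithinAt
  have hw0 : ∀ x, x ≠ 0 → 0 ≤ w x := fun x hx => sub_nonneg.2 (hle x hx)
  set Z : Set (Eu d) := {x | x ≠ 0 ∧ w x = 0} with hZ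
  have hconn := isPreconnected_compl_zero hd
  have hcont : ∀ x, x ≠ 0 → ContinuousAt w x := fun x hx =>
    hwc.continuousAt (isOpen_compl_singleton.mem_nhds hx)
  have hZc : closure Z ∩ {0}ᶜ ⊆ Z := by
    rintro x ⟨hxc, hx0⟩
    refine ⟨hx0, by_contra fun h => ?_⟩
    have := mem_closure_iff_frequently.1 hxc
    exact this (((hcont x hx0).eventually_ne h).mono fun y hy hyZ => hy hyZ.2)
  have hZo : IsOpen Z := by
    rw [Metric.isOpen_iff]
    rintro a ⟨ha0, haw⟩
    have hs : 0 < ‖a‖ := norm_pos_iff.2 ha0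
    set s := ‖a‖ / 2 with hsdef
    have hs0 : 0 < s := by positivity
    have hball : ∀ x ∈ closedBall a s, x ≠ 0 := by
      rintro x hx rfl
      rw [mem_closedBall, dist_zero_left] at hx
      linarith
    refine ⟨s / 4, by positivity, fun z hz => by_contra fun hzZ => ?_⟩
    have hzs : dist z a < s / 4 := hz
    have hz0 : z ≠ 0 := hball z (by rw [mem_closedBall]; linarith)
    have hcomp : IsCompact (closedBall a s ∩ w ⁻¹' {0}) :=
      (isCompact_closedBall a s).of_isClosed_subset
        ((hwc.mono fun x hx => hball x hx).preimage_isClosed_of_isClosed isClosed_closedBall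
          isClosed_singleton) inter_subset_left
    obtain ⟨x₁, ⟨hx1b, hx1w⟩, hmin⟩ := hcomp.exists_isMinOn
      (f := fun x => dist x z) ⟨a, mem_closedBall_self hs0.le, haw⟩ (by fun_prop)
    have hmin' : ∀ x ∈ closedBall a s ∩ w ⁻¹' {0}, dist x₁ z ≤ dist x z := fun x hx => hmin hx
    have hd1 : dist x₁ z < s / 4 := (hmin' a ⟨mem_closedBall_self hs0.le, haw⟩).trans_lt
      (by rwa [dist_comm])
    have hx1z : x₁ ≠ z := fun h => hzZ ⟨hz0, by rw [← h]; exact hx1w⟩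
    set y : Eu d := (1 / 2 : ℝ) • (x₁ + z) with hy
    have e1 : x₁ - y = (1 / 2 : ℝ) • (x₁ - z) := by rw [hy]; module
    have e2 : y - z = (1 / 2 : ℝ) • (x₁ - z) := by rw [hy]; module
    refine hU.not_contact hd hp hUc hf hle (hball x₁ hx1b) (y := y) ?_ (sub_eq_zero.1 hx1w)
      fun x hx0 hxx hxy => ?_
    · intro h
      rw [← sub_eq_zero, e1, smul_eq_zero] at h
      exact hx1z (sub_eq_zero.1 (h.resolve_left (by norm_num)))
    · refine lt_of_le_of_ne (hle x hx0) fun h => hxx ?_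
      have hxw : w x = 0 := by simp only [hw]; rw [← h, sub_self]
      have hn1 : ‖x₁ - y‖ = dist x₁ z / 2 := by
        rw [e1, norm_smul, dist_eq_norm]; norm_num; ring
      have hn2 : ‖y - z‖ = dist x₁ z / 2 := by
        rw [e2, norm_smul, dist_eq_norm]; norm_num; ring
      have hxz : dist x z ≤ dist x₁ z := by
        have := dist_triangle x y z
        rw [dist_eq_norm x y, dist_eq_norm y z] at this
        linarith
      have hxb : x ∈ closedBall a s := by
        have := dist_triangle x z a
        rw [mem_closedBall]; linarith
      have h3 := hmin' x ⟨hxb, hxw⟩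
      have h4 : x - z = (x - y) + (y - z) := by abel
      have h5 : ‖x - z‖ ^ 2 = ‖x - y‖ ^ 2 + 2 * ⟪x - y, y - z⟫ + ‖y - z‖ ^ 2 := by
        rw [h4]; exact norm_add_sq_real _ _
      have h6 : ‖(x - y) - (y - z)‖ ^ 2 = ‖x - y‖ ^ 2 - 2 * ⟪x - y, y - z⟫ + ‖y - z‖ ^ 2 :=
        norm_sub_sq_real _ _
      rw [← dist_eq_norm x z] at h5
      have h7 : dist x₁ z ^ 2 ≤ dist x z ^ 2 := pow_le_pow_left₀ dist_nonneg h3 2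
      have h8 : ‖x - y‖ ^ 2 ≤ ‖x₁ - y‖ ^ 2 := pow_le_pow_left₀ (norm_nonneg _) hxy 2
      rw [hn1] at h8
      rw [hn2] at h5 h6
      have h9 : ‖(x - y) - (y - z)‖ ^ 2 ≤ 0 := by nlinarith
      have h10 : (x - y) - (y - z) = 0 := by
        rw [← norm_eq_zero]
        exact pow_eq_zero_iff two_ne_zero |>.1 (le_antisymm h9 (sq_nonneg _))
      rw [e2, sub_eq_zero, ← e1] at h10
      exact sub_left_injective h10
  have := hconn.subset_of_closure_inter_subset hZo ⟨x₁, hx₁, hx₁, sub_eq_zero.2 heq⟩ hZc hx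
  exact sub_eq_zero.1 this.2

/-! ### Rigidity -/

/-- Liouville-type rigidity: if the oscillation ratio on spheres of a positive limit is maximal
on the unit sphere, it equals one. -/
lemma IsSuper.ratio_eq_one (hd : 2 ≤ d) (hp : 1 < p) {U : Eu d → ℝ}
    (hUc : ContinuousOn U {0}ᶜ) (hpos : ∀ x, x ≠ 0 → 0 < U x) (h1 : IsSuper p U)
    (h2 : IsSuper p fun x => -U x) {q : ℝ} (hq : 0 < q)
    (hle : ∀ x y, x ≠ 0 → ‖x‖ = ‖y‖ → U x ≤ q * U y) {x₁ x₂ : Eu d} (hx₁ : ‖x₁‖ = 1)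
    (hx₂ : ‖x₂‖ = 1) (he : U x₂ = q * U x₁) : q = 1 := by
  obtain ⟨f, hf1, hf⟩ := exists_primitive_rpow (radialExp d p)
  have hmono := strictMonoOn_of_hasDerivAt_rpow hf
  have hne : ∀ {x : Eu d} {r : ℝ}, 0 < r → ‖x‖ = r → x ≠ 0 := fun hr hx =>
    norm_pos_iff.1 (hx ▸ hr)
  have hmin : ∀ r : ℝ, 0 < r → ∃ z : Eu d, ‖z‖ = r ∧ ∀ x, ‖x‖ = r → U z ≤ U x := by
    intro r hr
    obtain ⟨z, hz, hzm⟩ := (isCompact_sphere (0 : Eu d) r).exists_isMinOn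
      ⟨r • x₁, by rw [mem_sphere_zero_iff_norm, norm_smul, hx₁, mul_one, Real.norm_of_nonneg hr.le]⟩
      (hUc.mono fun x hx => hne hr (mem_sphere_zero_iff_norm.1 hx))
    exact ⟨z, mem_sphere_zero_iff_norm.1 hz, fun x hx => hzm (mem_sphere_zero_iff_norm.2 hx)⟩
  choose! z hz hzm using hmin
  have hmax : ∀ r : ℝ, 0 < r → ∀ x, ‖x‖ = r → U x ≤ q * U (z r) := fun r hr x hx =>
    hle x (z r) (hne hr hx) (hx.trans (hz r hr).symm)
  have hx1min : ∀ x, ‖x‖ = 1 → U x₁ ≤ U x := fun x hx => by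
    have := hle x₂ x (hne one_pos hx₂) (hx₂.trans hx.symm)
    rw [he] at this
    exact le_of_mul_le_mul_left this hq
  have key : ∀ r s : ℝ, 0 < r → r < 1 → 1 < s →
      (U (z r) - U x₁) * f (s ^ 2) = (U (z s) - U x₁) * f (r ^ 2) := by
    intro r s hr hr1 hs1
    have hs : 0 < s := one_pos.trans hs1
    have hlt : f (r ^ 2) < f (s ^ 2) :=
      hmono (pow_pos hr 2) (pow_pos hs 2) (by nlinarith)
    set α := (U (z s) - U (z r)) / (f (s ^ 2) - f (r ^ 2)) with hα
    have hαm : α * (f (s ^ 2) - f (r ^ 2)) = U (z s) - U (z r) :=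
      div_mul_cancel₀ _ (sub_pos.2 hlt).ne'
    set β := U (z r) - α * f (r ^ 2) with hβ
    have er : α * f (r ^ 2) + β = U (z r) := by rw [hβ]; ring
    have es : α * f (s ^ 2) + β = U (z s) := by rw [hβ]; linarith
    have a1 : β ≤ U x₁ := by
      have := h1.three_spheres hd hp hf hr (α := α) (β := β) (r₂ := s) (x := x₁)
        (fun x hx => er.trans_le (hzm r hr x hx)) (fun x hx => es.trans_le (hzm s hs x hx))
        (by rw [hx₁]; exact hr1) (by rw [hx₁]; exact hs1)
      rw [hx₁, one_pow, hf1] at this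
      linarith
    have a2 : U x₁ ≤ β := by
      have := h2.three_spheres hd hp hf hr (α := -q * α) (β := -q * β) (r₂ := s) (x := x₂)
        (fun x hx => by nlinarith [hmax r hr x hx])
        (fun x hx => by nlinarith [hmax s hs x hx])
        (by rw [hx₂]; exact hr1) (by rw [hx₂]; exact hs1)
      rw [hx₂, one_pow, hf1, he] at this
      refine le_of_mul_le_mul_left (a := q) ?_ hq
      linarith
    have hβe := le_antisymm a1 a2
    rw [← hβe, ← er, ← es]
    ring
  have hf2 : 0 < f (2 ^ 2) := by
    rw [← hf1]; exact hmono (mem_Ioi.2 one_pos) (by norm_num [mem_Ioi]) (by norm_num)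
  have hf12 : f ((1 / 2) ^ 2) < 0 := by
    rw [← hf1]; exact hmono (by norm_num [mem_Ioi]) (mem_Ioi.2 one_pos) (by norm_num)
  set α := (U (z 2) - U x₁) / f (2 ^ 2) with hα
  have hα2 : α * f (2 ^ 2) = U (z 2) - U x₁ := div_mul_cancel₀ _ hf2.ne'
  have hlow : ∀ r : ℝ, 0 < r → r < 1 → U (z r) - U x₁ = α * f (r ^ 2) := by
    intro r hr hr1
    have := key r 2 hr hr1 one_lt_two
    rw [← hα2] at this
    refine mul_right_cancel₀ hf2.ne' ?_
    rw [this]; ring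
  have hhigh : ∀ r : ℝ, 1 < r → U (z r) - U x₁ = α * f (r ^ 2) := by
    intro r hr1
    have := key (1 / 2) r (by norm_num) (by norm_num) hr1
    rw [hlow _ (by norm_num) (by norm_num)] at this
    refine mul_right_cancel₀ hf12.ne ?_
    rw [← this]; ring
  have hb : ∀ x, x ≠ 0 → α * f (‖x‖ ^ 2) + U x₁ ≤ U x := by
    intro x hx
    have hx0 := norm_pos_iff.2 hx
    rcases lt_trichotomy ‖x‖ 1 with h | h | h
    · linarith [hlow _ hx0 h, hzm _ hx0 x rfl]
    · rw [h, one_pow, hf1, mul_zero, zero_add]; exact hx1min x h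
    · linarith [hhigh _ h, hzm _ hx0 x rfl]
  have h0 := h1.eq_of_contact hd hp hUc hf hb (hne one_pos hx₁)
    (by rw [hx₁, one_pow, hf1]; ring) (hne one_pos hx₂)
  rw [hx₂, one_pow, hf1, mul_zero, zero_add, he] at h0
  have := hpos x₁ (hne one_pos hx₁)
  exact mul_right_cancel₀ this.ne' (h0.trans (one_mul _).symm)

/-! ### Asymptotically harmonic families -/

/-- A family of solutions of `-Δ_p W = G` on larger and larger parts of the punctured space which
is locally bounded and asymptotically `p`-harmonic. -/
structure AsympHarmonic {ι : Type*} (p : ℝ) (l : Filter ι) (W G : ι → Eu d → ℝ) : Prop where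
  sol : ∀ K : Set (Eu d), IsCompact K → K ⊆ {0}ᶜ →
    ∀ᶠ n in l, ∃ Ω, K ⊆ Ω ∧ PSol p Ω (W n) (G n)
  bdd : ∀ K : Set (Eu d), IsCompact K → K ⊆ {0}ᶜ → ∃ M, ∀ᶠ n in l, ∀ x ∈ K, |W n x| ≤ M
  small : ∀ K : Set (Eu d), IsCompact K → K ⊆ {0}ᶜ → ∀ ε : ℝ, 0 < ε →
    ∀ᶠ n in l, ∀ x ∈ K, |G n x| ≤ ε

namespace AsympHarmonic

variable {ι : Type*} {l : Filter ι} {W G : ι → Eu d → ℝ}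

lemma neg (h : AsympHarmonic p l W G) :
    AsympHarmonic p l (fun n x => -W n x) fun n x => -G n x where
  sol K hK h0 := (h.sol K hK h0).mono fun n ⟨Ω, h1, h2⟩ => ⟨Ω, h1, h2.neg⟩
  bdd K hK h0 := by simpa only [abs_neg] using h.bdd K hK h0
  small K hK h0 := by simpa only [abs_neg] using h.small K hK h0

lemma comp {κ : Type*} {l' : Filter κ} (h : AsympHarmonic p l W G) {r : κ → ι}
    (hr : Tendsto r l' l) : AsympHarmonic p l' (fun n => W (r n)) fun n => G (r n) where
  sol K hK h0 := hr.eventually (h.sol K hK h0)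
  bdd K hK h0 := (h.bdd K hK h0).imp fun _ hM => hr.eventually hM
  small K hK h0 ε hε := hr.eventually (h.small K hK h0 ε hε)

/-- Solutions of an asymptotically harmonic family are locally equicontinuous. -/
lemma equicontinuous (hd : 2 ≤ d) (hp : 1 < p) (h : AsympHarmonic p l W G) {x : Eu d}
    (hx : x ≠ 0) {ε : ℝ} (hε : 0 < ε) :
    ∃ δ, 0 < δ ∧ δ < ‖x‖ ∧ ∀ᶠ n in l, ∀ y ∈ closedBall x δ, |W n y - W n x| ≤ ε := by
  obtain ⟨θ, hθ0, hθ1, hosc⟩ := exists_osc_decay hd hp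
  have hx0 : 0 < ‖x‖ := norm_pos_iff.2 hx
  set s := ‖x‖ / 2 with hs
  have hs0 : 0 < s := half_pos hx0
  have hpow : ∀ j : ℕ, s / 32 ^ j ≤ s := fun j =>
    div_le_self hs0.le (one_le_pow₀ (by norm_num))
  have hK : IsCompact (closedBall x s) := isCompact_closedBall x s
  have hK0 : closedBall x s ⊆ {0}ᶜ := by
    rintro y hy rfl
    rw [mem_closedBall, dist_zero_left] at hy
    linarith
  obtain ⟨M, hM⟩ := h.bdd _ hK hK0
  have key : ∀ j : ℕ, ∀ η : ℝ, 0 < η → ∀ᶠ n in l, ∀ y ∈ closedBall x (s / 32 ^ j),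
      ∀ y' ∈ closedBall x (s / 32 ^ j), W n y - W n y' ≤ θ ^ j * (2 * M) + η := by
    intro j
    induction j with
    | zero =>
      intro η hη
      filter_upwards [hM] with n hn y hy y' hy'
      rw [pow_zero, div_one] at hy hy'
      have h1 := (abs_le.1 (hn y hy)).2
      have h2 := (abs_le.1 (hn y' hy')).1
      linarith
    | succ j ih =>
      intro η hη
      have hR : 0 < s / 32 ^ j / 16 := by positivity
      have e16 : 16 * (s / 32 ^ j / 16) = s / 32 ^ j := by ring
      have e2 : s / 32 ^ j / 16 / 2 = s / 32 ^ (j + 1) := by rw [pow_succ]; field_simp; norm_num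
      have hκ : 0 < (η / 4) ^ (p - 1) / (s / 32 ^ j / 16) ^ p := by positivity
      filter_upwards [ih (η / 2) (half_pos hη), h.small _ hK hK0 _ hκ, h.sol _ hK hK0]
        with n h1 h2 ⟨Ω, h3, h4⟩ y hy y' hy'
      have hsub : closedBall x (s / 32 ^ j) ⊆ closedBall x s := closedBall_subset_closedBall (hpow j)
      have := hosc Ω (W n) (G n) x (s / 32 ^ j / 16) (θ ^ j * (2 * M) + η / 2) (η / 4) h4 hR
        (by rw [e16]; exact hsub.trans h3) (by positivity)
        (fun z hz => by
          rw [e16] at hz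
          rw [mul_comm]
          exact (le_div_iff₀ (by positivity)).1 (h2 z (hsub hz)))
        (by rw [e16]; exact h1) y (by rwa [e2]) y' (by rwa [e2])
      refine this.trans ?_
      rw [pow_succ]
      nlinarith
  have htend : Tendsto (fun j : ℕ => θ ^ j * (2 * M)) atTop (𝓝 (0 * (2 * M))) :=
    (tendsto_pow_atTop_nhds_zero_of_lt_one hθ0.le hθ1).mul_const _
  rw [zero_mul] at htend
  obtain ⟨j, hj⟩ := (htend.eventually (gt_mem_nhds (half_pos hε))).exists
  refine ⟨s / 32 ^ j, by positivity, (hpow j).trans_lt (by linarith), ?_⟩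
  filter_upwards [key j (ε / 2) (half_pos hε)] with n hn y hy
  have hxm : x ∈ closedBall x (s / 32 ^ j) := mem_closedBall_self (by positivity)
  rw [abs_le]
  constructor <;> linarith [hn y hy x hxm, hn x hxm y hy]

/-- A uniform limit of an asymptotically harmonic family has the supersolution property. -/
lemma isSuper [l.NeBot] (hd : 2 ≤ d) (hp : 1 < p) (h : AsympHarmonic p l W G) {U : Eu d → ℝ}
    (hU : ∀ K : Set (Eu d), IsCompact K → K ⊆ {0}ᶜ → ∀ ε : ℝ, 0 < ε →
      ∀ᶠ n in l, ∀ x ∈ K, |W n x - U x| ≤ ε) : IsSuper p U := by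
  intro D Ω b g hb hD hDc hDΩ h0 hg hfr x hx
  have hK0 : closure D ⊆ {0}ᶜ := fun y hy h => h0 (by rw [mem_singleton_iff] at h; rwa [h] at hy)
  obtain ⟨y, hy, hmax⟩ := hDc.exists_isMaxOn ⟨x, subset_closure hx⟩ (hb.cont.mono hDΩ)
  have hgy : 0 < -g y := neg_pos.2 (hg y hy)
  refine le_of_forall_pos_le_add fun η hη => ?_
  obtain ⟨n, h1, h2, Ω', h3, h4⟩ := ((h.small _ hDc hK0 _ hgy).and
    ((hU _ hDc hK0 _ (half_pos hη)).and (h.sol _ hDc hK0))).exists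
  have := (hb.add_const hp (-(η / 2))).comparison (by omega) hp h4 hD hDc hDΩ h3
    (fun z hz _ => by
      have e1 : g z ≤ g y := hmax (subset_closure hz)
      have e2 := (abs_le.1 (h1 z (subset_closure hz))).1
      linarith)
    (fun z hz => by
      have e1 := hfr z hz
      have e2 := (abs_le.1 (h2 z (frontier_subset_closure hz))).1
      linarith) x hx
  have e := (abs_le.1 (h2 x (subset_closure hx))).2
  linarith

/-- Compactness: along an ultrafilter, an asymptotically harmonic family converges locally
uniformly. -/
lemma exists_limit {l : Ultrafilter ι} (hd : 2 ≤ d) (hp : 1 < p)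
    (h : AsympHarmonic p (l : Filter ι) W G) :
    ∃ U : Eu d → ℝ, ContinuousOn U {0}ᶜ ∧ ∀ K : Set (Eu d), IsCompact K → K ⊆ {0}ᶜ →
      ∀ ε : ℝ, 0 < ε → ∀ᶠ n in l, ∀ x ∈ K, |W n x - U x| ≤ ε := by
  have hlim : ∀ x : Eu d, x ≠ 0 → ∃ a, Tendsto (fun n => W n x) l (𝓝 a) := by
    intro x hx
    obtain ⟨M, hM⟩ := h.bdd {x} isCompact_singleton (by simpa using hx.symm)
    have hmem : Icc (-M) M ∈ l.map fun n => W n x :=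
      hM.mono fun n hn => abs_le.1 (hn x rfl)
    obtain ⟨a, -, ha⟩ := isCompact_Icc.ultrafilter_le_nhds' _ hmem
    exact ⟨a, ha⟩
  choose! U hU using hlim
  have hloc : ∀ x : Eu d, x ≠ 0 → ∀ ε : ℝ, 0 < ε → ∃ δ, 0 < δ ∧
      (∀ y ∈ closedBall x δ, |U y - U x| ≤ ε) ∧
      ∀ᶠ n in l, ∀ y ∈ closedBall x δ, |W n y - U y| ≤ ε := by
    intro x hx ε hε
    obtain ⟨δ, hδ, hδx, hn⟩ := h.equicontinuous hd hp hx (by positivity : 0 < ε / 3)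
    have hUδ : ∀ y ∈ closedBall x δ, |U y - U x| ≤ ε / 3 := by
      intro y hy
      have hy0 : y ≠ 0 := by
        rintro rfl
        rw [mem_closedBall, dist_zero_left] at hy
        linarith
      exact le_of_tendsto ((hU y hy0).sub (hU x hx)).abs (hn.mono fun n hn => hn y hy)
    refine ⟨δ, hδ, fun y hy => (hUδ y hy).trans (by linarith), ?_⟩
    have hx' := ((hU x hx).sub_const (U x)).abs
    rw [sub_self, abs_zero] at hx'
    filter_upwards [hn, hx'.eventually (gt_mem_nhds (by positivity : 0 < ε / 3))] with n h1 h2 y hy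
    have e1 := abs_le.1 (h1 y hy)
    have e2 := abs_lt.1 h2
    have e3 := abs_le.1 (hUδ y hy)
    rw [abs_le]
    constructor <;> linarith
  refine ⟨U, fun x hx => ?_, fun K hK hK0 ε hε => ?_⟩
  · refine ContinuousAt.continuousWithinAt (Metric.continuousAt_iff'.2 fun ε hε => ?_)
    obtain ⟨δ, hδ, h1, -⟩ := hloc x hx (ε / 2) (half_pos hε)
    filter_upwards [closedBall_mem_nhds x hδ] with y hy
    exact (h1 y hy).trans_lt (half_lt_self hε)
  · refine hK.induction_on (p := fun S => ∀ᶠ n in l, ∀ x ∈ S, |W n x - U x| ≤ ε) ?_ ?_ ?_ ?_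
    · exact Eventually.of_forall fun n x hx => absurd hx (notMem_empty x)
    · exact fun s t hst ht => ht.mono fun n hn x hx => hn x (hst hx)
    · intro s t hs ht
      filter_upwards [hs, ht] with n h1 h2 x hx
      exact hx.elim (h1 x) (h2 x)
    · intro x hx
      obtain ⟨δ, hδ, -, h2⟩ := hloc x (hK0 hx) ε hε
      exact ⟨closedBall x δ, mem_nhdsWithin_of_mem_nhds (closedBall_mem_nhds x hδ), h2⟩

end AsympHarmonic

/-! ### Blow-up at the singularity -/

/-- A positive solution of the equation with a weak Fuchsian singularity at the origin. -/
structure FuchsSol (p : ℝ) (V : Eu d → ℝ) (Ω : Set (Eu d)) (u : Eu d → ℝ) : Prop where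
  pSol : PSol p Ω u fun x => -V x * u x ^ (p - 1)
  pos : ∀ x ∈ Ω, 0 < u x
  mem : ∀ᶠ x in 𝓝[≠] 0, x ∈ Ω
  small : Tendsto (fun x => ‖x‖ ^ p * V x) (𝓝[≠] 0) (𝓝 0)

lemma eventually_smul_of_isCompact {P : Eu d → Prop} (hP : ∀ᶠ x in 𝓝[≠] 0, P x) {K : Set (Eu d)}
    (hK : IsCompact K) (hK0 : K ⊆ {0}ᶜ) : ∀ᶠ r : ℝ in 𝓝[>] 0, ∀ x ∈ K, P (r • x) := by
  obtain ⟨δ, hδ, hδP⟩ := Metric.mem_nhdsWithin_iff.1 hP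
  obtain ⟨M, hM⟩ := hK.isBounded.exists_norm_le
  have hM1 : 0 < |M| + 1 := by positivity
  filter_upwards [Ioo_mem_nhdsGT (div_pos hδ hM1)] with r hr x hx
  refine hδP ⟨?_, smul_ne_zero hr.1.ne' (hK0 hx)⟩
  rw [mem_ball_zero_iff, norm_smul, Real.norm_of_nonneg hr.1.le]
  have h1 : r * (|M| + 1) < δ := (lt_div_iff₀ hM1).1 hr.2
  have h2 : ‖x‖ ≤ |M| + 1 := (hM x hx).trans ((le_abs_self M).trans (by linarith))
  exact (mul_le_mul_of_nonneg_left h2 hr.1.le).trans_lt h1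

namespace FuchsSol

variable {V u : Eu d → ℝ} {Ω : Set (Eu d)}

lemma eventually_pos (h : FuchsSol p V Ω u) {K : Set (Eu d)} (hK : IsCompact K)
    (hK0 : K ⊆ {0}ᶜ) : ∀ᶠ r : ℝ in 𝓝[>] 0, ∀ x ∈ K, 0 < u (r • x) :=
  eventually_smul_of_isCompact (h.mem.mono h.pos) hK hK0

lemma blowup (hp : 1 < p) (h : FuchsSol p V Ω u) {r : ℝ} (hr : 0 < r) :
    PSol p {x | r • x ∈ Ω} (fun x => u (r • x))
      fun x => -(r ^ p * V (r • x)) * u (r • x) ^ (p - 1) := by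
  have := h.pSol.rescale hp 0 hr
  simp only [zero_add] at this
  exact this.congr_rhs fun x _ => by ring

lemma eventually_potential_le (h : FuchsSol p V Ω u) {K : Set (Eu d)} (hK : IsCompact K)
    (hK0 : K ⊆ {0}ᶜ) {ε : ℝ} (hε : 0 < ε) :
    ∀ᶠ r : ℝ in 𝓝[>] 0, ∀ x ∈ K, ‖x‖ ^ p * |r ^ p * V (r • x)| ≤ ε := by
  have h1 : ∀ᶠ x in 𝓝[≠] 0, |‖x‖ ^ p * V x| < ε := by
    have := h.small.abs
    rw [abs_zero] at this
    exact this.eventually (gt_mem_nhds hε)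
  filter_upwards [eventually_smul_of_isCompact h1 hK hK0, self_mem_nhdsWithin] with r hr hr0 x hx
  have := (hr x hx).le
  rwa [norm_smul, Real.norm_of_nonneg (le_of_lt hr0),
    Real.mul_rpow (le_of_lt hr0) (norm_nonneg x), mul_comm (r ^ p), mul_assoc, abs_mul,
    abs_of_nonneg (Real.rpow_nonneg (norm_nonneg x) p)] at this

/-- Scale invariant Harnack inequality near the origin. -/
lemma local_harnack (hd : 2 ≤ d) (hp : 1 < p) (h : FuchsSol p V Ω u) :
    ∃ C : ℝ, 1 ≤ C ∧ ∀ x : Eu d, x ≠ 0 → ∀ᶠ r : ℝ in 𝓝[>] 0,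
      ∀ y ∈ closedBall x (‖x‖ / 64), ∀ y' ∈ closedBall x (‖x‖ / 64),
        u (r • y) ≤ C * u (r • y') := by
  obtain ⟨C, hC, hH⟩ := exists_harnack hd hp
  refine ⟨C, hC, fun x hx => ?_⟩
  have hx0 : 0 < ‖x‖ := norm_pos_iff.2 hx
  have hlow : ∀ y ∈ closedBall x (‖x‖ / 2), ‖x‖ / 2 ≤ ‖y‖ := by
    intro y hy
    rw [mem_closedBall, dist_comm, dist_eq_norm] at hy
    have := norm_sub_norm_le x y
    linarith
  have hK0 : closedBall x (‖x‖ / 2) ⊆ {0}ᶜ := fun y hy =>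
    norm_pos_iff.1 (lt_of_lt_of_le (half_pos hx0) (hlow y hy))
  have hK := isCompact_closedBall x (‖x‖ / 2)
  filter_upwards [eventually_smul_of_isCompact h.mem hK hK0, self_mem_nhdsWithin,
    h.eventually_potential_le hK hK0 one_pos] with r h1 hr0 h2
  have hsol : PSol p (ball x (‖x‖ / 2)) _ _ :=
    (h.blowup hp hr0).mono isOpen_ball fun y hy => h1 y (ball_subset_closedBall hy)
  have := hH _ _ _ x (‖x‖ / 32) hsol (fun y hy => h.pos _ (h1 y (ball_subset_closedBall hy)))
    (by positivity) (closedBall_subset_ball (by linarith)) fun y hy => by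
      have hy' := ball_subset_closedBall hy
      have hu := Real.rpow_nonneg (h.pos _ (h1 y hy')).le (p - 1)
      have e1 : (‖x‖ / 32) ^ p ≤ ‖y‖ ^ p :=
        Real.rpow_le_rpow (by positivity) (by linarith [hlow y hy']) (by linarith)
      rw [abs_mul, abs_neg, abs_of_nonneg hu, ← mul_assoc]
      refine mul_le_of_le_one_left hu ?_
      exact (mul_le_mul_of_nonneg_right e1 (abs_nonneg _)).trans (h2 y hy')
  rwa [show ‖x‖ / 32 / 2 = ‖x‖ / 64 by ring] at this

lemma exists_bound_point (hd : 2 ≤ d) (hp : 1 < p) (h : FuchsSol p V Ω u) {x y : Eu d}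
    (hx : x ≠ 0) (hy : y ≠ 0) :
    ∃ M : ℝ, 0 < M ∧ ∀ᶠ r : ℝ in 𝓝[>] 0, u (r • x) ≤ M * u (r • y) := by
  obtain ⟨C, hC, hH⟩ := h.local_harnack hd hp
  refine (isPreconnected_compl_zero hd).induction₂' (fun x y => ∃ M : ℝ, 0 < M ∧
    ∀ᶠ r : ℝ in 𝓝[>] 0, u (r • x) ≤ M * u (r • y)) ?_ ?_ hx hy
  · intro x hx
    have hx0 : 0 < ‖x‖ / 64 := div_pos (norm_pos_iff.2 hx) (by norm_num)
    filter_upwards [mem_nhdsWithin_of_mem_nhds (closedBall_mem_nhds x hx0)] with y hy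
    have hxm := mem_closedBall_self hx0.le (x := x)
    exact ⟨⟨C, by linarith, (hH x hx).mono fun r hr => hr x hxm y hy⟩,
      ⟨C, by linarith, (hH x hx).mono fun r hr => hr y hy x hxm⟩⟩
  · rintro x y z - - - ⟨M, hM, h1⟩ ⟨N, hN, h2⟩
    refine ⟨M * N, mul_pos hM hN, ?_⟩
    filter_upwards [h1, h2] with r h1 h2
    rw [mul_assoc]
    exact h1.trans (mul_le_mul_of_nonneg_left h2 hM.le)

lemma exists_bound (hd : 2 ≤ d) (hp : 1 < p) (h : FuchsSol p V Ω u) {e : Eu d} (he : e ≠ 0)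
    {K : Set (Eu d)} (hK : IsCompact K) (hK0 : K ⊆ {0}ᶜ) :
    ∃ M : ℝ, 0 < M ∧ ∀ᶠ r : ℝ in 𝓝[>] 0, ∀ x ∈ K,
      u (r • x) ≤ M * u (r • e) ∧ u (r • e) ≤ M * u (r • x) := by
  obtain ⟨C, hC, hH⟩ := h.local_harnack hd hp
  suffices ∃ M : ℝ, 0 < M ∧ ∀ᶠ r : ℝ in 𝓝[>] 0, ∀ x ∈ K, 0 < u (r • x) →
      0 < u (r • e) → u (r • x) ≤ M * u (r • e) ∧ u (r • e) ≤ M * u (r • x) by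
    obtain ⟨M, hM, h1⟩ := this
    refine ⟨M, hM, ?_⟩
    filter_upwards [h1, h.eventually_pos hK hK0,
      h.eventually_pos isCompact_singleton (singleton_subset_iff.2 he)] with r h1 h2 h3 x hx
    exact h1 x hx (h2 x hx) (h3 e rfl)
  refine hK.induction_on (p := fun K => ∃ M : ℝ, 0 < M ∧ ∀ᶠ r : ℝ in 𝓝[>] 0, ∀ x ∈ K,
    0 < u (r • x) → 0 < u (r • e) → u (r • x) ≤ M * u (r • e) ∧ u (r • e) ≤ M * u (r • x))
    ?_ ?_ ?_ ?_
  · exact ⟨1, one_pos, Eventually.of_forall fun r x hx => absurd hx (notMem_empty x)⟩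
  · rintro s t hst ⟨M, hM, ht⟩
    exact ⟨M, hM, ht.mono fun r hr x hx => hr x (hst hx)⟩
  · rintro s t ⟨M, hM, hs⟩ ⟨N, hN, ht⟩
    refine ⟨M + N, by positivity, ?_⟩
    filter_upwards [hs, ht] with r h1 h2 x hx p1 p2
    rcases hx with hx | hx
    · have := h1 x hx p1 p2
      constructor <;> nlinarith
    · have := h2 x hx p1 p2
      constructor <;> nlinarith
  · intro x hx
    have hx0 : 0 < ‖x‖ / 64 := div_pos (norm_pos_iff.2 (hK0 hx)) (by norm_num)
    obtain ⟨M, hM, h1⟩ := h.exists_bound_point hd hp (hK0 hx) he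
    obtain ⟨N, hN, h2⟩ := h.exists_bound_point hd hp he (hK0 hx)
    refine ⟨closedBall x (‖x‖ / 64),
      mem_nhdsWithin_of_mem_nhds (closedBall_mem_nhds x hx0), C * (M + N), by positivity, ?_⟩
    have hxm := mem_closedBall_self hx0.le (x := x)
    filter_upwards [h1, h2, hH x (hK0 hx)] with r h1 h2 h3 y hy p1 p2
    have e1 := h3 y hy x hxm
    have e2 := h3 x hxm y hy
    have hC0 : 0 < C := by linarith
    constructor
    · calc u (r • y) ≤ C * (M * u (r • e)) := e1.trans (mul_le_mul_of_nonneg_left h1 hC0.le)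
        _ ≤ C * (M + N) * u (r • e) := by
          rw [mul_assoc]
          exact mul_le_mul_of_nonneg_left (by nlinarith) hC0.le
    · calc u (r • e) ≤ N * (C * u (r • y)) := h2.trans (mul_le_mul_of_nonneg_left e2 hN.le)
        _ ≤ C * (M + N) * u (r • y) := by
          have : 0 < C * M * u (r • y) := by positivity
          linarith

/-- The normalized blow-ups of a positive solution are asymptotically `p`-harmonic. -/
lemma asympHarmonic (hd : 2 ≤ d) (hp : 1 < p) (h : FuchsSol p V Ω u) {e : Eu d} (he : e ≠ 0) :
    AsympHarmonic p (𝓝[>] (0 : ℝ)) (fun r x => (u (r • e))⁻¹ * u (r • x))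
      fun r x => (u (r • e))⁻¹ ^ (p - 1) * (-(r ^ p * V (r • x)) * u (r • x) ^ (p - 1)) := by
  have hpe := h.eventually_pos isCompact_singleton (singleton_subset_iff.2 he)
  have hle : ∀ K : Set (Eu d), IsCompact K → K ⊆ {0}ᶜ → ∃ M : ℝ, 0 < M ∧
      ∀ᶠ r : ℝ in 𝓝[>] 0, ∀ x ∈ K, 0 < (u (r • e))⁻¹ * u (r • x) ∧
        (u (r • e))⁻¹ * u (r • x) ≤ M := by
    intro K hK hK0
    obtain ⟨M, hM, h1⟩ := h.exists_bound hd hp he hK hK0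
    refine ⟨M, hM, ?_⟩
    filter_upwards [h1, h.eventually_pos hK hK0, hpe] with r h1 h2 h3 x hx
    refine ⟨mul_pos (inv_pos.2 (h3 e rfl)) (h2 x hx), ?_⟩
    rw [inv_mul_le_iff₀ (h3 e rfl), mul_comm]
    exact (h1 x hx).1
  refine ⟨fun K hK hK0 => ?_, fun K hK hK0 => ?_, fun K hK hK0 ε hε => ?_⟩
  · filter_upwards [eventually_smul_of_isCompact h.mem hK hK0, hpe, self_mem_nhdsWithin]
      with r h1 h2 hr
    exact ⟨_, h1, (h.blowup hp hr).const_mul hp (inv_pos.2 (h2 e rfl)).le⟩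
  · obtain ⟨M, -, h1⟩ := hle K hK hK0
    exact ⟨M, h1.mono fun r hr x hx => by rw [abs_of_pos (hr x hx).1]; exact (hr x hx).2⟩
  · obtain ⟨M, hM, h1⟩ := hle K hK hK0
    obtain ⟨m, hm, hmK⟩ : ∃ m : ℝ, 0 < m ∧ ∀ x ∈ K, m ≤ ‖x‖ := by
      rcases K.eq_empty_or_nonempty with rfl | hne
      · exact ⟨1, one_pos, fun x hx => absurd hx (notMem_empty x)⟩
      · obtain ⟨z, hz, hzm⟩ := hK.exists_isMinOn hne continuous_norm.continuousOn
        exact ⟨‖z‖, norm_pos_iff.2 (hK0 hz), fun x hx => hzm hx⟩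
    have hε' : 0 < ε * m ^ p / M ^ (p - 1) := by positivity
    filter_upwards [h1, h.eventually_pos hK hK0, hpe, h.eventually_potential_le hK hK0 hε']
      with r h1 h2 h3 h4 x hx
    have hu := h2 x hx
    have hv := inv_pos.2 (h3 e rfl)
    have e1 : ((u (r • e))⁻¹ * u (r • x)) ^ (p - 1) ≤ M ^ (p - 1) :=
      Real.rpow_le_rpow (h1 x hx).1.le (h1 x hx).2 (by linarith)
    have e2 : m ^ p * |r ^ p * V (r • x)| ≤ ε * m ^ p / M ^ (p - 1) :=
      (mul_le_mul_of_nonneg_right (Real.rpow_le_rpow hm.le (hmK x hx) (by linarith))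
        (abs_nonneg _)).trans (h4 x hx)
    have e3 : |r ^ p * V (r • x)| * M ^ (p - 1) ≤ ε := by
      rw [le_div_iff₀ (by positivity)] at e2
      refine le_of_mul_le_mul_left (a := m ^ p) ?_ (by positivity)
      linarith
    have e4 : (u (r • e))⁻¹ ^ (p - 1) * (-(r ^ p * V (r • x)) * u (r • x) ^ (p - 1)) =
        -(r ^ p * V (r • x)) * ((u (r • e))⁻¹ * u (r • x)) ^ (p - 1) := by
      rw [Real.mul_rpow hv.le hu.le]; ring
    rw [e4, abs_mul, abs_neg, abs_of_nonneg (Real.rpow_nonneg (h1 x hx).1.le _)]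
    exact (mul_le_mul_of_nonneg_left e1 (abs_nonneg _)).trans e3

lemma sphere_subset_compl_zero : sphere (0 : Eu d) 1 ⊆ {0}ᶜ := fun x hx h => by
  rw [mem_singleton_iff] at h
  rw [h, mem_sphere_zero_iff_norm, norm_zero] at hx
  exact zero_ne_one hx

/-- The blow-ups along an ultrafilter converge to a positive limit, which is a supersolution from
both sides. -/
lemma exists_blowup_limit {ι : Type*} {l : Ultrafilter ι} (hd : 2 ≤ d) (hp : 1 < p)
    (h : FuchsSol p V Ω u) {r : ι → ℝ} (hr : Tendsto r l (𝓝[>] 0)) {e : Eu d} (he : e ≠ 0) :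
    ∃ U : Eu d → ℝ, ContinuousOn U {0}ᶜ ∧ (∀ x, x ≠ 0 → 0 < U x) ∧ IsSuper p U ∧
      (IsSuper p fun x => -U x) ∧ ∀ K : Set (Eu d), IsCompact K → K ⊆ {0}ᶜ →
      ∀ ε : ℝ, 0 < ε → ∀ᶠ n in l, ∀ x ∈ K, |(u (r n • e))⁻¹ * u (r n • x) - U x| ≤ ε := by
  have hA := (h.asympHarmonic hd hp he).comp hr
  obtain ⟨U, hUc, hU⟩ := hA.exists_limit hd hp
  refine ⟨U, hUc, fun x hx => ?_, hA.isSuper hd hp hU, hA.neg.isSuper hd hp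
    fun K hK hK0 ε hε => (hU K hK hK0 ε hε).mono fun n hn x hx => ?_, hU⟩
  · obtain ⟨M, hM, h1⟩ := h.exists_bound_point hd hp he hx
    have hpe := h.eventually_pos isCompact_singleton (singleton_subset_iff.2 he)
    have hM' : 0 < (1 / M) / 2 := by positivity
    obtain ⟨n, ⟨h2, h3⟩, h4⟩ := ((hr.eventually (h1.and hpe)).and
      (hU {x} isCompact_singleton (singleton_subset_iff.2 hx) _ hM')).exists
    have h5 := (abs_le.1 (h4 x rfl)).2
    have h6 : 1 / M ≤ (u (r n • e))⁻¹ * u (r n • x) := by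
      have := h3 e rfl
      rw [div_le_iff₀ hM, ← div_eq_inv_mul, div_mul_eq_mul_div, le_div_iff₀ this]
      linarith
    linarith
  · rw [neg_sub_neg, abs_sub_comm]
    exact hn x hx

/-- Asymptotic spherical symmetry of positive solutions. -/
lemma eventually_ratio_le (hd : 2 ≤ d) (hp : 1 < p) (h : FuchsSol p V Ω u) {ε : ℝ}
    (hε : 0 < ε) : ∀ᶠ r : ℝ in 𝓝[>] 0, ∀ x ∈ sphere (0 : Eu d) 1, ∀ y ∈ sphere (0 : Eu d) 1,
      u (r • x) ≤ (1 + ε) * u (r • y) := by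
  have hS := isCompact_sphere (0 : Eu d) 1
  have hS0 := sphere_subset_compl_zero (d := d)
  have hpos := h.eventually_pos hS hS0
  obtain ⟨e, he⟩ : (sphere (0 : Eu d) 1).Nonempty := by
    have : Nontrivial (Eu d) := Module.nontrivial_of_finrank_pos (R := ℝ)
      (by rw [finrank_euclideanSpace_fin]; omega)
    exact NormedSpace.sphere_nonempty.2 zero_le_one
  set S : Set ℝ := {K | ∀ᶠ r : ℝ in 𝓝[>] 0, ∀ x ∈ sphere (0 : Eu d) 1,
    ∀ y ∈ sphere (0 : Eu d) 1, u (r • x) ≤ K * u (r • y)} with hSdef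
  have hSne : S.Nonempty := by
    obtain ⟨M, hM, h1⟩ := h.exists_bound hd hp (hS0 he) hS hS0
    refine ⟨M * M, h1.mono fun r hr x hx y hy => (hr x hx).1.trans ?_⟩
    rw [mul_assoc]
    exact mul_le_mul_of_nonneg_left (hr y hy).2 hM.le
  have hSge : ∀ K ∈ S, 1 ≤ K := by
    intro K hK
    obtain ⟨r, h1, h2⟩ := (hpos.and hK).exists
    have := h2 e he e he
    exact le_of_mul_le_mul_right (by rwa [one_mul]) (h1 e he)
  have hSb : BddBelow S := ⟨1, hSge⟩
  set q := sInf S with hq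
  have hq1 : 1 ≤ q := le_csInf hSne hSge
  have habove : ∀ K, q < K → K ∈ S := by
    intro K hK
    obtain ⟨K', hK', hlt⟩ := exists_lt_of_csInf_lt hSne hK
    filter_upwards [hK', hpos] with r h1 h2 x hx y hy
    exact (h1 x hx y hy).trans (mul_le_mul_of_nonneg_right hlt.le (h2 y hy).le)
  suffices hq_one : q = 1 from habove _ (by rw [hq_one]; linarith)
  have hseq : ∀ n : ℕ, ∃ r : ℝ, r ∈ Ioo (0 : ℝ) (1 / (n + 1)) ∧ ∃ x ∈ sphere (0 : Eu d) 1,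
      ∃ y ∈ sphere (0 : Eu d) 1, (q - 1 / (n + 1)) * u (r • y) < u (r • x) := by
    intro n
    have hn : (0 : ℝ) < 1 / (n + 1) := by positivity
    have hnot : q - 1 / (n + 1) ∉ S := notMem_of_lt_csInf (by linarith) hSb
    have hfr : ∃ᶠ r : ℝ in 𝓝[>] 0, ¬ ∀ x ∈ sphere (0 : Eu d) 1, ∀ y ∈ sphere (0 : Eu d) 1,
      u (r • x) ≤ (q - 1 / (n + 1)) * u (r • y) := not_eventually.1 hnot
    obtain ⟨r, h1, h2⟩ := (hfr.and_eventually (Ioo_mem_nhdsGT hn)).exists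
    push Not at h1
    exact ⟨r, h2, h1⟩
  choose r hr x hx y hy hxy using hseq
  have hrlim : Tendsto r atTop (𝓝[>] 0) := by
    refine tendsto_nhdsWithin_iff.2 ⟨?_, Eventually.of_forall fun n => (hr n).1⟩
    exact squeeze_zero (fun n => (hr n).1.le) (fun n => (hr n).2.le)
      tendsto_one_div_add_atTop_nhds_zero_nat
  have hl : (hyperfilter ℕ : Filter ℕ) ≤ atTop := Nat.hyperfilter_le_atTop
  obtain ⟨U, hUc, hUpos, hU1, hU2, hU⟩ := h.exists_blowup_limit (l := hyperfilter ℕ) hd hp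
    (hrlim.mono_left hl) (hS0 he)
  have hpe : ∀ᶠ n in (hyperfilter ℕ : Filter ℕ), 0 < (u (r n • e))⁻¹ :=
    ((hrlim.mono_left hl).eventually (hpos.mono fun r hr => inv_pos.2 (hr e he)))
  have hconv : ∀ z : ℕ → Eu d, (∀ n, z n ∈ sphere (0 : Eu d) 1) →
      ∃ a ∈ sphere (0 : Eu d) 1, Tendsto (fun n => (u (r n • e))⁻¹ * u (r n • z n))
        (hyperfilter ℕ) (𝓝 (U a)) := by
    intro z hz
    obtain ⟨a, ha, hza⟩ := hS.ultrafilter_le_nhds' ((hyperfilter ℕ).map z)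
      (Filter.mem_map.2 (univ_mem' hz))
    refine ⟨a, ha, ?_⟩
    have hz' : Tendsto z (hyperfilter ℕ) (𝓝 a) := hza
    have h1 : Tendsto (fun n => U (z n)) (hyperfilter ℕ) (𝓝 (U a)) :=
      (hUc.continuousAt (isOpen_compl_singleton.mem_nhds (hS0 ha))).tendsto.comp hz'
    have h2 : Tendsto (fun n => (u (r n • e))⁻¹ * u (r n • z n) - U (z n)) (hyperfilter ℕ)
        (𝓝 0) := by
      refine Metric.tendsto_nhds.2 fun δ hδ => ?_
      filter_upwards [hU _ hS hS0 _ (half_pos hδ)] with n hn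
      rw [Real.dist_0_eq_abs]
      exact (hn _ (hz n)).trans_lt (half_lt_self hδ)
    simpa using h2.add h1
  obtain ⟨x₂, hx₂, hxlim⟩ := hconv x hx
  obtain ⟨x₁, hx₁, hylim⟩ := hconv y hy
  have hge : q * U x₁ ≤ U x₂ := by
    have hK : Tendsto (fun n : ℕ => q - 1 / ((n : ℝ) + 1)) (hyperfilter ℕ) (𝓝 (q - 0)) :=
      (tendsto_const_nhds.sub tendsto_one_div_add_atTop_nhds_zero_nat).mono_left hl
    rw [sub_zero] at hK
    refine le_of_tendsto_of_tendsto (hK.mul hylim) hxlim (hpe.mono fun n hn => ?_)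
    have := mul_le_mul_of_nonneg_left (hxy n).le hn.le
    show (q - 1 / ((n : ℝ) + 1)) * ((u (r n • e))⁻¹ * u (r n • y n)) ≤ _
    linarith
  have hle : ∀ a b, a ≠ 0 → ‖a‖ = ‖b‖ → U a ≤ q * U b := by
    intro a b ha hab
    have ha0 : 0 < ‖a‖ := norm_pos_iff.2 ha
    have hb0 : b ≠ 0 := norm_pos_iff.1 (hab ▸ ha0)
    have hpt : ∀ z : Eu d, z ≠ 0 → Tendsto (fun n => (u (r n • e))⁻¹ * u (r n • z))
        (hyperfilter ℕ) (𝓝 (U z)) := by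
      intro z hz
      refine Metric.tendsto_nhds.2 fun δ hδ => ?_
      filter_upwards [hU {z} isCompact_singleton (singleton_subset_iff.2 hz) _ (half_pos hδ)]
        with n hn
      rw [Real.dist_eq]
      exact (hn z rfl).trans_lt (half_lt_self hδ)
    have hscale : Tendsto (fun n => r n * ‖a‖) (hyperfilter ℕ) (𝓝[>] 0) := by
      have h1 := (tendsto_nhdsWithin_iff.1 (hrlim.mono_left hl)).1.mul_const ‖a‖
      rw [zero_mul] at h1
      exact tendsto_nhdsWithin_iff.2 ⟨h1, Eventually.of_forall fun n => mul_pos (hr n).1 ha0⟩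
    have hunit : ∀ z : Eu d, ‖a‖ = ‖z‖ → ‖a‖⁻¹ • z ∈ sphere (0 : Eu d) 1 := fun z hz => by
      rw [mem_sphere_zero_iff_norm, norm_smul, norm_inv, norm_norm, ← hz, inv_mul_cancel₀ ha0.ne']
    have hback : ∀ (n : ℕ) (z : Eu d), (r n * ‖a‖) • ‖a‖⁻¹ • z = r n • z := fun n z => by
      rw [smul_smul, mul_assoc, mul_inv_cancel₀ ha0.ne', mul_one]
    have hK : ∀ K, q < K → U a ≤ K * U b := by
      intro K hK
      refine le_of_tendsto_of_tendsto (hpt a ha) ((hpt b hb0).const_mul K) ?_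
      filter_upwards [hpe, hscale.eventually (habove K hK)] with n h1 h2
      have := h2 _ (hunit a rfl) _ (hunit b hab)
      rw [hback, hback] at this
      have := mul_le_mul_of_nonneg_left this h1.le
      linarith
    have hlim : Tendsto (fun K => K * U b) (𝓝[>] q) (𝓝 (q * U b)) :=
      (Continuous.tendsto (by fun_prop) q).mono_left nhdsWithin_le_nhds
    exact ge_of_tendsto hlim (eventually_mem_nhdsWithin.mono hK)
  rw [mem_sphere_zero_iff_norm] at hx₁ hx₂
  exact hU1.ratio_eq_one hd hp hUc hUpos hU2 (by linarith) hle hx₁ hx₂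
    (le_antisymm (hle x₂ x₁ (norm_pos_iff.1 (by rw [hx₂]; exact one_pos)) (hx₂.trans hx₁.symm)) hge)

end FuchsSol

namespace FuchsSol

variable {V u v : Eu d → ℝ} {ρ : ℝ}

lemma eventually_le_of_frequently_lt (hd : 2 ≤ d) (hp : 1 < p)
    (hu : FuchsSol p V (ball 0 ρ \ {0}) u) (hv : FuchsSol p V (ball 0 ρ \ {0}) v) {α β : ℝ}
    (hα : 0 < α) (hαβ : α < β) (hfr : ∃ᶠ x in 𝓝[≠] 0, u x < α * v x) :
    ∀ᶠ x in 𝓝[≠] 0, u x ≤ β * v x := by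
  obtain ⟨ε, hε, hεβ⟩ : ∃ ε : ℝ, 0 < ε ∧ α * (1 + ε) ^ 2 < β := by
    have : Tendsto (fun ε : ℝ => α * (1 + ε) ^ 2) (𝓝[>] 0) (𝓝 (α * (1 + 0) ^ 2)) :=
      (Continuous.tendsto (by fun_prop) 0).mono_left nhdsWithin_le_nhds
    obtain ⟨ε, h1, h2⟩ := ((this.eventually (gt_mem_nhds (by simpa using hαβ))).and
      self_mem_nhdsWithin).exists
    exact ⟨ε, h2, h1⟩
  have hQ : ∃ᶠ r : ℝ in 𝓝[>] 0, 0 < r ∧ r < ρ ∧ ∀ y : Eu d, ‖y‖ = r → u y ≤ β * v y := by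
    have hnorm : Tendsto (fun x : Eu d => ‖x‖) (𝓝[≠] 0) (𝓝[>] 0) := tendsto_norm_nhdsNE_zero
    refine hnorm.frequently ?_
    have h1 := hnorm.eventually
      ((hu.eventually_ratio_le hd hp hε).and (hv.eventually_ratio_le hd hp hε))
    refine (hfr.and_eventually (h1.and hv.mem)).mono ?_
    rintro x ⟨hx, ⟨h1, h2⟩, hxΩ⟩
    have hx0 : 0 < ‖x‖ := norm_pos_iff.2 hxΩ.2
    have hunit : ∀ z : Eu d, ‖z‖ = ‖x‖ → ‖x‖⁻¹ • z ∈ sphere (0 : Eu d) 1 := fun z hz => by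
      rw [mem_sphere_zero_iff_norm, norm_smul, norm_inv, norm_norm, hz, inv_mul_cancel₀ hx0.ne']
    have hback : ∀ z : Eu d, ‖x‖ • ‖x‖⁻¹ • z = z := fun z => by
      rw [smul_smul, mul_inv_cancel₀ hx0.ne', one_smul]
    have hxρ : ‖x‖ < ρ := mem_ball_zero_iff.1 hxΩ.1
    refine ⟨hx0, hxρ, fun y hy => ?_⟩
    have e1 := h1 _ (hunit y hy) _ (hunit x rfl)
    have e2 := h2 _ (hunit x rfl) _ (hunit y hy)
    rw [hback, hback] at e1 e2
    have hy' : 0 < v y := hv.pos y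
      ⟨mem_ball_zero_iff.2 (hy.trans_lt hxρ), norm_pos_iff.1 (hy ▸ hx0)⟩
    calc u y ≤ (1 + ε) * (α * v x) := e1.trans (by gcongr)
      _ ≤ (1 + ε) * (α * ((1 + ε) * v y)) := by gcongr
      _ = α * (1 + ε) ^ 2 * v y := by ring
      _ ≤ β * v y := by gcongr
  obtain ⟨r₂, hr2, hr2ρ, h2⟩ := hQ.exists
  filter_upwards [self_mem_nhdsWithin, mem_nhdsWithin_of_mem_nhds (ball_mem_nhds 0 hr2)]
    with x hx0 hx2
  rw [mem_ball_zero_iff] at hx2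
  obtain ⟨r₁, ⟨hr1, -, h1⟩, hr1x⟩ := (hQ.and_eventually
    (Ioo_mem_nhdsGT (norm_pos_iff.2 hx0))).exists
  obtain ⟨hc, hsub⟩ := isCompact_closure_annulus (d := d) r₁ r₂
  refine picone_comparison (by omega) hp hu.pSol hv.pSol hu.pos hv.pos (isOpen_annulus r₁ r₂) hc
    (fun y hy => ⟨mem_ball_zero_iff.2 ((hsub hy).2.trans_lt hr2ρ),
      norm_pos_iff.1 (hr1.trans_le (hsub hy).1)⟩) (hα.trans hαβ) (fun y hy => ?_) x ⟨hr1x.2, hx2⟩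
  exact (norm_eq_of_mem_frontier_annulus hy).elim (h1 y) (h2 y)

/-- The quotient of two positive solutions has a limit at the singularity. -/
lemma exists_tendsto_div (hd : 2 ≤ d) (hp : 1 < p)
    (hu : FuchsSol p V (ball 0 ρ \ {0}) u) (hv : FuchsSol p V (ball 0 ρ \ {0}) v) :
    ∃ l : ℝ≥0∞, Tendsto (fun x => ENNReal.ofReal (u x / v x)) (𝓝[≠] 0) (𝓝 l) := by
  refine tendsto_of_no_upcrossings dense_univ ?_
  rintro a - b - hab ⟨ha, hb⟩
  obtain ⟨c, hac, hcb⟩ := exists_between hab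
  lift a to NNReal using hac.ne_top
  lift c to NNReal using hcb.ne_top
  have ha0 : 0 < a := by
    obtain ⟨x, hx⟩ := ha.exists
    exact_mod_cast pos_of_gt hx
  have hev := hu.eventually_le_of_frequently_lt hd hp hv (α := a) (β := c)
    (by exact_mod_cast ha0) (by exact_mod_cast hac)
    ((ha.and_eventually (hv.mem.mono hv.pos)).mono fun x ⟨h1, h2⟩ => by
      rw [← ENNReal.ofReal_coe_nnreal, ENNReal.ofReal_lt_ofReal_iff (by exact_mod_cast ha0)] at h1
      exact (div_lt_iff₀ h2).1 h1)
  refine hb (hev.and (hv.mem.mono hv.pos) |>.mono fun x ⟨h1, h2⟩ => not_lt.2 ?_)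
  refine le_trans ?_ hcb.le
  rw [← ENNReal.ofReal_coe_nnreal]
  exact ENNReal.ofReal_le_ofReal ((div_le_iff₀ h2).2 h1)

end FuchsSol

end

theorem stmt13 (d : ℕ) (hd : 2 ≤ d) (p : ℝ) (hp : 1 < p) (ρ : ℝ) (hρ : 0 < ρ)
    (V : EuclideanSpace ℝ (Fin d) → ℝ) (hVmeas : Measurable V)
    (hVcont : ContinuousOn (fun x : EuclideanSpace ℝ (Fin d) => ‖x‖ ^ p * V x)
      (ball (0 : EuclideanSpace ℝ (Fin d)) ρ \ {0}))
    (hVlim : Tendsto (fun x : EuclideanSpace ℝ (Fin d) => ‖x‖ ^ p * V x)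
      (𝓝[ball (0 : EuclideanSpace ℝ (Fin d)) ρ \ {0}] 0) (𝓝 0))
    (u v : EuclideanSpace ℝ (Fin d) → ℝ)
    (hu : IsPosWeakSol p V (ball (0 : EuclideanSpace ℝ (Fin d)) ρ \ {0}) u)
    (hv : IsPosWeakSol p V (ball (0 : EuclideanSpace ℝ (Fin d)) ρ \ {0}) v) :
    ∃ l : ℝ≥0∞, Tendsto (fun x => ENNReal.ofReal (u x / v x))
      (𝓝[ball (0 : EuclideanSpace ℝ (Fin d)) ρ \ {0}] 0) (𝓝 l) := by
  have hΩ : IsOpen (ball (0 : EuclideanSpace ℝ (Fin d)) ρ \ {0}) :=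
    isOpen_ball.sdiff isClosed_singleton
  have hnhds : 𝓝[ball (0 : EuclideanSpace ℝ (Fin d)) ρ \ {0}] 0 = 𝓝[≠] 0 := by
    rw [sdiff_eq]
    exact nhdsWithin_inter_of_mem (mem_nhdsWithin_of_mem_nhds (ball_mem_nhds 0 hρ))
  have hV : ContinuousOn V (ball (0 : EuclideanSpace ℝ (Fin d)) ρ \ {0}) := by
    have hn : ContinuousOn (fun x : EuclideanSpace ℝ (Fin d) => (‖x‖ ^ p)⁻¹)
        (ball (0 : EuclideanSpace ℝ (Fin d)) ρ \ {0}) := by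
      refine ContinuousOn.inv₀ (continuous_norm.continuousOn.rpow_const fun x _ =>
        Or.inr (by linarith)) fun x hx => ?_
      exact (Real.rpow_pos_of_pos (norm_pos_iff.2 hx.2) p).ne'
    refine (hn.mul hVcont).congr fun x hx => ?_
    rw [Pi.mul_apply, inv_mul_cancel_left₀ (Real.rpow_pos_of_pos (norm_pos_iff.2 hx.2) p).ne']
  rw [hnhds] at hVlim ⊢
  have hmem : ∀ᶠ x in 𝓝[≠] 0, x ∈ ball (0 : EuclideanSpace ℝ (Fin d)) ρ \ {0} := by
    rw [← hnhds]; exact self_mem_nhdsWithin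
  have hF : ∀ w, IsPosWeakSol p V (ball (0 : EuclideanSpace ℝ (Fin d)) ρ \ {0}) w →
      FuchsSol p V (ball 0 ρ \ {0}) w := fun w hw =>
    ⟨hw.pSol hp hΩ hV, hw.2.1, hmem, hVlim⟩
  exact (hF u hu).exists_tendsto_div hd hp (hF v hv)
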